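/- arXiv:2207.03015 — 9 statements merged into one kernel-verified Lean document; each statement's English description precedes it below -/
import Mathlib

section
/- Let p > 10^6 be prime. Then every p-core p'-partition λ satisfies |λ| < (1/24)p^6 − (1/200)p^5·√p. -/
/-- The hook length of the cell `(i, j)` of a Young diagram: one plus the number of
cells strictly to the right in row `i` plus the number of cells strictly below in
column `j`. -/
def YoungDiagram.hookLength (μ : YoungDiagram) (i j : ℕ) : ℕ :=
  (μ.rowLen i - j) + (μ.colLen j - i) - 1

namespace MaxPcore
open Finset

/-- gaps below x -/
def mcGap (X : Finset ℕ) (x : ℕ) : ℕ := #{y ∈ range x | y ∉ X}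

/-- gaps in row k -/
def mcRow (p : ℕ) (X : Finset ℕ) (k : ℕ) : ℕ := #{r ∈ range p | k * p + r ∉ X}

theorem mcGap_add (X : Finset ℕ) (a r : ℕ) :
    mcGap X (a + r) = mcGap X a + #{s ∈ range r | a + s ∉ X} := by
  induction r with
  | zero => simp
  | succ r ih =>
    unfold mcGap at *
    rw [← add_assoc, range_add_one, filter_insert, range_add_one, filter_insert]
    split_ifs with h
    · exact ih
    · rw [card_insert_of_notMem (by simp), card_insert_of_notMem (by simp), ih]; omega

theorem mcGap_row (p : ℕ) (X : Finset ℕ) (k : ℕ) :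
    mcGap X (k * p) = ∑ j ∈ range k, mcRow p X j := by
  induction k with
  | zero => simp [mcGap]
  | succ k ih =>
    rw [sum_range_succ, ← ih, Nat.succ_mul, mcGap_add]; rfl

theorem mc_numlemma (p : ℕ) (hp : p.Prime) (a c : ℕ) (ha : 1 ≤ a) (hap : a < p) :
    ∃ i < p, p ∣ c + i * a := by
  have := Fact.mk hp
  have ha0 : (a : ZMod p) ≠ 0 := by
    rw [Ne, ZMod.natCast_eq_zero_iff]
    intro h; exact absurd (Nat.le_of_dvd ha h) (by omega)
  refine ⟨(-(c : ZMod p) / a).val, ZMod.val_lt _, ?_⟩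
  rw [← ZMod.natCast_eq_zero_iff]
  push_cast
  rw [ZMod.natCast_zmod_val]
  field_simp
  ring

theorem mc_numlemma2 (p : ℕ) (hp : p.Prime) (a N N' P m m' : ℕ) (ha : 1 ≤ a) (hap : a + 1 < p)
    (hm : m' = m ∨ m' = m + 1)
    (h1 : ∀ i < N, ¬ p ∣ P + i * a + m)
    (h2 : ∀ i < N', ¬ p ∣ P + N * a + i * (a + 1) + m') (W : ℕ)
    (hW : 2 * p ≤ W + N + N') :
    ∃ w u : ℕ, 1 ≤ w ∧ w ≤ W ∧ u ≤ w ∧ p ∣ a * w + u := by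
  obtain ⟨i, hi, hd⟩ := mc_numlemma p hp a (P + m) ha (by omega)
  obtain ⟨j, hj, hd'⟩ := mc_numlemma p hp (a+1) (P + N * a + m') (by omega) (by omega)
  have hiN : N ≤ i := by
    by_contra h
    exact h1 i (by omega) (by convert hd using 1; ring)
  have hjN : N' ≤ j := by
    by_contra h
    exact h2 j (by omega) (by convert hd' using 1; ring)
  obtain ⟨v, rfl⟩ := Nat.exists_eq_add_of_le hiN
  obtain ⟨u, rfl⟩ := Nat.exists_eq_add_of_lt hj
  refine ⟨u + 1 + v, if m' = m then u + 1 else u, by omega, by omega, by split_ifs <;> omega, ?_⟩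
  rw [← Int.natCast_dvd_natCast, Nat.cast_add _ (ite _ _ _)]
  zify at hd hd'
  have e : ((a:ℤ) * (u + 1 + v) + (if m' = m then u + 1 else u : ℤ)) =
     (j + u + 1 : ℤ) * (a + 1) + (P + m + (N + v) * a) - (P + N * a + m' + j * (a + 1)) := by
    rcases hm with h | h <;> subst h <;> simp <;> ring
  have e2 : ((if m' = m then u + 1 else u : ℕ) : ℤ) = (if m' = m then u + 1 else u : ℤ) := by
    split_ifs <;> simp
  rw [e2]
  push_cast
  rw [e]
  exact dvd_sub (dvd_add (Dvd.intro _ rfl) hd) hd'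

section
variable (p : ℕ) (X : Finset ℕ)

theorem mcRow_mono (hc : ∀ x ∈ X, p ≤ x → x - p ∈ X) : Monotone (mcRow p X) := by
  apply monotone_nat_of_le_succ
  intro k
  apply card_le_card
  intro r hr
  simp only [mem_filter] at hr ⊢
  refine ⟨hr.1, fun h => hr.2 ?_⟩
  have := hc _ h (by rw [Nat.succ_mul]; omega)
  convert this using 1
  rw [Nat.succ_mul]; omega

theorem mcMem_anti (hc : ∀ x ∈ X, p ≤ x → x - p ∈ X) (r k l : ℕ) (hkl : k ≤ l)
    (h : l * p + r ∈ X) : k * p + r ∈ X := by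
  induction l, hkl using Nat.le_induction with
  | base => exact h
  | succ l hl ih =>
    apply ih
    have := hc _ h (by rw [Nat.succ_mul]; omega)
    convert this using 1
    rw [Nat.succ_mul]; omega

theorem mcRow_le (k : ℕ) : mcRow p X k ≤ p := by
  simpa [mcRow] using card_filter_le (range p) (fun r => k * p + r ∉ X)

theorem mcRow_pos (hp : 0 < p) (hc : ∀ x ∈ X, p ≤ x → x - p ∈ X)
    (hr : ∀ x ∈ X, ¬ p ∣ mcGap X x) (k : ℕ) : 1 ≤ mcRow p X k := by
  apply card_pos.2
  refine ⟨0, ?_⟩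
  simp only [mem_filter, mem_range]
  refine ⟨hp, fun h => ?_⟩
  have := mcMem_anti p X hc 0 0 k (by omega) h
  exact hr _ this (by simp [mcGap])

theorem mcRow_card (k : ℕ) : #{r ∈ range p | k * p + r ∈ X} + mcRow p X k = p := by
  have := card_filter_add_card_filter_not (s := range p) (fun r => k * p + r ∈ X)
  simpa [mcRow] using this

/-- same row count implies same gaps -/
theorem mcRow_eq (hc : ∀ x ∈ X, p ≤ x → x - p ∈ X) (k l : ℕ) (hkl : k ≤ l)
    (h : mcRow p X k = mcRow p X l) (r : ℕ) (hr : r < p) (hk : k * p + r ∈ X) : l * p + r ∈ X := by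
  have hs : ({r ∈ range p | k * p + r ∉ X} : Finset ℕ) ⊆ {r ∈ range p | l * p + r ∉ X} := by
    intro s hs
    simp only [mem_filter] at hs ⊢
    exact ⟨hs.1, fun h' => hs.2 (mcMem_anti p X hc s k l hkl h')⟩
  have := eq_of_subset_of_card_le hs (le_of_eq h.symm)
  by_contra hcon
  have h2 : r ∈ ({r ∈ range p | l * p + r ∉ X} : Finset ℕ) := by simp [hr, hcon]
  rw [← this] at h2
  simp at h2
  exact h2.2 hk

/-- number of rows with fewer than a gaps -/
def mcT (K a : ℕ) : ℕ := #{k ∈ range K | mcRow p X k < a}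

def mcN (K a : ℕ) : ℕ := #{k ∈ range K | mcRow p X k = a}

theorem mcT_succ (K a : ℕ) : mcT p X K (a + 1) = mcT p X K a + mcN p X K a := by
  unfold mcT mcN
  rw [← card_union_of_disjoint, ← filter_or]
  · congr 1; ext k; simp only [mem_filter]
    constructor <;> rintro ⟨h, h'⟩ <;> exact ⟨h, by omega⟩
  · rw [disjoint_filter]; intros; omega

theorem mcT_iff (hc : ∀ x ∈ X, p ≤ x → x - p ∈ X) (K a : ℕ) (k : ℕ) :
    k < mcT p X K a ↔ k < K ∧ mcRow p X k < a := by
  have hm := mcRow_mono p X hc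
  constructor
  · intro h
    by_contra hcon
    have : ({k ∈ range K | mcRow p X k < a} : Finset ℕ) ⊆ range k := by
      intro l hl
      simp only [mem_filter, mem_range] at hl ⊢
      by_contra hlk
      exact hcon ⟨by omega, lt_of_le_of_lt (hm (by omega)) hl.2⟩
    have := card_le_card this
    rw [card_range] at this
    unfold mcT at h; omega
  · rintro ⟨h1, h2⟩
    have : range (k + 1) ⊆ ({k ∈ range K | mcRow p X k < a} : Finset ℕ) := by
      intro l hl
      simp only [mem_filter, mem_range] at hl ⊢
      exact ⟨by omega, lt_of_le_of_lt (hm (by omega)) h2⟩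
    have := card_le_card this
    rw [card_range] at this
    exact this

theorem mcRow_T (hc : ∀ x ∈ X, p ≤ x → x - p ∈ X) (K a i : ℕ) (hi : i < mcN p X K a) :
    mcRow p X (mcT p X K a + i) = a := by
  have h1 := mcT_iff p X hc K a (mcT p X K a + i)
  have h2 := mcT_iff p X hc K (a + 1) (mcT p X K a + i)
  rw [mcT_succ] at h2
  have h3 := h2.1 (by omega)
  by_contra h
  have := h1.2 ⟨h3.1, by omega⟩
  omega

theorem mcGap_T (hc : ∀ x ∈ X, p ≤ x → x - p ∈ X) (K a i : ℕ) (hi : i ≤ mcN p X K a) :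
    mcGap X ((mcT p X K a + i) * p) = mcGap X (mcT p X K a * p) + i * a := by
  induction i with
  | zero => simp
  | succ i ih =>
    rw [mcGap_row, ← add_assoc, sum_range_succ, ← mcGap_row, ih (by omega),
      mcRow_T p X hc K a i (by omega)]
    ring

/-- bead in level a: avoid residues -/
theorem mc_avoid (hc : ∀ x ∈ X, p ≤ x → x - p ∈ X)
    (hr : ∀ x ∈ X, ¬ p ∣ mcGap X x) (K a r : ℕ) (hrp : r < p)
    (hX : mcT p X K a * p + r ∈ X) (i : ℕ) (hi : i < mcN p X K a) :
    ¬ p ∣ mcGap X (mcT p X K a * p) + i * a + #{s ∈ range r | mcT p X K a * p + s ∉ X} := by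
  have e : mcRow p X (mcT p X K a) = mcRow p X (mcT p X K a + i) := by
    rw [mcRow_T p X hc K a i hi]
    exact mcRow_T p X hc K a 0 (by omega)
  have hx := mcRow_eq p X hc _ _ (by omega) e r hrp hX
  have := hr _ hx
  rw [mcGap_add, mcGap_T p X hc K a i (by omega)] at this
  convert this using 4
  ext s
  simp only [mem_filter, mem_range]
  refine and_congr_right fun hs => not_congr ⟨fun h => ?_, fun h => ?_⟩
  · exact mcRow_eq p X hc _ _ (by omega) e s (by omega) h
  · exact mcMem_anti p X hc s _ _ (by omega) h

theorem mc_exists_bead (k : ℕ) (h : mcRow p X k < p) : ∃ r < p, k * p + r ∈ X := by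
  have := mcRow_card p X k
  have h2 : 0 < #{r ∈ range p | k * p + r ∈ X} := by omega
  obtain ⟨r, hr⟩ := card_pos.1 h2
  simp at hr
  exact ⟨r, hr⟩

theorem mcN_lt (hp : p.Prime) (hc : ∀ x ∈ X, p ≤ x → x - p ∈ X)
    (hr : ∀ x ∈ X, ¬ p ∣ mcGap X x) (K a : ℕ) (ha : 1 ≤ a) (hap : a < p) : mcN p X K a < p := by
  rcases Nat.eq_zero_or_pos (mcN p X K a) with h | h
  · rw [h]; exact hp.pos
  have e := mcRow_T p X hc K a 0 h
  obtain ⟨r, hrp, hX⟩ := mc_exists_bead p X _ (by rw [e]; exact hap)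
  have := mc_avoid p X hc hr K a r hrp hX
  by_contra hcon
  obtain ⟨i, hi, hd⟩ := mc_numlemma p hp a (mcGap X (mcT p X K a * p) +
    #{s ∈ range r | mcT p X K a * p + s ∉ X}) ha hap
  exact this i (by omega) (by convert hd using 1; ring)

theorem mc_bad (hp : p.Prime) (hc : ∀ x ∈ X, p ≤ x → x - p ∈ X)
    (hr : ∀ x ∈ X, ¬ p ∣ mcGap X x) (K a : ℕ) (ha : 1 ≤ a) (hap : a + 1 < p) (W : ℕ) (hWp : W < p)
    (hW : 2 * p ≤ W + mcN p X K a + mcN p X K (a + 1)) :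
    ∃ w u : ℕ, 1 ≤ w ∧ w ≤ W ∧ u ≤ w ∧ p ∣ a * w + u := by
  have l1 := mcN_lt p X hp hc hr K a ha (by omega)
  have l2 := mcN_lt p X hp hc hr K (a + 1) (by omega) hap
  have e1 : mcRow p X (mcT p X K a) = a := mcRow_T p X hc K a 0 (by omega)
  have e2 : mcRow p X (mcT p X K (a + 1)) = a + 1 := mcRow_T p X hc K (a + 1) 0 (by omega)
  obtain ⟨r, hrp, hX⟩ := mc_exists_bead p X _ (by rw [e2]; exact hap)
  have hT : mcT p X K a ≤ mcT p X K (a + 1) := by rw [mcT_succ]; omega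
  have hX1 := mcMem_anti p X hc r _ _ hT hX
  have a1 := mc_avoid p X hc hr K a r hrp hX1
  have a2 := mc_avoid p X hc hr K (a + 1) r hrp hX
  have hG : mcGap X (mcT p X K (a + 1) * p) = mcGap X (mcT p X K a * p) + mcN p X K a * a := by
    rw [mcT_succ, mcGap_T p X hc K a _ le_rfl]
  rw [hG] at a2
  refine mc_numlemma2 p hp a _ _ _ _ _ ha hap ?_ a1 a2 W hW
  -- counts before r differ by at most one
  set A := mcT p X K a
  set B := mcT p X K (a + 1)
  have c1 : #{s ∈ range r | A * p + s ∉ X} ≤ #{s ∈ range r | B * p + s ∉ X} := by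
    apply card_le_card
    intro s hs
    simp only [mem_filter] at hs ⊢
    exact ⟨hs.1, fun h' => hs.2 (mcMem_anti p X hc s _ _ hT h')⟩
  have key : ∀ k, mcRow p X k = #{s ∈ range r | k * p + s ∉ X} + #{s ∈ Ico r p | k * p + s ∉ X} := by
    intro k
    unfold mcRow
    rw [← card_union_of_disjoint, ← filter_union]
    · congr 2
      ext s; simp only [mem_union, mem_range, mem_Ico]; omega
    · apply disjoint_filter_filter
      rw [disjoint_left]; intro s; simp only [mem_range, mem_Ico]; omega
  have c2 : #{s ∈ Ico r p | A * p + s ∉ X} ≤ #{s ∈ Ico r p | B * p + s ∉ X} := by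
    apply card_le_card
    intro s hs
    simp only [mem_filter] at hs ⊢
    exact ⟨hs.1, fun h' => hs.2 (mcMem_anti p X hc s _ _ hT h')⟩
  have k1 := key A
  have k2 := key B
  omega

/-- the number of bad levels -/
theorem mc_bad_card (hp : p.Prime) (hc : ∀ x ∈ X, p ≤ x → x - p ∈ X)
    (hr : ∀ x ∈ X, ¬ p ∣ mcGap X x) (K W : ℕ) (hWp : W < p) :
    #{a ∈ Ico 1 (p - 1) | 2 * p ≤ W + mcN p X K a + mcN p X K (a + 1)} ≤ W * (W + 1) := by
  have H : ∀ a ∈ ({a ∈ Ico 1 (p - 1) | 2 * p ≤ W + mcN p X K a + mcN p X K (a + 1)} : Finset ℕ),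
      ∃ q : ℕ × ℕ, 1 ≤ q.1 ∧ q.1 ≤ W ∧ q.2 ≤ q.1 ∧ p ∣ a * q.1 + q.2 := by
    intro a ha
    simp only [mem_filter, mem_Ico] at ha
    obtain ⟨w, u, h⟩ := mc_bad p X hp hc hr K a (by omega) (by omega) W hWp ha.2
    exact ⟨(w, u), h⟩
  choose! f hf using H
  have := card_le_card_of_injOn
    (s := {a ∈ Ico 1 (p - 1) | 2 * p ≤ W + mcN p X K a + mcN p X K (a + 1)}) (t := (Icc 1 W) ×ˢ (range (W + 1))) f ?_ ?_
  · simpa using this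
  · intro a ha
    obtain ⟨h1, h2, h3, -⟩ := hf a ha
    simp only [coe_product, Set.mem_prod, mem_coe, mem_Icc, mem_range]
    omega
  · intro a ha b hb hab
    obtain ⟨h1, h2, h3, h4⟩ := hf a ha
    obtain ⟨-, -, -, h4'⟩ := hf b hb
    rw [← hab] at h4'
    simp only [coe_filter, mem_Ico, Set.mem_ofPred_eq] at ha hb
    zify at h4 h4'
    have hd : (p : ℤ) ∣ ((a : ℤ) - b) * (f a).1 := by
      have h5 := dvd_sub h4 h4'
      have h6 : ((a : ℤ) - b) * (f a).1 =
        (a * (f a).1 + (f a).2 : ℤ) - (b * (f a).1 + (f a).2 : ℤ) := by ring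
      rw [h6]; exact h5
    rcases (Nat.prime_iff_prime_int.1 hp).dvd_or_dvd hd with h | h
    · have := Int.eq_zero_of_abs_lt_dvd h (by rw [abs_lt]; omega)
      omega
    · have := Int.le_of_dvd (by omega) h
      omega
end

theorem mc_sum_blocks (p : ℕ) (f : ℕ → ℕ) (K : ℕ) :
    ∑ x ∈ range (K * p), f x = ∑ k ∈ range K, ∑ r ∈ range p, f (k * p + r) := by
  induction K with
  | zero => simp
  | succ K ih => rw [Nat.succ_mul, sum_range_add, sum_range_succ, ih]

theorem mc_size (p : ℕ) (X : Finset ℕ) (K : ℕ) (hK : X ⊆ range (K * p)) :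
    ((∑ x ∈ X, mcGap X x : ℕ) : ℝ) ≤ ∑ k ∈ range K, ((p : ℝ) - mcRow p X k) *
      ∑ j ∈ range (k + 1), (mcRow p X j : ℝ) := by
  have h1 : ∑ x ∈ X, mcGap X x = ∑ x ∈ range (K * p), if x ∈ X then mcGap X x else 0 := by
    rw [← sum_filter]
    congr 1
    ext x
    simp only [mem_filter]
    exact ⟨fun h => ⟨hK h, h⟩, fun h => h.2⟩
  rw [h1, mc_sum_blocks]
  push_cast
  refine sum_le_sum fun k _ => ?_
  have h2 : ((p : ℝ) - mcRow p X k) = (#{r ∈ range p | k * p + r ∈ X} : ℕ) := by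
    have := mcRow_card p X k
    rw [sub_eq_iff_eq_add]
    exact_mod_cast this.symm
  have h3 : ∑ j ∈ range (k + 1), (mcRow p X j : ℝ) = (mcGap X ((k + 1) * p) : ℕ) := by
    rw [mcGap_row]; push_cast; rfl
  rw [h2, h3]
  norm_cast
  rw [← sum_filter, ← smul_eq_mul (#_)]
  apply sum_le_card_nsmul
  intro r hr
  simp only [mem_filter, mem_range] at hr
  unfold mcGap
  apply card_le_card
  apply filter_subset_filter
  intro y
  simp only [mem_range]
  have : (k + 1) * p = k * p + p := by ring
  omega

/-- Green kernel -/
noncomputable def mcKer (p a c : ℝ) : ℝ := min a c * (p - max a c)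

theorem mc_double (f : ℕ → ℕ → ℝ) (hf : ∀ j k, f j k = f k j) (K : ℕ) :
    2 * ∑ k ∈ range K, ∑ j ∈ range (k + 1), f j k =
      ∑ k ∈ range K, ∑ j ∈ range K, f j k + ∑ k ∈ range K, f k k := by
  induction K with
  | zero => simp
  | succ K ih =>
    rw [sum_range_succ, mul_add, ih]
    simp only [sum_range_succ, sum_add_distrib]
    have : ∑ k ∈ range K, f K k = ∑ k ∈ range K, f k K := sum_congr rfl fun k _ => hf _ _
    rw [this]; ring

theorem mc_ker_sum (p c : ℕ) (hc : c ≤ p) :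
    ∑ a ∈ range (p + 1), mcKer p a c = p * c * (p - c) / 2 := by
  have h1 : ∀ m, m ≤ c → ∑ a ∈ range m, mcKer p a c = m * (m - 1) / 2 * (p - c) := by
    intro m
    induction m with
    | zero => simp
    | succ m ih =>
      intro hm
      have : (m : ℝ) ≤ c := by exact_mod_cast (by omega : m ≤ c)
      rw [sum_range_succ, ih (by omega), mcKer, min_eq_left this, max_eq_right this]
      push_cast; ring
  have h2 : ∀ m, c ≤ m → ∑ a ∈ range m, mcKer p a c =
      c * (c - 1) / 2 * (p - c) + c * ((m - c) * (2 * p - c - m + 1)) / 2 := by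
    intro m hm
    induction m, hm using Nat.le_induction with
    | base => rw [h1 c le_rfl]; ring
    | succ m hm ih =>
      have : (c : ℝ) ≤ m := by exact_mod_cast hm
      rw [sum_range_succ, ih, mcKer, min_eq_right this, max_eq_left this]
      push_cast; ring
  rw [h2 (p + 1) (by omega)]
  push_cast; ring

theorem mc_q_sum (n : ℕ) (p : ℝ) : ∑ a ∈ range (n + 1), (a : ℝ) * (p - a) =
    p * (n * (n + 1)) / 2 - n * (n + 1) * (2 * n + 1) / 6 := by
  induction n with
  | zero => simp
  | succ n ih => rw [sum_range_succ, ih]; push_cast; ring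

theorem mc_fiber (p : ℕ) (X : Finset ℕ) (K : ℕ) (F : ℕ → ℝ) :
    ∑ j ∈ range K, F (mcRow p X j) = ∑ a ∈ range (p + 1), (mcN p X K a : ℝ) * F a := by
  rw [← sum_fiberwise_of_maps_to (t := range (p + 1)) (g := mcRow p X)
    (fun j _ => by have := mcRow_le p X j; simp only [mem_range]; omega)]
  refine sum_congr rfl fun a _ => ?_
  rw [mcN, ← nsmul_eq_mul]
  apply sum_eq_card_nsmul
  intro j hj
  rw [(mem_filter.1 hj).2]

theorem mc_quad (p : ℕ) (hp : p.Prime) (X : Finset ℕ) (hc : ∀ x ∈ X, p ≤ x → x - p ∈ X)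
    (hr : ∀ x ∈ X, ¬ p ∣ mcGap X x) (K : ℕ) (hK : X ⊆ range (K * p)) :
    ((∑ x ∈ X, mcGap X x : ℕ) : ℝ) ≤
      ((p : ℝ) ^ 2 / 4 + 1 / 2) * ∑ a ∈ range (p + 1), (mcN p X K a : ℝ) * (a * (p - a)) := by
  refine (mc_size p X K hK).trans ?_
  have hm := mcRow_mono p X hc
  have hd := mc_double (fun j k => mcKer p (mcRow p X j) (mcRow p X k))
    (fun j k => by simp only [mcKer, min_comm, max_comm]) K
  have e1 : ∑ k ∈ range K, ∑ j ∈ range (k + 1), mcKer p (mcRow p X j) (mcRow p X k)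
      = ∑ k ∈ range K, ((p : ℝ) - mcRow p X k) * ∑ j ∈ range (k + 1), (mcRow p X j : ℝ) := by
    refine sum_congr rfl fun k _ => ?_
    rw [mul_sum]
    refine sum_congr rfl fun j hj => ?_
    have : (mcRow p X j : ℝ) ≤ mcRow p X k := by
      exact_mod_cast hm (by simp only [mem_range] at hj; omega)
    rw [mcKer, min_eq_left this, max_eq_right this]; ring
  have e2 : ∑ k ∈ range K, mcKer p (mcRow p X k) (mcRow p X k) =
      ∑ a ∈ range (p + 1), (mcN p X K a : ℝ) * (a * (p - a)) := by
    rw [← mc_fiber p X K (fun a => (a : ℝ) * (p - a))]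
    simp [mcKer]
  have e3 : ∑ k ∈ range K, ∑ j ∈ range K, mcKer p (mcRow p X j) (mcRow p X k) ≤
      (p : ℝ) ^ 2 / 2 * ∑ a ∈ range (p + 1), (mcN p X K a : ℝ) * (a * (p - a)) := by
    rw [← mc_fiber p X K (fun a => (a : ℝ) * (p - a)), mul_sum]
    refine sum_le_sum fun k _ => ?_
    have hle := mcRow_le p X k
    rw [mc_fiber p X K (fun a => mcKer p a (mcRow p X k))]
    have : ∑ a ∈ range (p + 1), (mcN p X K a : ℝ) * mcKer p a (mcRow p X k) ≤
        ∑ a ∈ range (p + 1), (p : ℝ) * mcKer p a (mcRow p X k) := by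
      refine sum_le_sum fun a ha => ?_
      have hle' : (mcRow p X k : ℝ) ≤ p := by exact_mod_cast hle
      have h0 : (0 : ℝ) ≤ mcRow p X k := by positivity
      simp only [mem_range] at ha
      rcases Nat.eq_zero_or_pos a with h | h
      · subst h; simp [mcKer]
      rcases Nat.lt_or_ge a p with h' | h'
      · have hl := mcN_lt p X hp hc hr K a h h'
        apply mul_le_mul_of_nonneg_right
        · exact_mod_cast hl.le
        · have h1 : (a : ℝ) ≤ p := by exact_mod_cast h'.le
          have h2 : (0 : ℝ) ≤ a := by positivity
          exact mul_nonneg (le_min h2 h0) (sub_nonneg.2 (max_le h1 hle'))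
      · have : a = p := by omega
        subst this
        simp [mcKer, max_eq_left hle']
    refine this.trans (le_of_eq ?_)
    rw [← mul_sum, mc_ker_sum p _ hle]; ring
  rw [← e1]
  rw [e2] at hd
  linarith

theorem mc_D (p : ℕ) (hp : p.Prime) (X : Finset ℕ) (hc : ∀ x ∈ X, p ≤ x → x - p ∈ X)
    (hr : ∀ x ∈ X, ¬ p ∣ mcGap X x) (K W : ℕ) (hWp : W < p) :
    ((W : ℝ) + 1) * (((p - 1 : ℝ) ^ 3 - (p - 1)) / 6 - W * (W + 1) * ((p : ℝ) ^ 2 / 4)) ≤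
      2 * ∑ a ∈ range (p + 1), ((p : ℝ) - mcN p X K a) * (a * (p - a)) := by
  have hp2 := hp.two_le
  set F : ℕ → ℝ := fun a => ((p : ℝ) - mcN p X K a) * (a * (p - a)) with hF
  have hs : ∀ a, 1 ≤ a → a < p → (0 : ℝ) ≤ (p : ℝ) - mcN p X K a := by
    intro a h1 h2
    have := (mcN_lt p X hp hc hr K a h1 h2).le
    rw [sub_nonneg]; exact_mod_cast this
  have hF0 : ∀ a ∈ range (p + 1), 0 ≤ F a := by
    intro a ha
    simp only [mem_range] at ha
    rcases Nat.eq_zero_or_pos a with h | h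
    · subst h; simp [hF]
    rcases Nat.lt_or_ge a p with h' | h'
    · have h1 : (a : ℝ) ≤ p := by exact_mod_cast h'.le
      exact mul_nonneg (hs a h h') (mul_nonneg (by positivity) (sub_nonneg.2 h1))
    · have : a = p := by omega
      subst this; simp [hF]
  have d1 : ∑ a ∈ Ico 1 (p - 1), F a ≤ ∑ a ∈ range (p + 1), F a := by
    apply sum_le_sum_of_subset_of_nonneg
    · intro a; simp only [mem_Ico, mem_range]; omega
    · intro a ha _; exact hF0 a ha
  have d2 : ∑ a ∈ Ico 1 (p - 1), F (a + 1) ≤ ∑ a ∈ range (p + 1), F a := by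
    rw [sum_Ico_add' F 1 (p - 1) 1]
    apply sum_le_sum_of_subset_of_nonneg
    · intro a; simp only [mem_Ico, mem_range]; omega
    · intro a ha _; exact hF0 a ha
  have d3 : ∑ a ∈ Ico 1 (p - 1), (((W : ℝ) + 1) * (a * ((p - 1 : ℝ) - a)) -
      if 2 * p ≤ W + mcN p X K a + mcN p X K (a + 1) then ((W : ℝ) + 1) * ((p : ℝ) ^ 2 / 4) else 0)
      ≤ ∑ a ∈ Ico 1 (p - 1), (F a + F (a + 1)) := by
    refine sum_le_sum fun a ha => ?_
    simp only [mem_Ico] at ha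
    have s1 := hs a (by omega) (by omega)
    have s2 := hs (a + 1) (by omega) (by omega)
    have ha0 : (0 : ℝ) ≤ a := by positivity
    have hap : (a : ℝ) ≤ p - 1 := by
      have : a + 1 ≤ p := by omega
      have : (a : ℝ) + 1 ≤ p := by exact_mod_cast this
      linarith
    have hc0 : (0 : ℝ) ≤ a * ((p - 1 : ℝ) - a) := mul_nonneg ha0 (by linarith)
    have hge : (((p : ℝ) - mcN p X K a) + ((p : ℝ) - mcN p X K (a + 1))) * (a * ((p - 1 : ℝ) - a))
        ≤ F a + F (a + 1) := by
      rw [add_mul]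
      apply add_le_add
      · apply mul_le_mul_of_nonneg_left _ s1
        nlinarith
      · apply mul_le_mul_of_nonneg_left _ s2
        push_cast
        nlinarith
    split_ifs with h
    · have hup : (a : ℝ) * ((p - 1 : ℝ) - a) ≤ (p : ℝ) ^ 2 / 4 := by
        nlinarith [sq_nonneg ((p : ℝ) - 2 * a)]
      have hW0 : (0 : ℝ) ≤ W := by positivity
      have : (0 : ℝ) ≤ (((p : ℝ) - mcN p X K a) + ((p : ℝ) - mcN p X K (a + 1))) *
        (a * ((p - 1 : ℝ) - a)) := mul_nonneg (by linarith) hc0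
      have : ((W : ℝ) + 1) * (a * ((p - 1 : ℝ) - a)) ≤ ((W : ℝ) + 1) * ((p : ℝ) ^ 2 / 4) :=
        mul_le_mul_of_nonneg_left hup (by linarith)
      linarith
    · rw [sub_zero]
      refine le_trans (mul_le_mul_of_nonneg_right ?_ hc0) hge
      have : W + mcN p X K a + mcN p X K (a + 1) + 1 ≤ 2 * p := by omega
      have : (W : ℝ) + mcN p X K a + mcN p X K (a + 1) + 1 ≤ 2 * p := by exact_mod_cast this
      linarith
  rw [sum_add_distrib, sum_sub_distrib, ← mul_sum, ← sum_filter, sum_const, nsmul_eq_mul] at d3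
  have hb := mc_bad_card p X hp hc hr K W hWp
  have hb' : (#{a ∈ Ico 1 (p - 1) | 2 * p ≤ W + mcN p X K a + mcN p X K (a + 1)} : ℝ) ≤
      W * (W + 1) := by exact_mod_cast hb
  have hsum : ∑ a ∈ Ico 1 (p - 1), (a : ℝ) * ((p - 1 : ℝ) - a) =
      ((p - 1 : ℝ) ^ 3 - (p - 1)) / 6 := by
    have h := mc_q_sum (p - 1) (p - 1 : ℝ)
    rw [sum_range_succ, range_eq_Ico, sum_eq_sum_Ico_succ_bot (by omega : 0 < p - 1),
      Nat.cast_sub (by omega : 1 ≤ p)] at h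
    simp only [Nat.cast_zero, zero_mul, Nat.cast_one, sub_self, mul_zero, add_zero, zero_add] at h
    rw [h]; ring
  rw [hsum] at d3
  have := mul_le_mul_of_nonneg_right hb' (by positivity : (0 : ℝ) ≤ ((W : ℝ) + 1) * ((p : ℝ) ^ 2 / 4))
  nlinarith

theorem mc_final (p : ℕ) (hp : p.Prime) (hp6 : 10 ^ 6 < p) (X : Finset ℕ)
    (hc : ∀ x ∈ X, p ≤ x → x - p ∈ X) (hr : ∀ x ∈ X, ¬ p ∣ mcGap X x) :
    ((∑ x ∈ X, mcGap X x : ℕ) : ℝ) <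
      (1 / 24 : ℝ) * (p : ℝ) ^ 6 - (1 / 200 : ℝ) * (p : ℝ) ^ 5 * Real.sqrt p := by
  obtain ⟨K, hK⟩ : ∃ K, X ⊆ range (K * p) := by
    refine ⟨X.sup id + 1, fun x hx => ?_⟩
    have h1 : x ≤ X.sup id := le_sup (f := id) hx
    have h2 := hp.pos
    simp only [mem_range]
    nlinarith
  set r := Real.sqrt p with hrdef
  have hr2 : r ^ 2 = p := Real.sq_sqrt (by positivity)
  have hpR : (10 : ℝ) ^ 6 < p := by exact_mod_cast hp6
  have hr1 : 1000 < r := by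
    rw [hrdef]; apply Real.lt_sqrt_of_sq_lt; linarith
  have q := mc_quad p hp X hc hr K hK
  set W := ⌊r / 2⌋₊ with hWd
  have hW1 : (W : ℝ) ≤ r / 2 := Nat.floor_le (by linarith)
  have hW2 : r / 2 < W + 1 := Nat.lt_floor_add_one _
  have hWp : W < p := by
    have : (W : ℝ) < p := by rw [← hr2]; nlinarith
    exact_mod_cast this
  have d := mc_D p hp X hc hr K W hWp
  have e : ∑ a ∈ range (p + 1), (mcN p X K a : ℝ) * (a * (p - a)) =
      (p : ℝ) ^ 2 * (p ^ 2 - 1) / 6 -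
        ∑ a ∈ range (p + 1), ((p : ℝ) - mcN p X K a) * (a * (p - a)) := by
    simp only [sub_mul (p : ℝ) (mcN p X K _ : ℝ)]
    rw [sum_sub_distrib, ← mul_sum, mc_q_sum]
    ring
  rw [e] at q
  set D := ∑ a ∈ range (p + 1), ((p : ℝ) - mcN p X K a) * (a * (p - a))
  rw [← hr2] at q d ⊢
  have hW0 : (0 : ℝ) ≤ W := by positivity
  have hbad : (W : ℝ) * (W + 1) ≤ r ^ 2 / 4 + r / 2 := by nlinarith
  have hB : r ^ 6 / 10 ≤ ((r ^ 2 - 1) ^ 3 - (r ^ 2 - 1)) / 6 - W * (W + 1) * ((r ^ 2) ^ 2 / 4) := by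
    have h1 : (W : ℝ) * (W + 1) * ((r ^ 2) ^ 2 / 4) ≤ (r ^ 2 / 4 + r / 2) * ((r ^ 2) ^ 2 / 4) :=
      mul_le_mul_of_nonneg_right hbad (by positivity)
    have h2 : 0 ≤ r ^ 5 * (r - 1000) := mul_nonneg (by positivity) (by linarith)
    have h3 : 0 ≤ r ^ 4 * (r - 1000) := mul_nonneg (by positivity) (by linarith)
    have h4 : 0 ≤ r ^ 4 := by positivity
    have h5 : 0 ≤ r ^ 2 := by positivity
    nlinarith
  have hD : r ^ 7 / 40 ≤ D := by
    have : r / 2 * (r ^ 6 / 10) ≤ 2 * D :=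
      (mul_le_mul hW2.le hB (by positivity) (by linarith)).trans d
    nlinarith
  refine lt_of_le_of_lt q ?_
  have h1 : ((r ^ 2) ^ 2 / 4 + 1 / 2) * (r ^ 7 / 40) ≤ ((r ^ 2) ^ 2 / 4 + 1 / 2) * D :=
    mul_le_mul_of_nonneg_left hD (by positivity)
  have h2 : 0 < r ^ 10 * (r - 1000) := mul_pos (by positivity) (by linarith)
  have h3 : 0 < r ^ 9 * (r - 1000) := mul_pos (by positivity) (by linarith)
  have h4 : 0 < r ^ 8 * (r - 1000) := mul_pos (by positivity) (by linarith)
  have h7 : 0 < r ^ 7 := by positivity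
  have h5 : 0 < r ^ 4 := by positivity
  have h6 : 0 < r ^ 8 := by positivity
  nlinarith

/-- beta numbers -/
def mcBeta (μ : YoungDiagram) (i : ℕ) : ℕ := μ.rowLen i + (μ.colLen 0 - 1 - i)

def mcX (μ : YoungDiagram) : Finset ℕ := (range (μ.colLen 0)).image (mcBeta μ)

theorem mcBeta_lt (μ : YoungDiagram) (i j : ℕ) (hij : i < j) (hj : j < μ.colLen 0) :
    mcBeta μ j < mcBeta μ i := by
  have := μ.rowLen_anti i j hij.le
  unfold mcBeta; omega

theorem mc_rowcol (μ : YoungDiagram) (i j : ℕ) : j < μ.rowLen i ↔ i < μ.colLen j := by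
  rw [← YoungDiagram.mem_iff_lt_rowLen, YoungDiagram.mem_iff_lt_colLen]

theorem mcBeta_inj (μ : YoungDiagram) : Set.InjOn (mcBeta μ) (range (μ.colLen 0)) := by
  intro i hi j hj h
  simp only [coe_range, Set.mem_Iio] at hi hj
  rcases lt_trichotomy i j with h' | h' | h'
  · have := mcBeta_lt μ i j h' hj; omega
  · exact h'
  · have := mcBeta_lt μ j i h' hi; omega

theorem mc_gap_beta (μ : YoungDiagram) (i : ℕ) (hi : i < μ.colLen 0) :
    mcGap (mcX μ) (mcBeta μ i) = μ.rowLen i := by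
  have h := card_filter_add_card_filter_not (s := range (mcBeta μ i)) (fun r => r ∈ mcX μ)
  have e : ({r ∈ range (mcBeta μ i) | r ∈ mcX μ} : Finset ℕ)
      = (Ioo i (μ.colLen 0)).image (mcBeta μ) := by
    ext y
    simp only [mem_filter, mem_range, mcX, mem_image, mem_Ioo]
    constructor
    · rintro ⟨h1, j, hj, rfl⟩
      refine ⟨j, ⟨?_, hj⟩, rfl⟩
      by_contra hji
      rcases Nat.lt_or_eq_of_le (not_lt.1 hji) with h' | h'
      · have := mcBeta_lt μ j i h' hi; omega
      · subst h'; omega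
    · rintro ⟨j, ⟨h1, h2⟩, rfl⟩
      exact ⟨mcBeta_lt μ i j h1 h2, j, h2, rfl⟩
  rw [e, card_image_of_injOn, card_range, Nat.card_Ioo] at h
  · unfold mcGap
    unfold mcBeta at h ⊢
    omega
  · apply (mcBeta_inj μ).mono
    intro j hj
    simp at hj ⊢
    exact hj.2

theorem mc_card (μ : YoungDiagram) : μ.card = ∑ i ∈ range (μ.colLen 0), μ.rowLen i := by
  have : μ.card = ∑ i ∈ range (μ.colLen 0), #{c ∈ μ.cells | c.1 = i} := by
    apply card_eq_sum_card_fiberwise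
    rintro ⟨i, j⟩ h
    simp only [coe_range, Set.mem_Iio]
    rw [← YoungDiagram.mem_iff_lt_colLen]
    exact μ.up_left_mem le_rfl (Nat.zero_le j) ((YoungDiagram.mem_cells _).1 h)
  rw [this]
  refine sum_congr rfl fun i _ => ?_
  rw [YoungDiagram.rowLen_eq_card]; rfl

theorem mc_sum (μ : YoungDiagram) : μ.card = ∑ x ∈ mcX μ, mcGap (mcX μ) x := by
  rw [mc_card, mcX, sum_image (mcBeta_inj μ)]
  refine sum_congr rfl fun i hi => ?_
  exact (mc_gap_beta μ i (mem_range.1 hi)).symm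

theorem mc_reg (p : ℕ) (μ : YoungDiagram) (hreg : ∀ r ∈ μ.rowLens, ¬ p ∣ r) :
    ∀ x ∈ mcX μ, ¬ p ∣ mcGap (mcX μ) x := by
  intro x hx
  simp only [mcX, mem_image, mem_range] at hx
  obtain ⟨i, hi, rfl⟩ := hx
  rw [mc_gap_beta μ i hi]
  apply hreg
  simp only [YoungDiagram.rowLens, List.mem_map, List.mem_range]
  exact ⟨i, hi, rfl⟩

theorem mc_gap_form (μ : YoungDiagram) (y : ℕ) (hy : y ∉ mcX μ) :
    ∃ j, y + μ.colLen j = j + μ.colLen 0 := by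
  have hex : ∃ j, y + μ.colLen j ≤ j + μ.colLen 0 :=
    ⟨y, by have := μ.colLen_anti 0 y (Nat.zero_le _); omega⟩
  classical
  have h1 := Nat.find_spec hex
  have h2 : ∀ m, m < Nat.find hex → _ := fun m hm => Nat.find_min hex hm
  set j := Nat.find hex
  refine ⟨j, le_antisymm h1 ?_⟩
  by_contra hlt
  apply hy
  rcases Nat.eq_zero_or_pos j with hj | hj
  · rw [hj] at hlt; omega
  have h3 := h2 (j - 1) (by omega)
  have h4 := μ.colLen_anti 0 (j - 1) (Nat.zero_le _)
  obtain ⟨i, hi⟩ : ∃ i, i + y + 1 = μ.colLen 0 + j := ⟨μ.colLen 0 + j - y - 1, by omega⟩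
  have r1 := mc_rowcol μ i j
  have r2 := mc_rowcol μ i (j - 1)
  have r3 : μ.rowLen i = j := by omega
  have hi0 : i < μ.colLen 0 := by omega
  simp only [mcX, mem_image, mem_range]
  refine ⟨i, hi0, ?_⟩
  unfold mcBeta; omega

theorem mc_core (p : ℕ) (hp : 0 < p) (μ : YoungDiagram)
    (hcore : ∀ c ∈ μ.cells, ¬ p ∣ μ.hookLength c.1 c.2) :
    ∀ x ∈ mcX μ, p ≤ x → x - p ∈ mcX μ := by
  intro x hx hpx
  by_contra hcon
  simp only [mcX, mem_image, mem_range] at hx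
  obtain ⟨i, hi, rfl⟩ := hx
  obtain ⟨j, hj⟩ := mc_gap_form μ _ hcon
  have r := mc_rowcol μ i j
  have hb : mcBeta μ i = μ.rowLen i + (μ.colLen 0 - 1 - i) := rfl
  have hlt : j < μ.rowLen i := by
    by_contra h
    have : ¬ i < μ.colLen j := fun h' => h (r.2 h')
    omega
  refine hcore (i, j) ?_ ?_
  · rw [YoungDiagram.mem_cells]; exact YoungDiagram.mem_iff_lt_rowLen.2 hlt
  · have h2 := r.1 hlt
    have : μ.hookLength i j = p := by unfold YoungDiagram.hookLength; omega
    simp [this]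

end MaxPcore

/-- Every `p`-core `p'`-partition `μ` for a prime `p > 10^6` satisfies
`|μ| < p^6/24 - p^5·√p/200`. -/
theorem max_pcore_pprime_upper_bound (p : ℕ) (hp : p.Prime) (hp6 : 10 ^ 6 < p)
    (μ : YoungDiagram)
    (hcore : ∀ c ∈ μ.cells, ¬ p ∣ μ.hookLength c.1 c.2)
    (hreg : ∀ r ∈ μ.rowLens, ¬ p ∣ r) :
    (μ.card : ℝ) < (1 / 24 : ℝ) * (p : ℝ) ^ 6 - (1 / 200 : ℝ) * (p : ℝ) ^ 5 * Real.sqrt p := by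
  rw [MaxPcore.mc_sum]
  exact MaxPcore.mc_final p hp hp6 (MaxPcore.mcX μ) (MaxPcore.mc_core p hp.pos μ hcore)
    (MaxPcore.mc_reg p μ hreg)
end

section
/- Let p > 10^6 be prime. Then there exists a p-core p'-partition λ with |λ| > (1/24)p^6 − p^5·√p. -/
lemma count_compl (P : ℕ → Prop) [DecidablePred P] (n : ℕ) :
    Nat.count P n + Nat.count (fun x => ¬ P x) n = n := by
  induction n with
  | zero => simp
  | succ n ih =>
    rw [Nat.count_succ, Nat.count_succ]
    by_cases h : P n <;> simp [h] <;> omega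

lemma exists_young (p : ℕ) (X : Finset ℕ)
    (hX : ∀ x ∈ X, p ≤ x → x - p ∈ X)
    (hc : ∀ x ∈ X, ¬ p ∣ Nat.count (fun y => ¬ y ∈ X) x) :
    ∃ μ : YoungDiagram, (∀ c ∈ μ.cells, ¬ p ∣ μ.hookLength c.1 c.2) ∧
      (∀ r ∈ μ.rowLens, ¬ p ∣ r) ∧ μ.card = ∑ x ∈ X, Nat.count (fun y => ¬ y ∈ X) x := by
  classical
  have hfin : (Set.ofPred (fun y => y ∈ X)).Finite := X.finite_toSet
  have hcard : hfin.toFinset.card = X.card := by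
    congr 1; ext x; simp
  have hinf : (Set.ofPred (fun y => ¬ y ∈ X)).Infinite := by
    have := X.finite_toSet.infinite_compl
    convert this using 1
    ext x; simp
  set n := X.card with hn
  set B : ℕ → ℕ := fun m => Nat.nth (fun y => y ∈ X) m with hB
  set Y : ℕ → ℕ := fun j => Nat.nth (fun y => ¬ y ∈ X) j with hY
  have hBmem : ∀ m < n, B m ∈ X := fun m hm => Nat.nth_mem_of_lt_card hfin (by rw [hcard]; exact hm)
  have hBcount : ∀ m < n, Nat.count (fun y => y ∈ X) (B m) = m := fun m hm =>
    Nat.count_nth_of_lt_card_finite hfin (by rw [hcard]; exact hm)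
  have hBmono : ∀ m m', m ≤ m' → m' < n → B m ≤ B m' := fun m m' h h' =>
    Nat.nth_le_nth_of_lt_card hfin h (by rw [hcard]; exact h')
  have hYmem : ∀ j, Y j ∉ X := fun j => Nat.nth_mem_of_infinite hinf j
  have hYcount : ∀ j, Nat.count (fun y => ¬ y ∈ X) (Y j) = j := fun j =>
    Nat.count_nth_of_infinite hinf j
  have hYlt : ∀ j x, Y j < x ↔ j < Nat.count (fun y => ¬ y ∈ X) x := by
    intro j x
    have := Nat.count_le_iff_le_nth hinf (a := x) (b := j)
    simp only [hY]; omega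
  have hYmono : Monotone Y := Nat.nth_monotone hinf
  -- row lengths
  let rl : ℕ → ℕ := fun i => if i < n then Nat.count (fun y => ¬ y ∈ X) (B (n - 1 - i)) else 0
  have hrl : ∀ i i', i ≤ i' → rl i' ≤ rl i := by
    intro i i' h
    simp only [rl]
    split_ifs with h1 h2
    · exact Nat.count_monotone _ (hBmono _ _ (by omega) (by omega))
    · omega
    · omega
    · omega
  let μ : YoungDiagram :=
    { cells := (Finset.range n).sigma (fun i => Finset.range (rl i)) |>.image (fun s => (s.1, s.2))
      isLowerSet := by
        rintro ⟨i, j⟩ ⟨i', j'⟩ hle hm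
        simp only [Finset.coe_image, Set.mem_image, Finset.mem_coe, Finset.mem_sigma,
          Finset.mem_range, Sigma.exists, Prod.mk.injEq] at hm ⊢
        obtain ⟨a, b, ⟨h1, h2⟩, rfl, rfl⟩ := hm
        have h3 : i' ≤ a := hle.1
        have h4 : j' ≤ b := hle.2
        exact ⟨i', j', ⟨by omega, by have := hrl _ _ h3; omega⟩, rfl, rfl⟩ }
  have hmem : ∀ i j, (i, j) ∈ μ ↔ j < rl i := by
    intro i j
    rw [← YoungDiagram.mem_cells]
    simp only [μ, Finset.mem_image, Finset.mem_sigma, Finset.mem_range, Sigma.exists,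
      Prod.mk.injEq]
    constructor
    · rintro ⟨a, b, ⟨h1, h2⟩, rfl, rfl⟩; exact h2
    · intro h
      refine ⟨i, j, ⟨?_, h⟩, rfl, rfl⟩
      by_contra hh
      simp only [rl, if_neg hh] at h
      omega
  have hmem' : ∀ i j, (i, j) ∈ μ ↔ i < n ∧ Y j < B (n - 1 - i) := by
    intro i j
    rw [hmem]
    simp only [rl]
    split_ifs with h
    · rw [hYlt]; simp [h]
    · simp [h]
  have hrow : ∀ i, μ.rowLen i = rl i := by
    intro i
    apply le_antisymm
    · by_contra h
      push Not at h
      have := (hmem i (rl i)).1 (YoungDiagram.mem_iff_lt_rowLen.2 h)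
      omega
    · by_contra h
      push Not at h
      have := YoungDiagram.mem_iff_lt_rowLen.1 ((hmem i (μ.rowLen i)).2 h)
      omega
  -- column
  have hcol : ∀ j, μ.colLen j = n - Nat.count (fun y => y ∈ X) (Y j) := by
    intro j
    have key : ∀ i, i < μ.colLen j ↔ i < n - Nat.count (fun y => y ∈ X) (Y j) := by
      intro i
      rw [← YoungDiagram.mem_iff_lt_colLen, hmem']
      constructor
      · rintro ⟨h1, h2⟩
        have h3 : Nat.count (fun y => y ∈ X) (Y j) ≤ Nat.count (fun y => y ∈ X) (B (n - 1 - i)) :=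
          Nat.count_monotone _ h2.le
        rw [hBcount _ (by omega)] at h3
        omega
      · intro h
        refine ⟨by omega, ?_⟩
        by_contra hh
        push Not at hh
        have h0 : B (n - 1 - i) ∈ X := hBmem _ (by omega)
        have hne : B (n - 1 - i) ≠ Y j := fun e => hYmem j (e ▸ h0)
        have h3 := Nat.count_strict_mono (p := fun y => y ∈ X) h0 (lt_of_le_of_ne hh hne)
        rw [hBcount _ (by omega)] at h3
        omega
    apply le_antisymm
    · by_contra h
      push Not at h
      have := (key _).1 h; omega
    · by_contra h
      push Not at h
      have := (key _).2 h; omega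
  refine ⟨μ, ?_, ?_, ?_⟩
  · rintro ⟨i, j⟩ hm
    have hm' := (hmem' i j).1 ((YoungDiagram.mem_cells _).1 hm)
    obtain ⟨h1, h2⟩ := hm'
    have e1 := count_compl (fun y => y ∈ X) (B (n - 1 - i))
    have e2 := count_compl (fun y => y ∈ X) (Y j)
    have e3 := hBcount (n - 1 - i) (by omega)
    have e4 := hYcount j
    have e5 := (hYlt j _).1 h2
    have e6 := YoungDiagram.mem_iff_lt_colLen.1 ((YoungDiagram.mem_cells _).1 hm)
    have hook : μ.hookLength i j = B (n - 1 - i) - Y j := by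
      unfold YoungDiagram.hookLength
      rw [hcol] at e6 ⊢
      rw [hrow]
      simp only [rl, if_pos h1]
      omega
    show ¬ p ∣ μ.hookLength i j
    rw [hook]
    rintro ⟨m, hm⟩
    have claim : ∀ m x, x ∈ X → p * m ≤ x → x - p * m ∈ X := by
      intro m
      induction m with
      | zero => intro x hx _; simpa using hx
      | succ m ih =>
        intro x hx hle
        rw [Nat.mul_succ] at hle ⊢
        have := hX _ (ih x hx (by omega)) (by omega)
        rwa [Nat.sub_sub] at this
    have := claim m _ (hBmem (n - 1 - i) (by omega)) (by omega)
    rw [show B (n - 1 - i) - p * m = Y j by omega] at this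
    exact hYmem j this
  · intro r hr
    obtain ⟨k, hk, rfl⟩ := List.getElem_of_mem hr
    have hpos := μ.pos_of_mem_rowLens _ hr
    have : μ.rowLens[k] = rl k := by
      rw [← hrow]; exact YoungDiagram.get_rowLens
    rw [this] at hpos ⊢
    by_cases h : k < n
    · simp only [rl, if_pos h]
      exact hc _ (hBmem _ (by omega))
    · simp only [rl, if_neg h] at hpos; omega
  · have h1 : μ.card = ∑ i ∈ Finset.range n, rl i := by
      show (Finset.image _ _).card = _
      rw [Finset.card_image_of_injOn]
      · simp
      · rintro ⟨a, b⟩ _ ⟨c, d⟩ _ h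
        simp only [Prod.mk.injEq] at h
        obtain ⟨rfl, rfl⟩ := h
        rfl
    rw [h1]
    refine Finset.sum_bij (fun i _ => B (n - 1 - i)) ?_ ?_ ?_ ?_
    · intro i hi
      exact hBmem _ (by simp at hi; omega)
    · intro i hi i' hi' h
      simp at hi hi'
      have h1 := hBcount (n - 1 - i) (by omega)
      have h2 := hBcount (n - 1 - i') (by omega)
      rw [h] at h1
      omega
    · intro x hx
      have hlt : Nat.count (fun y => y ∈ X) x < n := by
        rw [← hcard]; exact Nat.count_lt_card hfin hx
      refine ⟨n - 1 - Nat.count (fun y => y ∈ X) x, by simp; omega, ?_⟩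
      rw [show n - 1 - (n - 1 - Nat.count (fun y => y ∈ X) x) = Nat.count (fun y => y ∈ X) x by omega]
      exact Nat.nth_count (p := fun y => y ∈ X) hx
    · intro i hi
      simp at hi
      simp only [rl, if_pos hi]
lemma count_interval (a e n : ℕ) (h : a ≤ e) :
    Nat.count (fun i => ¬ (a ≤ i ∧ i < e)) n = min n a + (n - e) := by
  induction n with
  | zero => simp
  | succ n ih =>
    rw [Nat.count_succ, ih]
    split_ifs <;> omega

lemma exists_rows (p T : ℕ) (hp : 0 < p) (a b : ℕ → ℕ) (ha : Monotone a) (hb : Monotone b)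
    (hab : ∀ t < T, a t + b t ≤ p)
    (h : ∀ t < T, ¬ p ∣ (∑ s ∈ Finset.range t, (a s + b s)) + a t) :
    ∃ μ : YoungDiagram, (∀ c ∈ μ.cells, ¬ p ∣ μ.hookLength c.1 c.2) ∧
      (∀ r ∈ μ.rowLens, ¬ p ∣ r) ∧
      μ.card = ∑ t ∈ Finset.range T,
        (p - (a t + b t)) * ((∑ s ∈ Finset.range t, (a s + b s)) + a t) := by
  classical
  set X : Finset ℕ := (Finset.range (p * T)).filter
    (fun x => a (x / p) ≤ x % p ∧ x % p < p - b (x / p)) with hXdef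
  have hmem : ∀ x, x ∈ X ↔ x / p < T ∧ a (x / p) ≤ x % p ∧ x % p < p - b (x / p) := by
    intro x
    rw [hXdef, Finset.mem_filter, Finset.mem_range, Nat.div_lt_iff_lt_mul hp, mul_comm]
  have hdm : ∀ t i, i < p → (p * t + i) / p = t ∧ (p * t + i) % p = i := by
    intro t i hi
    constructor
    · rw [Nat.mul_add_div hp, Nat.div_eq_of_lt hi, add_zero]
    · rw [Nat.mul_add_mod, Nat.mod_eq_of_lt hi]
  have hmem' : ∀ t i, i < p → (p * t + i ∈ X ↔ t < T ∧ a t ≤ i ∧ i < p - b t) := by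
    intro t i hi
    rw [hmem, (hdm t i hi).1, (hdm t i hi).2]
  have hrow : ∀ t < T, ∀ n ≤ p, Nat.count (fun i => ¬ (p * t + i ∈ X)) n
      = min n (a t) + (n - (p - b t)) := by
    intro t ht n hn
    rw [← count_interval (a t) (p - b t) n (by have := hab t ht; omega)]
    rw [Nat.count_eq_card_filter_range, Nat.count_eq_card_filter_range]
    congr 1
    apply Finset.filter_congr
    intro i hi
    rw [Finset.mem_range] at hi
    rw [hmem' t i (by omega)]
    simp [ht]
  have hcnt0 : ∀ t ≤ T, Nat.count (fun y => ¬ y ∈ X) (p * t)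
      = ∑ s ∈ Finset.range t, (a s + b s) := by
    intro t
    induction t with
    | zero => simp
    | succ t ih =>
      intro ht
      rw [Finset.sum_range_succ, Nat.mul_succ, Nat.count_add, ih (by omega),
        hrow t (by omega) p le_rfl]
      have := hab t (by omega)
      omega
  have hcnt : ∀ t < T, ∀ i, a t ≤ i → i < p - b t → Nat.count (fun y => ¬ y ∈ X) (p * t + i)
      = (∑ s ∈ Finset.range t, (a s + b s)) + a t := by
    intro t ht i h1 h2
    rw [Nat.count_add, hcnt0 t ht.le, hrow t ht i (by omega)]
    omega
  obtain ⟨μ, h1, h2, h3⟩ := exists_young p X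
    (by
      intro x hx hpx
      rw [hmem] at hx ⊢
      have e1 := Nat.div_eq_sub_div hp hpx
      have e2 : (x - p) % p = x % p := (Nat.mod_eq_sub_mod hpx).symm
      rw [e2]
      rw [e1] at hx
      generalize (x - p) / p = k at hx ⊢
      generalize x % p = l at hx ⊢
      have := ha (Nat.le_add_right k 1)
      have := hb (Nat.le_add_right k 1)
      omega)
    (by
      intro x hx
      have hx' := (hmem x).1 hx
      have := hcnt (x / p) hx'.1 (x % p) hx'.2.1 hx'.2.2
      rw [Nat.div_add_mod] at this
      rw [this]
      exact h _ hx'.1)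
  refine ⟨μ, h1, h2, ?_⟩
  rw [h3]
  have key : ∀ t ≤ T, ∑ x ∈ Finset.range (p * t), (if x ∈ X then Nat.count (fun y => ¬ y ∈ X) x else 0)
      = ∑ t ∈ Finset.range t,
        (p - (a t + b t)) * ((∑ s ∈ Finset.range t, (a s + b s)) + a t) := by
    intro t
    induction t with
    | zero => simp
    | succ t ih =>
      intro ht
      rw [Finset.sum_range_succ, Nat.mul_succ, Finset.sum_range_add, ih (by omega)]
      congr 1
      have : ∀ i ∈ Finset.range p, (if p * t + i ∈ X then
          Nat.count (fun y => ¬ y ∈ X) (p * t + i) else 0) =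
          if i ∈ Finset.Ico (a t) (p - b t) then
            ((∑ s ∈ Finset.range t, (a s + b s)) + a t) else 0 := by
        intro i hi
        rw [Finset.mem_range] at hi
        simp only [Finset.mem_Ico]
        by_cases hc : a t ≤ i ∧ i < p - b t
        · rw [if_pos hc, if_pos ((hmem' t i hi).2 ⟨by omega, hc⟩), hcnt t (by omega) i hc.1 hc.2]
        · rw [if_neg hc, if_neg]
          rw [hmem' t i hi]
          tauto
      rw [Finset.sum_congr rfl this, ← Finset.sum_filter, Finset.sum_const, smul_eq_mul]
      congr 1
      have : (Finset.range p).filter (fun i => i ∈ Finset.Ico (a t) (p - b t)) =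
          Finset.Ico (a t) (p - b t) := by
        ext i; simp only [Finset.mem_filter, Finset.mem_range, Finset.mem_Ico]; omega
      rw [this, Nat.card_Ico]
      omega
  rw [← key T le_rfl, ← Finset.sum_filter]
  congr 1
  ext x
  simp only [Finset.mem_filter, Finset.mem_range]
  constructor
  · intro hx
    exact ⟨by have := (Finset.mem_filter.1 (hXdef ▸ hx)).1; simpa using this, hx⟩
  · exact fun hx => hx.2

lemma exists_lev (R : ℕ → ℕ) (hR : ∀ n, 1 ≤ R n) :
    ∃ lev : ℕ → ℕ, Monotone lev ∧
      (∀ n i, i < R n → lev ((∑ m ∈ Finset.range n, R m) + i) = n) ∧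
      ∀ t, ∑ m ∈ Finset.range (lev t), R m ≤ t ∧ t < ∑ m ∈ Finset.range (lev t + 1), R m := by
  classical
  set T : ℕ → ℕ := fun n => ∑ m ∈ Finset.range n, R m with hT
  have hmono : StrictMono T := strictMono_nat_of_lt_succ (by
    intro n; simp only [hT, Finset.sum_range_succ]; have := hR n; omega)
  have hT0 : T 0 = 0 := by simp [hT]
  have hex : ∀ t, ∃ n, t < T (n + 1) := fun t => ⟨t, by
    have := hmono.id_le (t + 1); simp at this; omega⟩
  have hlow : ∀ t, T (Nat.find (hex t)) ≤ t := by
    intro t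
    rcases Nat.eq_zero_or_pos (Nat.find (hex t)) with h0 | h0
    · rw [h0, hT0]; omega
    · have := Nat.find_min (hex t) (m := Nat.find (hex t) - 1) (by omega)
      rw [Nat.sub_add_cancel h0] at this
      omega
  refine ⟨fun t => Nat.find (hex t), ?_, ?_, ?_⟩
  · intro t t' htt
    apply Nat.find_min'
    exact lt_of_le_of_lt htt (Nat.find_spec (hex t'))
  · intro n i hi
    have h1 := Nat.find_spec (hex (T n + i))
    have h2 := hlow (T n + i)
    have h3 : T n + i < T (n + 1) := by simp only [hT, Finset.sum_range_succ]; omega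
    have h4 := hmono.lt_iff_lt.1 (lt_of_le_of_lt h2 h3)
    have h5 := hmono.lt_iff_lt.1 (lt_of_le_of_lt (Nat.le_add_right (T n) i) h1)
    show Nat.find (hex (T n + i)) = n
    omega
  · intro t
    exact ⟨hlow t, Nat.find_spec (hex t)⟩

lemma sum_blocks (R F : ℕ → ℕ) (n : ℕ) :
    ∑ t ∈ Finset.range (∑ m ∈ Finset.range n, R m), F t =
      ∑ m ∈ Finset.range n, ∑ i ∈ Finset.range (R m), F ((∑ l ∈ Finset.range m, R l) + i) := by
  induction n with
  | zero => simp
  | succ n ih =>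
    rw [Finset.sum_range_succ R, Finset.sum_range_add, ih, Finset.sum_range_succ]

lemma build (p : ℕ) (hp : p.Prime) (N : ℕ) (hN : N + 1 < p) (s v τ R : ℕ → ℕ)
    (hv0 : v 0 = 1) (hv : ∀ n, 1 ≤ v n) (hτ : ∀ n, τ n ≤ 1)
    (hRp : ∀ n, R n + s n + v n = p) (hR : ∀ n, 1 ≤ R n)
    (hstep : ∀ n, n + 1 < N → (p : ℤ) ∣ ((n : ℤ) + 3) * (s n + v (n + 1)) - s n - τ n) :
    ∃ μ : YoungDiagram, (∀ c ∈ μ.cells, ¬ p ∣ μ.hookLength c.1 c.2) ∧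
      (∀ r ∈ μ.rowLens, ¬ p ∣ r) ∧
      ∑ n ∈ Finset.range N, (p - (n + 2)) * (R n * ∑ m ∈ Finset.range n, (m + 2) * R m)
        ≤ μ.card := by
  obtain ⟨lev, hmono, hlev, hbd⟩ := exists_lev R hR
  set T : ℕ → ℕ := fun n => ∑ m ∈ Finset.range n, R m with hT
  set A : ℕ → ℕ := fun n => 2 + ∑ m ∈ Finset.range n, τ m with hA
  set B : ℕ → ℕ := fun n => ∑ m ∈ Finset.range n, (1 - τ m) with hB
  set G : ℕ → ℕ := fun n => ∑ m ∈ Finset.range n, (m + 2) * R m with hG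
  have hAm : Monotone A := monotone_nat_of_le_succ (by
    intro n; simp only [hA, Finset.sum_range_succ]; omega)
  have hBm : Monotone B := monotone_nat_of_le_succ (by
    intro n; simp only [hB, Finset.sum_range_succ]; omega)
  have hAB : ∀ n, A n + B n = n + 2 := by
    intro n
    induction n with
    | zero => simp [hA, hB]
    | succ n ih =>
      simp only [hA, hB, Finset.sum_range_succ] at ih ⊢
      have := hτ n
      omega
  have hTm : StrictMono T := strictMono_nat_of_lt_succ (by
    intro n; simp only [hT, Finset.sum_range_succ]; have := hR n; omega)
  -- gap counts
  have hg : ∀ n i, i ≤ R n →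
      ∑ u ∈ Finset.range (T n + i), (A (lev u) + B (lev u)) = G n + i * (n + 2) := by
    intro n i hi
    rw [Finset.sum_range_add, sum_blocks]
    congr 1
    · simp only [hG]
      apply Finset.sum_congr rfl
      intro m _
      rw [Finset.sum_congr rfl (g := fun _ => m + 2), Finset.sum_const, Finset.card_range,
        smul_eq_mul, mul_comm]
      intro x hx
      rw [hlev m x (Finset.mem_range.1 hx), hAB]
    · rw [Finset.sum_congr rfl (g := fun _ => n + 2), Finset.sum_const, Finset.card_range,
        smul_eq_mul]
      intro x hx
      have := Finset.mem_range.1 hx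
      rw [hlev n x (by omega), hAB]
  have hinv : ∀ n < N, (p : ℤ) ∣ (G n + A n : ℤ) - (n + 2) * v n := by
    intro n
    induction n with
    | zero => intro _; simp [hG, hA, hv0]
    | succ n ih =>
      intro hn
      obtain ⟨w1, hw1⟩ := ih (by omega)
      obtain ⟨w2, hw2⟩ := hstep n hn
      have h1 : G (n + 1) = G n + (n + 2) * R n := by simp only [hG, Finset.sum_range_succ]
      have h2 : A (n + 1) = A n + τ n := by simp only [hA, Finset.sum_range_succ]; omega
      have h3 : (R n : ℤ) + s n + v n = p := by exact_mod_cast hRp n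
      refine ⟨w1 + (n + 2) - w2, ?_⟩
      rw [h1, h2]
      push_cast
      linear_combination hw1 - hw2 + ((n : ℤ) + 2) * h3
  have hdec : ∀ t < T N, ∃ n i, n < N ∧ i < R n ∧ t = T n + i := by
    intro t ht
    obtain ⟨h1, h2⟩ := hbd t
    refine ⟨lev t, t - T (lev t), ?_, ?_, ?_⟩
    · exact hTm.lt_iff_lt.1 (lt_of_le_of_lt h1 ht)
    · rw [Finset.sum_range_succ] at h2
      simp only [hT]; omega
    · simp only [hT]; omega
  obtain ⟨μ, h1, h2, h3⟩ := exists_rows p (T N) hp.pos (fun t => A (lev t)) (fun t => B (lev t))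
    (hAm.comp hmono) (hBm.comp hmono)
    (by
      intro t ht
      obtain ⟨n, i, hn, hi, rfl⟩ := hdec t ht
      simp only [hT] at *
      rw [hlev n i hi, hAB]; omega)
    (by
      intro t ht
      obtain ⟨n, i, hn, hi, rfl⟩ := hdec t ht
      rw [hg n i hi.le]
      have e : lev (T n + i) = n := hlev n i hi
      simp only [e]
      intro hd
      have hd' : (p : ℤ) ∣ (G n + i * (n + 2) + A n : ℤ) := by exact_mod_cast hd
      obtain ⟨w1, hw1⟩ := hinv n hn
      obtain ⟨w2, hw2⟩ := hd'
      have hd2 : (p : ℤ) ∣ (((n + 2) * (v n + i) : ℕ) : ℤ) := ⟨w2 - w1, by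
        push_cast; linear_combination hw2 - hw1⟩
      have hd3 : p ∣ (n + 2) * (v n + i) := by exact_mod_cast hd2
      have := hRp n
      have := hv n
      rcases (hp.dvd_mul).1 hd3 with h | h
      · have := Nat.le_of_dvd (by omega) h; omega
      · have := Nat.le_of_dvd (by omega) h; omega)
  refine ⟨μ, h1, h2, ?_⟩
  rw [h3, sum_blocks]
  apply Finset.sum_le_sum
  intro n _
  calc (p - (n + 2)) * (R n * G n) = ∑ i ∈ Finset.range (R n), (p - (n + 2)) * G n := by
        rw [Finset.sum_const, Finset.card_range, smul_eq_mul]; ring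
    _ ≤ _ := by
        apply Finset.sum_le_sum
        intro i hi
        have hi' := Finset.mem_range.1 hi
        have e : lev (∑ l ∈ Finset.range n, R l + i) = n := hlev n i hi'
        have e2 := hg n i hi'.le
        simp only [hT] at e2
        rw [e2, e, hAB]
        apply Nat.mul_le_mul_left
        omega

lemma aux_bezout (a b j d P : ℤ) (hb : 0 < b) (hd : 0 < d) (hab : IsCoprime a b) :
    ∃ x z : ℤ, a * x - b * z = j ∧ P ≤ d * x ∧ d * (x - b) < P := by
  obtain ⟨u, w, huw⟩ := hab
  set M : ℤ := -((-P) / d) with hM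
  have h1 : P ≤ d * M := by
    have := Int.mul_ediv_self_le (x := -P) (k := d) hd.ne'
    rw [hM]; linarith
  have h2 : d * (M - 1) < P := by
    have := Int.lt_mul_ediv_self_add (x := -P) (k := d) hd
    rw [hM]; linarith
  set e := (j * u - M) / b with he
  have hmod := Int.emod_add_mul_ediv (j * u - M) b
  have hm0 := Int.emod_nonneg (j * u - M) hb.ne'
  have hm1 := Int.emod_lt_of_pos (j * u - M) hb
  rw [← he] at hmod
  refine ⟨j * u - b * e, -(j * w) - a * e, ?_, ?_, ?_⟩
  · linear_combination j * huw
  · have : M ≤ j * u - b * e := by linarith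
    nlinarith
  · have : j * u - b * e - b ≤ M - 1 := by omega
    nlinarith

set_option maxHeartbeats 1000000 in
lemma core_neg (p q N : ℤ) (a b : ℤ) (hab : IsCoprime a b) (hb : 1 ≤ b) (hbN : b ≤ N)
    (hN : N * N ≤ p) (hp6 : 1000 ≤ N) (r : ℤ) (hρ : -r = b * q - a * p) (hr0 : 0 < r)
    (hrN : r ≤ N) (hq3 : ¬ (r = 1 ∧ b = 1)) :
    ∃ c y z : ℤ, 1 ≤ c ∧ 0 ≤ y ∧ y ≤ c ∧ q * c = p * z + y ∧ 2 * c < p ∧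
      c * max b r ≤ p + (r + b) * max b r := by
  have hpN : 1000 * N ≤ p := by nlinarith
  have key : ∀ j : ℤ, (r * (r + b) ≤ j * p) →
    ∃ c y z : ℤ, 0 ≤ y ∧ y ≤ c ∧ q * c = p * z + y ∧ j * p ≤ (r + b) * c ∧
      (r + b) * (c - b) < j * p := by
    intro j hj
    obtain ⟨x, z, h1, h2, h3⟩ := aux_bezout a b j (r + b) (j * p) (by omega) (by omega) hab
    have e : r * x + b * (q * x - p * z) = j * p := by
      linear_combination p * h1 - x * hρ
    refine ⟨x, q * x - p * z, z, ?_, ?_, by ring, h2, h3⟩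
    · by_contra hlt
      push Not at hlt
      have : r * x > j * p := by nlinarith
      have t1 : r * ((r + b) * (x - b)) ≤ r * (j * p) := mul_le_mul_of_nonneg_left h3.le hr0.le
      have t2 : (r + b) * (r * x) > (r + b) * (j * p) := mul_lt_mul_of_pos_left this (by omega)
      have t3 : b * (r * (r + b)) > b * (j * p) := by linarith
      have : r * (r + b) > j * p := lt_of_mul_lt_mul_left t3 (by omega)
      omega
    · have : b * (q * x - p * z) ≤ b * x := by linarith
      exact le_of_mul_le_mul_left this (by omega)
  have hmax : max b r ≤ r + b := max_le (by omega) (by omega)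
  have hmax0 : 0 < max b r := by omega
  generalize max b r = m at hmax hmax0 ⊢
  by_cases hj : r * (r + b) ≤ p
  · obtain ⟨c, y, z, h1, h2, h3, h4, h5⟩ := key 1 (by omega)
    rw [one_mul] at h4 h5
    have hc : 1 ≤ c := by
      by_contra hh
      have : (r + b) * c ≤ 0 := mul_nonpos_of_nonneg_of_nonpos (by omega) (by omega)
      omega
    refine ⟨c, y, z, hc, h1, h2, h3, ?_, ?_⟩
    · have h6 : 3 ≤ r + b := by omega
      rcases lt_or_ge b c with h | h
      · have : 3 * (c - b) ≤ (r + b) * (c - b) := mul_le_mul_of_nonneg_right h6 (by omega)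
        omega
      · omega
    · rcases lt_or_ge b c with h | h
      · have : m * (c - b) ≤ (r + b) * (c - b) := mul_le_mul_of_nonneg_right hmax (by omega)
        have : 0 ≤ r * m := by positivity
        linarith
      · have : c * m ≤ b * m := mul_le_mul_of_nonneg_right h (by omega)
        have : 0 ≤ r * m := by positivity
        linarith
  · have hrr : r * r ≤ N * N := mul_le_mul hrN hrN (by omega) (by omega)
    have hrb : r * b ≤ N * N := mul_le_mul hrN hbN (by omega) (by omega)
    obtain ⟨c, y, z, h1, h2, h3, h4, h5⟩ := key 2 (by linarith)
    have hc : 1 ≤ c := by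
      by_contra hh
      have : (r + b) * c ≤ 0 := mul_nonpos_of_nonneg_of_nonpos (by omega) (by omega)
      omega
    have h6 : c - b < 2 * r := by
      by_contra hh
      push Not at hh
      have : (r + b) * (2 * r) ≤ (r + b) * (c - b) := mul_le_mul_of_nonneg_left hh (by omega)
      linarith
    refine ⟨c, y, z, hc, h1, h2, h3, ?_, ?_⟩
    · omega
    · have h7 : (r + b) * (c - b - r) < p := by linarith
      rcases lt_or_ge (b + r) c with h | h
      · have : m * (c - b - r) ≤ (r + b) * (c - b - r) :=
          mul_le_mul_of_nonneg_right hmax (by omega)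
        linarith
      · have : c * m ≤ (b + r) * m := mul_le_mul_of_nonneg_right h (by omega)
        linarith

set_option maxHeartbeats 1000000 in
lemma core_pos (p q N : ℤ) (a b : ℤ) (hab : IsCoprime a b) (hb : 1 ≤ b) (hbN : b ≤ N)
    (hN : N * N ≤ p) (hp6 : 1000 ≤ N) (r : ℤ) (hρ : r = b * q - a * p) (hr0 : 0 < r)
    (hrN : r ≤ N) (hq2 : ¬ (r = 2 ∧ b = 1)) :
    ∃ c y z : ℤ, 1 ≤ c ∧ 0 ≤ y ∧ y ≤ c ∧ q * c = p * z + y ∧ 2 * c < p ∧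
      c * max b r ≤ p + (r + b) * max b r := by
  have hpN : 1000 * N ≤ p := by nlinarith
  by_cases hle : r ≤ b
  · refine ⟨b, r, a, hb, hr0.le, hle, by linarith, by omega, ?_⟩
    have : 0 ≤ r * max b r := by positivity
    linarith
  · push Not at hle
    rw [max_eq_right hle.le]
    obtain ⟨x, z, h1, h2, h3⟩ := aux_bezout a b (-1) r p (by omega) (by omega) hab
    have e : r * x - b * (q * x - p * z) = p := by
      linear_combination -p * h1 + x * hρ
    have hrr : r * r ≤ N * N := mul_le_mul hrN hrN (by omega) (by omega)
    have hx : r ≤ x := by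
      have : r * r ≤ r * x := by linarith
      exact le_of_mul_le_mul_left this hr0
    refine ⟨x, q * x - p * z, z, by omega, ?_, ?_, by ring, ?_, ?_⟩
    · have : 0 ≤ b * (q * x - p * z) := by linarith
      exact nonneg_of_mul_nonneg_right this (by omega)
    · have : b * (q * x - p * z) ≤ b * r := by linarith
      have := le_of_mul_le_mul_left this (by omega)
      omega
    · have h6 : 3 ≤ r := by omega
      rcases lt_or_ge b x with h | h
      · have : 3 * (x - b) ≤ r * (x - b) := mul_le_mul_of_nonneg_right h6 (by omega)
        omega
      · omega
    · have : 0 ≤ r * r := by positivity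
      linarith

lemma core_c (p q N : ℤ) (a b : ℤ) (hab : IsCoprime a b) (hb : 1 ≤ b) (hbN : b ≤ N)
    (hN : N * N ≤ p) (hp6 : 1000 ≤ N) (ρ : ℤ) (hρ : ρ = b * q - a * p) (hρ0 : ρ ≠ 0)
    (hρN : |ρ| ≤ N) (hq2 : ¬ (ρ = 2 ∧ b = 1)) (hq3 : ¬ (ρ = -1 ∧ b = 1)) :
    ∃ c y z : ℤ, 1 ≤ c ∧ 0 ≤ y ∧ y ≤ c ∧ q * c = p * z + y ∧ 2 * c < p ∧
      c * max b |ρ| ≤ p + (|ρ| + b) * max b |ρ| := by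
  rcases lt_or_gt_of_ne hρ0 with hneg | hpos
  · rw [abs_of_neg hneg] at hρN ⊢
    exact core_neg p q N a b hab hb hbN hN hp6 (-ρ) (by linarith) (by omega) hρN (by omega)
  · rw [abs_of_pos hpos] at hρN ⊢
    exact core_pos p q N a b hab hb hbN hN hp6 ρ hρ hpos hρN hq2

lemma exists_c (p : ℕ) (hp : p.Prime) (hp6 : 10 ^ 6 < p) (q : ℕ) (hq : 3 ≤ q) (hqp : q + 2 ≤ p) :
    ∃ b r c y : ℕ, ∃ ε : Bool, b ∈ Finset.Icc 1 (Nat.sqrt p) ∧ r ∈ Finset.Icc 1 (Nat.sqrt p) ∧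
      ((p : ℤ) ∣ (b * q - (if ε then (r : ℤ) else -(r : ℤ)))) ∧ 1 ≤ c ∧ y ≤ c ∧ (p : ℤ) ∣ (q * c - y) ∧
      2 * c < p ∧ (c : ℝ) ≤ p * (1 / (max b r : ℕ)) + (r + b) := by
  set N := Nat.sqrt p with hNdef
  have hN1 : N * N ≤ p := Nat.sqrt_le p
  have hN2 : p < (N + 1) * (N + 1) := Nat.lt_succ_sqrt p
  have hN3 : 1000 ≤ N := by
    rw [hNdef, Nat.le_sqrt]; omega
  clear_value N
  obtain ⟨x, hx1, hx2⟩ := Real.exists_rat_abs_sub_le_and_den_le ((q : ℝ) / p) (n := N) (by omega)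
  have hpR : (0 : ℝ) < p := by exact_mod_cast hp.pos
  have hbpos : 0 < x.den := x.den_pos
  have hbR : (0 : ℝ) < x.den := by exact_mod_cast hbpos
  set ρ : ℤ := x.den * q - x.num * p with hρ
  have hρabs : |ρ| * (N + 1) ≤ p := by
    have h1 : ((q : ℝ) / p - x) * (x.den * p) = ρ := by
      rw [hρ]; push_cast
      have : (x : ℝ) = x.num / x.den := by exact_mod_cast (Rat.num_div_den x).symm
      rw [this]; field_simp
    have h2 : (|(ρ : ℝ)|) ≤ 1 / ((N + 1) * x.den) * (x.den * p) := by
      rw [← h1, abs_mul, abs_of_pos (mul_pos hbR hpR)]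
      exact mul_le_mul_of_nonneg_right hx1 (mul_pos hbR hpR).le
    have h3 : (|(ρ : ℝ)|) * (N + 1) ≤ p := by
      calc (|(ρ : ℝ)|) * (N + 1) ≤ 1 / ((N + 1) * x.den) * (x.den * p) * (N + 1) := by gcongr
        _ = p := by field_simp
    exact_mod_cast h3
  have hρN : |ρ| ≤ N := by
    have h : (p : ℤ) < (N + 1) * (N + 1) := by exact_mod_cast hN2
    by_contra hh
    push Not at hh
    nlinarith
  have hNp : N < p := by nlinarith
  have hbp : ¬ (p : ℤ) ∣ x.den * q := by
    intro h
    have h' : p ∣ x.den * q := by exact_mod_cast h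
    rcases (hp.dvd_mul).1 h' with h | h
    · have := Nat.le_of_dvd hbpos h; omega
    · have := Nat.le_of_dvd (by omega) h; omega
  have hρ0 : ρ ≠ 0 := by
    intro h
    exact hbp ⟨x.num, by rw [hρ] at h; linarith⟩
  have hcop : IsCoprime x.num (x.den : ℤ) := by
    rw [Int.isCoprime_iff_gcd_eq_one]; exact x.reduced
  have hNpz : (N : ℤ) * N ≤ p := by exact_mod_cast hN1
  have hsmall : ∀ e : ℤ, ¬ (p : ℤ) ∣ e ∨ e = 0 ∨ (p : ℤ) ≤ |e| := by
    intro e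
    by_cases h : (p : ℤ) ∣ e
    · by_cases h0 : e = 0
      · simp [h0]
      · right; right
        exact Int.le_of_dvd (abs_pos.mpr h0) ((dvd_abs _ _).2 h)
    · simp [h]
  obtain ⟨c, y, z, hc1, hy0, hyc, hqc, h2c, hcb⟩ :=
    core_c p q N x.num x.den hcop (by exact_mod_cast hbpos) (by exact_mod_cast hx2)
      (by exact_mod_cast hN1) (by exact_mod_cast hN3) ρ hρ hρ0 hρN
      (by
        rintro ⟨h1, h2⟩
        have hd : (p : ℤ) ∣ (q - 2 : ℤ) := ⟨x.num, by rw [h2] at hρ; linarith⟩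
        have := Int.le_of_dvd (by omega) hd
        omega)
      (by
        rintro ⟨h1, h2⟩
        have hd : (p : ℤ) ∣ (q + 1 : ℤ) := ⟨x.num, by rw [h2] at hρ; linarith⟩
        have := Int.le_of_dvd (by omega) hd
        omega)
  lift c to ℕ using by omega
  lift y to ℕ using hy0
  refine ⟨x.den, ρ.natAbs, c, y, decide (0 < ρ), ?_, ?_, ?_, by exact_mod_cast hc1,
    by exact_mod_cast hyc, ⟨z, by linarith⟩, by exact_mod_cast h2c, ?_⟩
  · simp; omega
  · have := Int.abs_eq_natAbs ρ
    have := abs_pos.mpr hρ0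
    simp only [Finset.mem_Icc]; omega
  · refine ⟨x.num, ?_⟩
    by_cases h : 0 < ρ
    · simp only [h, decide_true, if_true]
      have : (ρ.natAbs : ℤ) = ρ := by omega
      rw [this]; linarith
    · simp only [h, decide_false]
      have : (ρ.natAbs : ℤ) = -ρ := by omega
      rw [this]; simp; linarith
  · have habs : |ρ| = (ρ.natAbs : ℤ) := Int.abs_eq_natAbs ρ
    rw [habs] at hcb
    have hm : (0 : ℝ) < (max x.den ρ.natAbs : ℕ) := by
      exact_mod_cast lt_of_lt_of_le hbpos (le_max_left _ _)
    have : (c : ℝ) * (max x.den ρ.natAbs : ℕ) ≤ p + (ρ.natAbs + x.den) * (max x.den ρ.natAbs : ℕ) := by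
      exact_mod_cast hcb
    rw [← le_div_iff₀ hm] at this
    refine this.trans (le_of_eq ?_)
    field_simp

lemma sum_inv_max (N : ℕ) : ∑ b ∈ Finset.Icc 1 N, ∑ r ∈ Finset.Icc 1 N,
    (1 / ((max b r : ℕ) : ℝ)) ≤ 2 * N := by
  induction N with
  | zero => simp
  | succ N ih =>
    rw [Finset.sum_Icc_succ_top (by omega)]
    have h1 : ∀ b ∈ Finset.Icc 1 N, ∑ r ∈ Finset.Icc 1 (N + 1), (1 / ((max b r : ℕ) : ℝ)) =
        ∑ r ∈ Finset.Icc 1 N, (1 / ((max b r : ℕ) : ℝ)) + 1 / ((N : ℝ) + 1) := by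
      intro b hb
      rw [Finset.mem_Icc] at hb
      rw [Finset.sum_Icc_succ_top (by omega), max_eq_right (by omega)]
      push_cast; rfl
    have h2 : ∀ r ∈ Finset.Icc 1 (N + 1), (1 / ((max (N + 1) r : ℕ) : ℝ)) = 1 / ((N : ℝ) + 1) := by
      intro r hr
      rw [Finset.mem_Icc] at hr
      rw [max_eq_left (by omega)]
      push_cast; rfl
    rw [Finset.sum_congr rfl h1, Finset.sum_congr rfl h2, Finset.sum_add_distrib]
    simp only [Finset.sum_const, Nat.card_Icc, nsmul_eq_mul, Nat.add_sub_cancel]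
    have hN : (0 : ℝ) < (N : ℝ) + 1 := by positivity
    have h3 : (N : ℝ) * (1 / ((N : ℝ) + 1)) ≤ 1 := by
      rw [mul_one_div, div_le_one hN]; linarith
    have h4 : ((N + 1 : ℕ) : ℝ) * (1 / ((N : ℝ) + 1)) = 1 := by
      push_cast; field_simp
    rw [h4]
    have h5 : ((N + 1 : ℕ) : ℝ) = N + 1 := by push_cast; rfl
    rw [h5]
    linarith

lemma sum_add_Icc (N : ℕ) : ∑ b ∈ Finset.Icc 1 N, ∑ r ∈ Finset.Icc 1 N,
    ((r : ℝ) + b) = N * N * (N + 1) := by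
  have h : ∀ M : ℕ, ∑ b ∈ Finset.Icc 1 M, (b : ℝ) = M * (M + 1) / 2 := by
    intro M
    induction M with
    | zero => simp
    | succ M ih => rw [Finset.sum_Icc_succ_top (by omega), ih]; push_cast; ring
  simp only [Finset.sum_add_distrib, h, Finset.sum_const, Nat.card_Icc, nsmul_eq_mul,
    Nat.add_sub_cancel]
  rw [← Finset.mul_sum, h]
  ring

lemma sum_c_bound (p : ℕ) (hp : p.Prime) (hp6 : 10 ^ 6 < p) (b r c : ℕ → ℕ) (ε : ℕ → Bool)
    (hb : ∀ n, n + 5 ≤ p → b n ∈ Finset.Icc 1 (Nat.sqrt p))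
    (hr : ∀ n, n + 5 ≤ p → r n ∈ Finset.Icc 1 (Nat.sqrt p))
    (hd : ∀ n, n + 5 ≤ p → (p : ℤ) ∣ (b n * ((n + 3 : ℕ) : ℤ) -
      (if ε n then (r n : ℤ) else -(r n : ℤ))))
    (hc : ∀ n, n + 5 ≤ p → (c n : ℝ) ≤ p * (1 / ((max (b n) (r n) : ℕ) : ℝ)) + (r n + b n)) :
    ∑ n ∈ Finset.range (p - 4), (c n : ℝ) ≤ 6 * p * Real.sqrt p + 2 * p := by
  classical
  set N := Nat.sqrt p with hNdef
  have hN1 : N * N ≤ p := Nat.sqrt_le p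
  have hN3 : 1000 ≤ N := by rw [hNdef, Nat.le_sqrt]; omega
  have hNp : N < p := by nlinarith
  let S : Finset (Bool × ℕ × ℕ) := Finset.univ ×ˢ (Finset.Icc 1 N ×ˢ Finset.Icc 1 N)
  let f : Bool × ℕ × ℕ → ℝ := fun x => p * (1 / ((max x.2.1 x.2.2 : ℕ) : ℝ)) + (x.2.2 + x.2.1)
  have hinj : Set.InjOn (fun n => (ε n, b n, r n)) (Finset.range (p - 4) : Set ℕ) := by
    intro n hn m hm h
    simp only [Finset.coe_range, Set.mem_Iio] at hn hm
    simp only [Prod.mk.injEq] at h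
    obtain ⟨h1, h2, h3⟩ := h
    have hdn := hd n (by omega)
    have hdm := hd m (by omega)
    rw [h1, h2, h3] at hdn
    generalize (if ε m then (r m : ℤ) else -(r m : ℤ)) = z at hdn hdm
    have hdd := dvd_sub hdn hdm
    have hdd2 : (p : ℤ) ∣ (b m : ℤ) * ((n : ℤ) - m) := by
      have e : (b m : ℤ) * ((n : ℤ) - m) =
          ((b m : ℤ) * ((n + 3 : ℕ) : ℤ) - z) - ((b m : ℤ) * ((m + 3 : ℕ) : ℤ) - z) := by
        push_cast; ring
      rw [e]; exact hdd
    have hbm := Finset.mem_Icc.1 (hb m (by omega))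
    rcases (Nat.prime_iff_prime_int.1 hp).dvd_or_dvd hdd2 with h | h
    · have := Int.le_of_dvd (by omega) h; omega
    · by_contra hne
      have := Int.le_of_dvd (abs_pos.mpr (sub_ne_zero.mpr (by exact_mod_cast hne)))
        ((dvd_abs _ _).2 h)
      rcases abs_cases ((n : ℤ) - m) with h | h <;> omega
  have step1 : ∑ n ∈ Finset.range (p - 4), (c n : ℝ) ≤ ∑ x ∈ S, f x := by
    calc ∑ n ∈ Finset.range (p - 4), (c n : ℝ)
        ≤ ∑ n ∈ Finset.range (p - 4), f (ε n, b n, r n) := by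
          apply Finset.sum_le_sum
          intro n hn
          exact hc n (by have := Finset.mem_range.1 hn; omega)
      _ = ∑ x ∈ (Finset.range (p - 4)).image (fun n => (ε n, b n, r n)), f x := by
          rw [Finset.sum_image hinj]
      _ ≤ ∑ x ∈ S, f x := by
          apply Finset.sum_le_sum_of_subset_of_nonneg
          · intro x hx
            obtain ⟨n, hn, rfl⟩ := Finset.mem_image.1 hx
            have hn' : n + 5 ≤ p := by have := Finset.mem_range.1 hn; omega
            simp only [S, Finset.mem_product, Finset.mem_univ, true_and]
            exact ⟨hb n hn', hr n hn'⟩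
          · intro x _ _
            simp only [f]; positivity
  have step2 : ∑ x ∈ S, f x = 2 * (p * ∑ b ∈ Finset.Icc 1 N, ∑ r ∈ Finset.Icc 1 N,
      (1 / ((max b r : ℕ) : ℝ)) + N * N * (N + 1)) := by
    simp only [S, f]
    rw [Finset.sum_product]
    simp only [Finset.sum_const, Finset.card_univ, Fintype.card_bool]
    rw [Finset.sum_product]
    simp only [Finset.sum_add_distrib (f := fun r : ℕ => (p : ℝ) * _)]
    rw [Finset.sum_add_distrib, sum_add_Icc]
    simp only [← Finset.mul_sum]
    rw [nsmul_eq_mul]; norm_num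
  have hs : (N : ℝ) ≤ Real.sqrt p := Real.nat_sqrt_le_real_sqrt
  have hNN : (N : ℝ) * N ≤ p := by exact_mod_cast hN1
  have hpR : (0 : ℝ) ≤ p := by positivity
  have h5 := sum_inv_max N
  have h6 : (p : ℝ) * ∑ b ∈ Finset.Icc 1 N, ∑ r ∈ Finset.Icc 1 N,
      (1 / ((max b r : ℕ) : ℝ)) ≤ p * (2 * Real.sqrt p) :=
    mul_le_mul_of_nonneg_left (by linarith) hpR
  have h7 : (N : ℝ) * N * (N + 1) ≤ p * (Real.sqrt p + 1) :=
    mul_le_mul hNN (by linarith) (by positivity) hpR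
  rw [step2] at step1
  linarith

lemma size_bound (P : ℝ) (hP : 0 ≤ P) (L : ℕ → ℝ) (hL : ∀ n, 0 ≤ L n) (n : ℕ)
    (hn : (n : ℝ) + 1 ≤ P) :
    P ^ 2 * ((P - 2) * (n * (n - 1) * (n + 4)) / 6 - n * (n - 1) * (n ^ 2 + 3 * n - 2) / 8)
      - P ^ 4 / 8 * ∑ m ∈ Finset.range n, L m
      + P * (∑ m ∈ Finset.range n, ((m : ℝ) + 2) * L m) * ((P - (n + 2)) * (P - (n + 2) + 1) / 2)
    ≤ ∑ j ∈ Finset.range n, (P - (j + 2)) *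
        ((P - L j) * ∑ m ∈ Finset.range j, ((m : ℝ) + 2) * (P - L m)) := by
  induction n with
  | zero => simp
  | succ n ih =>
    push_cast at hn
    have ih' := ih (by linarith)
    rw [Finset.sum_range_succ, Finset.sum_range_succ, Finset.sum_range_succ _ n]
    have hH : ∑ m ∈ Finset.range n, ((m : ℝ) + 2) * (P - L m) =
        P * (n * (n + 3) / 2) - ∑ m ∈ Finset.range n, ((m : ℝ) + 2) * L m := by
      clear ih ih' hn
      induction n with
      | zero => simp
      | succ n ih => rw [Finset.sum_range_succ, Finset.sum_range_succ, ih]; push_cast; ring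
    rw [hH]
    have hM : 0 ≤ ∑ m ∈ Finset.range n, ((m : ℝ) + 2) * L m :=
      Finset.sum_nonneg (fun m _ => mul_nonneg (by positivity) (hL m))
    generalize (∑ m ∈ Finset.range n, ((m : ℝ) + 2) * L m) = M at *
    generalize (∑ j ∈ Finset.range n, (P - (j + 2)) *
        ((P - L j) * ∑ m ∈ Finset.range j, ((m : ℝ) + 2) * (P - L m))) = S at *
    generalize (∑ m ∈ Finset.range n, L m) = Q at *
    have hLn := hL n
    generalize L n = l at *
    have hx0 : (0 : ℝ) ≤ n := by positivity
    push_cast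
    generalize (n : ℝ) = x at *
    have hk : 0 ≤ P - (x + 2) := by linarith
    have hLM : 0 ≤ (P - (x + 2)) * (l * M) := by positivity
    -- key polynomial inequality
    have key : 0 ≤ P ^ 4 / 8 - P * (P - (x + 2)) * (x * (x + 3) / 2)
        - P * (x + 2) * ((P - (x + 3)) * (P - (x + 2)) / 2) := by
      have e1 : 0 ≤ P * (P - (x + 2)) * (x + 4) := by positivity
      have e2 : 0 ≤ P * (x + 2) * (P - (x + 2)) := by positivity
      have e3 : 0 ≤ P ^ 2 * (P - 2 * (x + 2)) ^ 2 := by positivity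
      nlinarith
    have key2 : 0 ≤ l * (P ^ 4 / 8 - P * (P - (x + 2)) * (x * (x + 3) / 2)
        - P * (x + 2) * ((P - (x + 3)) * (P - (x + 2)) / 2)) := mul_nonneg hLn key
    linarith

lemma final_ineq (P q Λ S : ℝ) (hq : 1000 ≤ q) (hP : P = q ^ 2)
    (hΛ : Λ ≤ 6 * P * q + 2 * P + 1)
    (hS : P ^ 2 * ((P - 2) * ((P - 3) * ((P - 3) - 1) * ((P - 3) + 4)) / 6
        - (P - 3) * ((P - 3) - 1) * ((P - 3) ^ 2 + 3 * (P - 3) - 2) / 8)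
      - P ^ 4 / 8 * Λ ≤ S) :
    (1 / 24 : ℝ) * P ^ 6 - P ^ 5 * q < S := by
  have hP6 : 1000000 ≤ P := by rw [hP]; nlinarith
  have h1 : P ^ 4 / 8 * Λ ≤ P ^ 4 / 8 * (6 * P * q + 2 * P + 1) := by gcongr
  have e : P ^ 2 * ((P - 2) * ((P - 3) * ((P - 3) - 1) * ((P - 3) + 4)) / 6
        - (P - 3) * ((P - 3) - 1) * ((P - 3) ^ 2 + 3 * (P - 3) - 2) / 8)
      = P ^ 6 / 24 - P ^ 5 / 12 + P ^ 2 * (-25 * P ^ 2 + 74 * P - 24) / 24 := by ring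
  have h2 : P ^ 2 * (-25 * P ^ 2 + 74 * P - 24) / 24 ≥ - (2 * P ^ 4) := by
    have : 0 ≤ P ^ 2 * (23 * P ^ 2 + 74 * P - 24) := mul_nonneg (by positivity) (by nlinarith)
    linarith
  have h3 : P ^ 5 * 1000 ≤ P ^ 5 * q := by gcongr
  have h4 : P ^ 4 * 1000000 ≤ P ^ 4 * P := by gcongr
  have h5 : 0 < P ^ 5 := by positivity
  rw [e] at hS
  nlinarith

lemma step_exists (p : ℕ) (hp : p.Prime) (hp6 : 10 ^ 6 < p) (n : ℕ) :
    ∃ b r s w τ : ℕ, ∃ ε : Bool, 1 ≤ w ∧ τ ≤ 1 ∧ 2 * (s + w) < p ∧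
      (p < n + 5 → s = 0) ∧
      (n + 5 ≤ p → b ∈ Finset.Icc 1 (Nat.sqrt p) ∧ r ∈ Finset.Icc 1 (Nat.sqrt p) ∧
        (p : ℤ) ∣ (b * ((n + 3 : ℕ) : ℤ) - (if ε then (r : ℤ) else -(r : ℤ))) ∧
        ((s + w : ℕ) : ℝ) ≤ p * (1 / ((max b r : ℕ) : ℝ)) + (r + b) ∧
        (p : ℤ) ∣ ((n : ℤ) + 3) * (s + w) - s - τ) := by
  by_cases h : n + 5 ≤ p
  · obtain ⟨b, r, c, y, ε, h1, h2, h3, h4, h5, h6, h7, h8⟩ :=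
      exists_c p hp hp6 (n + 3) (by omega) (by omega)
    by_cases hy : y = c
    · refine ⟨b, r, c - 1, 1, 1, ε, le_rfl, le_rfl, by omega, by omega, fun _ => ⟨h1, h2, h3, ?_, ?_⟩⟩
      · rwa [Nat.sub_add_cancel h4]
      · subst hy
        convert h6 using 1
        push_cast [h4]; ring
    · refine ⟨b, r, y, c - y, 0, ε, by omega, by omega, by omega, by omega, fun _ => ⟨h1, h2, h3, ?_, ?_⟩⟩
      · rwa [Nat.add_sub_cancel' h5]
      · convert h6 using 1
        push_cast [h5]; ring
  · exact ⟨0, 0, 0, 1, 0, true, le_rfl, by omega, by omega, fun _ => rfl, fun h' => absurd h' h⟩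

/-- For a prime `p > 10^6`, there exists a `p`-core `p'`-partition `μ` with
`|μ| > p^6/24 - p^5·√p`. -/
theorem max_pcore_pprime_lower_bound (p : ℕ) (hp : p.Prime) (hp6 : 10 ^ 6 < p) :
    ∃ μ : YoungDiagram,
      (∀ c ∈ μ.cells, ¬ p ∣ μ.hookLength c.1 c.2) ∧
      (∀ r ∈ μ.rowLens, ¬ p ∣ r) ∧
      (1 / 24 : ℝ) * (p : ℝ) ^ 6 - (p : ℝ) ^ 5 * Real.sqrt p < (μ.card : ℝ) := by
  choose b r s w τ ε h1 h2 h3 h4 h5 using step_exists p hp hp6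
  obtain ⟨v, hv0, hvs⟩ : ∃ v : ℕ → ℕ, v 0 = 1 ∧ ∀ n, v (n + 1) = w n :=
    ⟨fun n => Nat.casesOn n 1 w, rfl, fun _ => rfl⟩
  have hv : ∀ n, 1 ≤ v n := by
    intro n
    cases n with
    | zero => exact hv0.ge
    | succ n => rw [hvs]; exact h1 n
  have hvp : ∀ n, 2 * v n < p := by
    intro n
    cases n with
    | zero => rw [hv0]; omega
    | succ n => rw [hvs]; have := h3 n; omega
  have hsv : ∀ n, s n + v n < p := by
    intro n
    have := h3 n
    have := hvp n
    omega
  obtain ⟨μ, hμ1, hμ2, hμ3⟩ := build p hp (p - 3) (by omega) s v τ (fun n => p - (s n + v n)) hv0 hv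
    h2 (fun n => by have := hsv n; omega) (fun n => by have := hsv n; omega)
    (fun n hn => by rw [hvs]; exact (h5 n (by omega)).2.2.2.2)
  refine ⟨μ, hμ1, hμ2, ?_⟩
  have hsum := sum_c_bound p hp hp6 b r (fun n => s n + w n) ε (fun n hn => (h5 n hn).1)
    (fun n hn => (h5 n hn).2.1) (fun n hn => (h5 n hn).2.2.1)
    (fun n hn => (h5 n hn).2.2.2.1)
  let L : ℕ → ℝ := fun n => ((s n + v n : ℕ) : ℝ)
  have hLsum : ∑ n ∈ Finset.range (p - 3), L n ≤ 6 * p * Real.sqrt p + 2 * p + 1 := by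
    obtain ⟨k, hk⟩ : ∃ k, p = k + 4 := ⟨p - 4, by omega⟩
    have e1 : p - 3 = k + 1 := by omega
    have e2 : p - 4 = k := by omega
    rw [e2] at hsum
    have e4 : ∑ n ∈ Finset.range (k + 1), ((v n : ℕ) : ℝ) =
        ∑ n ∈ Finset.range k, ((w n : ℕ) : ℝ) + 1 := by
      rw [Finset.sum_range_succ']
      simp only [hvs, hv0, Nat.cast_one]
    have e3 : ∑ n ∈ Finset.range (p - 3), L n = ∑ n ∈ Finset.range k, ((s n + w n : ℕ) : ℝ) + 1 := by
      simp only [L]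
      rw [e1]
      push_cast
      rw [Finset.sum_add_distrib, Finset.sum_add_distrib, Finset.sum_range_succ (fun n => ((s n : ℕ) : ℝ)),
        e4, h4 k (by omega)]
      push_cast; ring
    rw [e3]; linarith
  have hsz := size_bound p (by positivity) L (fun n => by simp only [L]; positivity) (p - 3)
    (by rw [Nat.cast_sub (by omega)]; push_cast; linarith)
  have hcast : ((p - 3 : ℕ) : ℝ) = (p : ℝ) - 3 := by
    rw [Nat.cast_sub (by omega)]; norm_num
  have hS : ∑ j ∈ Finset.range (p - 3), ((p : ℝ) - (j + 2)) *
        ((p - L j) * ∑ m ∈ Finset.range j, ((m : ℝ) + 2) * (p - L m)) ≤ (μ.card : ℝ) := by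
    refine le_trans (le_of_eq ?_) (Nat.cast_le.2 hμ3)
    push_cast
    apply Finset.sum_congr rfl
    intro j hj
    have hj' := Finset.mem_range.1 hj
    have hc : ∀ n, ((p - (s n + v n) : ℕ) : ℝ) = p - L n := fun n => by
      simp only [L]; rw [Nat.cast_sub (hsv n).le]
    rw [Nat.cast_sub (by omega : j + 2 ≤ p)]
    simp only [hc]
    push_cast
    rfl
  rw [hcast] at hsz
  have hq : (1000 : ℝ) ≤ Real.sqrt p := by
    apply Real.le_sqrt_of_sq_le
    have : ((10 ^ 6 : ℕ) : ℝ) < p := by exact_mod_cast hp6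
    norm_num at this ⊢; linarith
  refine final_ineq p (Real.sqrt p) (∑ n ∈ Finset.range (p - 3), L n) μ.card hq
    (Real.sq_sqrt (by positivity)).symm hLsum (le_trans ?_ (le_trans hsz hS))
  have hM : 0 ≤ (p : ℝ) * (∑ m ∈ Finset.range (p - 3), ((m : ℝ) + 2) * L m) *
      ((p - ((p - 3 : ℝ) + 2)) * (p - ((p - 3 : ℝ) + 2) + 1) / 2) := by
    apply mul_nonneg
    · apply mul_nonneg (by positivity)
      apply Finset.sum_nonneg
      intro m _
      simp only [L]; positivity
    · ring_nf; norm_num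
  linarith
end

section
/- For every ε > 0 there exists N such that for every prime p > N: (i) every p-core p'-partition λ satisfies |λ| < (1/24 + ε)·p^6, and (ii) there exists a p-core p'-partition λ with |λ| > (1/24 − ε)·p^6. (In other words, the maximal size of a p-core p'-partition is asymptotic to p^6/24 as p → ∞ through primes.) -/
namespace PCore

open Finset

/-- number of gaps of `X` below `x` -/
def G (X : Finset ℕ) (x : ℕ) : ℕ := Nat.count (fun y => y ∉ X) x

def bead (μ : YoungDiagram) (i : ℕ) : ℕ := μ.rowLen i + (μ.colLen 0 - 1 - i)

def gap (μ : YoungDiagram) (j : ℕ) : ℕ := μ.colLen 0 + j - μ.colLen j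

def beads (μ : YoungDiagram) : Finset ℕ := (range (μ.colLen 0)).image (bead μ)

lemma lt_iff (μ : YoungDiagram) (i j : ℕ) : j < μ.rowLen i ↔ i < μ.colLen j := by
  rw [← YoungDiagram.mem_iff_lt_rowLen, YoungDiagram.mem_iff_lt_colLen]

lemma bead_lt {μ : YoungDiagram} {i i' : ℕ} (h : i < i') (h' : i' < μ.colLen 0) :
    bead μ i' < bead μ i := by
  have := μ.rowLen_anti i i' h.le
  unfold bead
  omega

lemma gap_lt {μ : YoungDiagram} {j j' : ℕ} (h : j < j') : gap μ j < gap μ j' := by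
  have h1 := μ.colLen_anti j j' h.le
  have h2 := μ.colLen_anti 0 j (Nat.zero_le _)
  unfold gap
  omega

lemma gap_inj (μ : YoungDiagram) : Function.Injective (gap μ) :=
  StrictMono.injective (fun _ _ h => gap_lt h)

lemma bead_inj (μ : YoungDiagram) : Set.InjOn (bead μ) (range (μ.colLen 0)) := by
  intro i hi i' hi' h
  simp only [coe_range, Set.mem_Iio] at hi hi'
  rcases lt_trichotomy i i' with h1 | h1 | h1
  · have := bead_lt h1 hi'; omega
  · exact h1
  · have := bead_lt h1 hi; omega

lemma gap_lt_bead {μ : YoungDiagram} {i j : ℕ} (hi : i < μ.colLen 0) :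
    gap μ j < bead μ i ↔ j < μ.rowLen i := by
  have h1 := lt_iff μ i j
  have h2 := μ.colLen_anti 0 j (Nat.zero_le _)
  unfold gap bead
  omega

lemma gap_ne_bead {μ : YoungDiagram} {i j : ℕ} (hi : i < μ.colLen 0) :
    bead μ i ≠ gap μ j := by
  have h1 := lt_iff μ i j
  have h2 := μ.colLen_anti 0 j (Nat.zero_le _)
  unfold gap bead
  omega

lemma gap_notMem (μ : YoungDiagram) (j : ℕ) : gap μ j ∉ beads μ := by
  simp only [beads, mem_image, mem_range, not_exists, not_and]
  intro i hi
  exact gap_ne_bead hi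

lemma exists_gap {μ : YoungDiagram} {z : ℕ} (hz : z ∉ beads μ) : ∃ j, gap μ j = z := by
  classical
  have hz' : ∀ i < μ.colLen 0, bead μ i ≠ z := by
    simpa [beads] using hz
  have hex : ∃ i, μ.colLen 0 ≤ i ∨ bead μ i < z := ⟨_, Or.inl le_rfl⟩
  set i0 := Nat.find hex with hi0
  have hs := Nat.find_spec hex
  rw [← hi0] at hs
  have hm : ∀ i < i0, i < μ.colLen 0 ∧ z < bead μ i := by
    intro i hi
    have := Nat.find_min hex hi
    push Not at this
    exact ⟨this.1, lt_of_le_of_ne this.2 (hz' i this.1).symm⟩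
  have hle : i0 ≤ μ.colLen 0 := by
    by_contra! h
    exact absurd (hm _ h).1 (lt_irrefl _)
  have hj : μ.colLen 0 ≤ z + i0 := by
    rcases hs with h | h
    · omega
    · by_contra! h'
      have := (lt_iff μ i0 0).2 (by omega)
      unfold bead at h
      omega
  have hc : μ.colLen (z + i0 - μ.colLen 0) = i0 := by
    apply le_antisymm
    · by_contra! h
      have h1 := (lt_iff μ _ _).2 h
      have h2 : i0 < μ.colLen 0 := lt_of_lt_of_le h (μ.colLen_anti 0 _ (Nat.zero_le _))
      rcases hs with h3 | h3
      · omega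
      · unfold bead at h3; omega
    · by_contra! h
      have h4 : i0 - 1 < i0 := by omega
      have h5 := hm _ h4
      have h6 : ¬ (i0 - 1 < μ.colLen (z + i0 - μ.colLen 0)) := by omega
      rw [← lt_iff] at h6
      unfold bead at h5
      omega
  refine ⟨z + i0 - μ.colLen 0, ?_⟩
  unfold gap
  rw [hc]
  omega

lemma G_bead {μ : YoungDiagram} {i : ℕ} (hi : i < μ.colLen 0) :
    G (beads μ) (bead μ i) = μ.rowLen i := by
  unfold G
  rw [Nat.count_eq_card_filter_range]
  have : (range (bead μ i)).filter (fun y => y ∉ beads μ) = (range (μ.rowLen i)).image (gap μ) := by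
    ext z
    simp only [mem_filter, mem_range, mem_image]
    constructor
    · rintro ⟨h1, h2⟩
      obtain ⟨j, rfl⟩ := exists_gap h2
      exact ⟨j, (gap_lt_bead hi).1 h1, rfl⟩
    · rintro ⟨j, h1, rfl⟩
      exact ⟨(gap_lt_bead hi).2 h1, gap_notMem μ j⟩
  rw [this, card_image_of_injective _ (gap_inj μ), card_range]

lemma card_eq (μ : YoungDiagram) : μ.card = ∑ x ∈ beads μ, G (beads μ) x := by
  unfold beads
  rw [sum_image (bead_inj μ)]
  change _ = ∑ i ∈ range (μ.colLen 0), G (beads μ) (bead μ i)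
  rw [sum_congr rfl (fun i hi => G_bead (mem_range.1 hi))]
  have := Finset.card_eq_sum_card_fiberwise (f := Prod.fst) (s := μ.cells)
    (t := range (μ.colLen 0)) (by
      rintro ⟨i, j⟩ h
      have h : (i, j) ∈ μ := by simpa using h
      simp only [coe_range, Set.mem_Iio]
      rw [YoungDiagram.mem_iff_lt_colLen] at h
      exact lt_of_lt_of_le h (μ.colLen_anti 0 _ (Nat.zero_le _)))
  unfold YoungDiagram.card
  rw [this]
  apply sum_congr rfl
  intro i _
  rw [YoungDiagram.rowLen_eq_card]
  rfl

lemma hook_eq {μ : YoungDiagram} {i j : ℕ} (h : j < μ.rowLen i) :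
    i < μ.colLen 0 ∧ gap μ j + μ.hookLength i j = bead μ i := by
  have h1 := (lt_iff μ i j).1 h
  have h2 := μ.colLen_anti 0 j (Nat.zero_le _)
  unfold gap bead YoungDiagram.hookLength
  omega

lemma zero_notMem (μ : YoungDiagram) : 0 ∉ beads μ := by
  simp only [beads, mem_image, mem_range, not_exists, not_and]
  intro i hi h
  have := (lt_iff μ i 0).2 hi
  unfold bead at h
  omega

lemma core_iff (μ : YoungDiagram) (p : ℕ) (hp : 0 < p) :
    (∀ c ∈ μ.cells, ¬ p ∣ μ.hookLength c.1 c.2) ↔ (∀ x, x + p ∈ beads μ → x ∈ beads μ) := by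
  constructor
  · intro h x hx
    by_contra hx'
    obtain ⟨j, rfl⟩ := exists_gap hx'
    simp only [beads, mem_image, mem_range] at hx
    obtain ⟨i, hi, hb⟩ := hx
    have h1 : j < μ.rowLen i := (gap_lt_bead hi).1 (by omega)
    have h2 := (hook_eq h1).2
    apply h (i, j) (by simpa using YoungDiagram.mem_iff_lt_rowLen.2 h1)
    have : μ.hookLength i j = p := by omega
    simp [this]
  · rintro h ⟨i, j⟩ hc ⟨k, hk⟩
    have h1 : j < μ.rowLen i := YoungDiagram.mem_iff_lt_rowLen.1 (by simpa using hc)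
    obtain ⟨hi, h2⟩ := hook_eq h1
    simp only at hk
    have h3 : ∀ k x, x + p * k ∈ beads μ → x ∈ beads μ := by
      intro k
      induction k with
      | zero => intro x hx; simpa using hx
      | succ k ih =>
        intro x hx
        apply ih
        apply h
        convert hx using 1
        ring
    apply gap_notMem μ j
    apply h3 k
    rw [← hk, h2]
    exact mem_image_of_mem _ (mem_range.2 hi)

lemma parts_iff (μ : YoungDiagram) (p : ℕ) :
    (∀ r ∈ μ.rowLens, ¬ p ∣ r) ↔ (∀ x ∈ beads μ, ¬ p ∣ G (beads μ) x) := by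
  have : (∀ r ∈ μ.rowLens, ¬ p ∣ r) ↔ ∀ i < μ.colLen 0, ¬ p ∣ μ.rowLen i := by
    simp [YoungDiagram.rowLens]
  rw [this]
  constructor
  · intro h x hx
    simp only [beads, mem_image, mem_range] at hx
    obtain ⟨i, hi, rfl⟩ := hx
    rw [G_bead hi]
    exact h i hi
  · intro h i hi
    rw [← G_bead hi]
    exact h _ (mem_image_of_mem _ (mem_range.2 hi))

lemma count_add_G (X : Finset ℕ) (x : ℕ) : Nat.count (fun y => y ∈ X) x + G X x = x := by
  unfold G
  rw [Nat.count_eq_card_filter_range, Nat.count_eq_card_filter_range]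
  rw [card_filter_add_card_filter_not, card_range]

lemma G_mono (X : Finset ℕ) : Monotone (G X) := Nat.count_monotone _

lemma exists_diagram (X : Finset ℕ) (hX : 0 ∉ X) : ∃ μ : YoungDiagram, beads μ = X := by
  classical
  set n := X.card with hn
  have hf : (Set.ofPred (fun y => y ∈ X)).Finite := X.finite_toSet
  have hfX : hf.toFinset = X := by ext; simp
  have hfc : #hf.toFinset = n := by rw [hfX]
  set e : ℕ → ℕ := Nat.nth (fun y => y ∈ X) with he
  have hmem : ∀ k < n, e k ∈ X := fun k hk =>
    Nat.nth_mem_of_lt_card hf (by rw [hfc]; exact hk)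
  have hcount : ∀ k < n, k + G X (e k) = e k := by
    intro k hk
    have h1 := count_add_G X (e k)
    have h2 : Nat.count (fun y => y ∈ X) (e k) = k :=
      Nat.count_nth_of_lt_card_finite hf (by rw [hfc]; exact hk)
    omega
  have hmono : ∀ k k', k ≤ k' → k' < n → e k ≤ e k' := fun k k' h h' =>
    Nat.nth_le_nth_of_lt_card hf h (by rw [hfc]; exact h')
  have hpos : ∀ k < n, 0 < G X (e k) := by
    intro k hk
    have h1 : 1 ≤ e k := by
      rcases Nat.eq_zero_or_pos (e k) with h | h
      · exact absurd (h ▸ hmem k hk) hX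
      · exact h
    have h2 := G_mono X h1
    have h3 : G X 1 = 1 := by simp [G, Nat.count_succ, hX]
    omega
  let cells : Finset (ℕ × ℕ) := (range n).biUnion
    (fun i => (range (G X (e (n - 1 - i)))).image (fun j => (i, j)))
  have hcells : ∀ i j, (i, j) ∈ cells ↔ i < n ∧ j < G X (e (n - 1 - i)) := by
    intro i j
    simp [cells]
  have hl : IsLowerSet (cells : Set (ℕ × ℕ)) := by
    rintro ⟨i, j⟩ ⟨i', j'⟩ hle h
    simp only [mem_coe] at h ⊢
    rw [hcells] at h ⊢
    obtain ⟨h1, h2⟩ : i' ≤ i ∧ j' ≤ j := hle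
    have := G_mono X (hmono (n - 1 - i) (n - 1 - i') (by omega) (by omega))
    omega
  let μ : YoungDiagram := ⟨cells, hl⟩
  have hμ : ∀ i j, (i, j) ∈ μ ↔ i < n ∧ j < G X (e (n - 1 - i)) := hcells
  have hrow : ∀ i < n, μ.rowLen i = G X (e (n - 1 - i)) := by
    intro i hi
    apply le_antisymm
    · by_contra! h
      rw [← YoungDiagram.mem_iff_lt_rowLen, hμ] at h
      omega
    · by_contra! h
      have := (hμ i (μ.rowLen i)).2 ⟨hi, h⟩
      rw [YoungDiagram.mem_iff_lt_rowLen] at this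
      omega
  have hcol : μ.colLen 0 = n := by
    apply le_antisymm
    · by_contra! h
      rw [← YoungDiagram.mem_iff_lt_colLen, hμ] at h
      omega
    · by_contra! h
      have := (hμ (μ.colLen 0) 0).2 ⟨h, hpos _ (by omega)⟩
      rw [YoungDiagram.mem_iff_lt_colLen] at this
      omega
  have hb : ∀ i < n, bead μ i = e (n - 1 - i) := by
    intro i hi
    have := hcount (n - 1 - i) (by omega)
    unfold bead
    rw [hrow i hi, hcol]
    omega
  refine ⟨μ, ?_⟩
  apply eq_of_subset_of_card_le
  · intro x hx
    simp only [beads, mem_image, mem_range] at hx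
    obtain ⟨i, hi, rfl⟩ := hx
    rw [hcol] at hi
    rw [hb i hi]
    exact hmem _ (by omega)
  · rw [beads, card_image_of_injOn (bead_inj μ), hcol, card_range]

/-- number of gaps in row `k` -/
def gp (X : Finset ℕ) (p k : ℕ) : ℕ := Nat.count (fun r => k * p + r ∉ X) p

lemma G_add (X : Finset ℕ) (a r : ℕ) : G X (a + r) = G X a + Nat.count (fun r => a + r ∉ X) r := by
  unfold G
  rw [Nat.count_add]

lemma G_succ_mul (X : Finset ℕ) (p k : ℕ) : G X ((k + 1) * p) = G X (k * p) + gp X p k := by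
  rw [Nat.succ_mul, G_add]; rfl

lemma G_mul (X : Finset ℕ) (p k : ℕ) : G X (k * p) = ∑ j ∈ range k, gp X p j := by
  induction k with
  | zero => simp [G]
  | succ k ih => rw [G_succ_mul, ih, sum_range_succ]

lemma sum_blocks (f : ℕ → ℕ) (p K : ℕ) :
    ∑ x ∈ range (K * p), f x = ∑ k ∈ range K, ∑ r ∈ range p, f (k * p + r) := by
  induction K with
  | zero => simp
  | succ k ih => rw [Nat.succ_mul, sum_range_add, ih, sum_range_succ]

lemma sum_X (X : Finset ℕ) (p K : ℕ) (hK : ∀ x ∈ X, x < K * p) (f : ℕ → ℕ) :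
    ∑ x ∈ X, f x = ∑ k ∈ range K, ∑ r ∈ range p, if k * p + r ∈ X then f (k * p + r) else 0 := by
  rw [← sum_blocks (fun x => if x ∈ X then f x else 0), ← sum_filter]
  congr 1
  ext x
  simp only [mem_filter, mem_range]
  exact ⟨fun h => ⟨hK x h, h⟩, fun h => h.2⟩

lemma card_row (X : Finset ℕ) (p k : ℕ) :
    #((range p).filter (fun r => k * p + r ∈ X)) + gp X p k = p := by
  unfold gp
  rw [Nat.count_eq_card_filter_range, card_filter_add_card_filter_not, card_range]

lemma gp_le (X : Finset ℕ) (p k : ℕ) : gp X p k ≤ p := Nat.count_le _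

lemma row_le (X : Finset ℕ) (p k : ℕ) :
    (∑ r ∈ range p, if k * p + r ∈ X then G X (k * p + r) else 0)
      ≤ (p - gp X p k) * (G X (k * p) + p) := by
  rw [← sum_filter]
  have h := card_row X p k
  have : p - gp X p k = #((range p).filter (fun r => k * p + r ∈ X)) := by omega
  rw [this]
  refine (sum_le_card_nsmul _ _ (G X (k * p) + p) ?_).trans_eq (smul_eq_mul _ _)
  intro r hr
  simp only [mem_filter, mem_range] at hr
  rw [G_add]
  have : Nat.count (fun r => k * p + r ∉ X) r ≤ r := Nat.count_le _
  omega

lemma le_row (X : Finset ℕ) (p k : ℕ) :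
    (p - gp X p k) * G X (k * p) ≤ 
    (∑ r ∈ range p, if k * p + r ∈ X then G X (k * p + r) else 0) := by
  rw [← sum_filter]
  have h := card_row X p k
  have : p - gp X p k = #((range p).filter (fun r => k * p + r ∈ X)) := by omega
  rw [this]
  refine (smul_eq_mul _ _).symm.trans_le (card_nsmul_le_sum _ _ (G X (k * p)) ?_)
  intro r hr
  exact G_mono X (Nat.le_add_right _ _)

section upper

variable {X : Finset ℕ} {p : ℕ}

lemma closed_le (hc : ∀ x, x + p ∈ X → x ∈ X) {k k' : ℕ} (h : k ≤ k') (r : ℕ)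
    (hr : k' * p + r ∈ X) : k * p + r ∈ X := by
  induction k', h using Nat.le_induction with
  | base => exact hr
  | succ n hn ih =>
    apply ih
    apply hc
    convert hr using 1
    ring

lemma count_row_mono (hc : ∀ x, x + p ∈ X → x ∈ X) {k k' : ℕ} (h : k ≤ k') (a r : ℕ) :
    Nat.count (fun r => k * p + (a + r) ∉ X) r ≤ Nat.count (fun r => k' * p + (a + r) ∉ X) r :=
  Nat.count_mono_left (fun i _ hi hi' => hi (closed_le hc h _ hi'))

lemma gp_mono (hc : ∀ x, x + p ∈ X → x ∈ X) : Monotone (gp X p) := by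
  intro k k' h
  have := count_row_mono hc h 0 p
  simpa [gp] using this

lemma gp_pos (hp : 0 < p) (h0 : 0 ∉ X) (hc : ∀ x, x + p ∈ X → x ∈ X) (k : ℕ) : 0 < gp X p k := by
  apply Nat.pos_of_ne_zero
  unfold gp
  rw [Nat.count_ne_iff_exists]
  refine ⟨0, hp, fun h => h0 ?_⟩
  have := closed_le hc (Nat.zero_le k) 0 h
  simpa using this

lemma gp_lt (hp : p.Prime) (h0 : 0 ∉ X) (hc : ∀ x, x + p ∈ X → x ∈ X)
    (hd : ∀ x ∈ X, ¬ p ∣ G X x) (k : ℕ) (hk : gp X p (k + (p - 1)) < p) :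
    gp X p k < gp X p (k + (p - 1)) := by
  by_contra! hle
  set m := gp X p k with hm
  have hconst : ∀ i < p, gp X p (k + i) = m := by
    intro i hi
    have h1 := gp_mono hc (show k ≤ k + i by omega)
    have h2 := gp_mono hc (show k + i ≤ k + (p - 1) by omega)
    omega
  have hmp : m < p := lt_of_le_of_lt (gp_mono hc (by omega)) hk
  obtain ⟨r, hr, hrX⟩ : ∃ r < p, (k + (p - 1)) * p + r ∈ X := by
    by_contra! h
    have : gp X p (k + (p - 1)) = p := by
      unfold gp
      rw [Nat.count_iff_forall]
      exact h
    omega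
  set g := Nat.count (fun r => k * p + r ∉ X) r with hg
  have hgi : ∀ i < p, Nat.count (fun r => (k + i) * p + r ∉ X) r = g := by
    intro i hi
    have h1 := count_row_mono hc (show k ≤ k + i by omega) 0 r
    have h2 := count_row_mono hc (show k ≤ k + i by omega) r (p - r)
    simp only [zero_add] at h1
    have h3 : gp X p k = g + Nat.count (fun s => k * p + (r + s) ∉ X) (p - r) := by
      rw [hg, ← Nat.count_add (fun s => k * p + s ∉ X)]
      unfold gp
      congr 1; omega
    have h4 : gp X p (k + i) = Nat.count (fun r => (k + i) * p + r ∉ X) r +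
        Nat.count (fun s => (k + i) * p + (r + s) ∉ X) (p - r) := by
      rw [← Nat.count_add (fun s => (k + i) * p + s ∉ X)]
      unfold gp
      congr 1; omega
    have h5 := hconst i hi
    omega
  have hGi : ∀ i < p, G X ((k + i) * p) = G X (k * p) + i * m := by
    intro i
    induction i with
    | zero => intro _; simp
    | succ i ih =>
      intro hi
      rw [← add_assoc, G_succ_mul, ih (by omega), hconst i (by omega)]
      ring
  have := Fact.mk hp
  have hm0 : 0 < m := gp_pos hp.pos h0 hc k
  have hmz : (m : ZMod p) ≠ 0 := by
    rw [Ne, ZMod.natCast_eq_zero_iff]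
    intro h
    exact absurd (Nat.le_of_dvd hm0 h) (by omega)
  set i := (-((G X (k * p) + g : ℕ) : ZMod p) / m).val with hi
  have hip : i < p := ZMod.val_lt _
  apply hd ((k + i) * p + r) (closed_le hc (by omega) r hrX)
  rw [G_add, hgi i hip, hGi i hip, ← ZMod.natCast_eq_zero_iff]
  push_cast
  rw [hi, ZMod.natCast_zmod_val]
  field_simp
  push_cast
  ring

lemma fiber_card (hp : p.Prime) (h0 : 0 ∉ X) (hc : ∀ x, x + p ∈ X → x ∈ X)
    (hd : ∀ x ∈ X, ¬ p ∣ G X x) (S : Finset ℕ) (v : ℕ) (hv : v < p) :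
    #(S.filter (fun k => gp X p k = v)) ≤ p := by
  rcases (S.filter (fun k => gp X p k = v)).eq_empty_or_nonempty with h | h
  · simp [h]
  · set F := S.filter (fun k => gp X p k = v) with hF
    set k0 := F.min' h
    have hk0 : gp X p k0 = v := (mem_filter.1 (F.min'_mem h)).2
    have : F ⊆ Ico k0 (k0 + p) := by
      intro k hk
      have h1 : k0 ≤ k := F.min'_le k hk
      have h2 : gp X p k = v := (mem_filter.1 hk).2
      rw [mem_Ico]
      refine ⟨h1, ?_⟩
      by_contra! h3
      have h4 := gp_mono hc (show k0 + (p - 1) ≤ k by omega)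
      have h5 := gp_lt hp h0 hc hd k0 (by omega)
      omega
    have := card_le_card this
    simpa using this

lemma sum_fiber_le (hp : p.Prime) (h0 : 0 ∉ X) (hc : ∀ x, x + p ∈ X → x ∈ X)
    (hd : ∀ x ∈ X, ¬ p ∣ G X x) (S : Finset ℕ) (n : ℕ) (hn : n ≤ p)
    (hS : ∀ k ∈ S, gp X p k < n) (f : ℕ → ℕ) :
    ∑ k ∈ S, f (gp X p k) ≤ p * ∑ v ∈ range n, f v := by
  rw [← sum_fiberwise_of_maps_to (t := range n) (g := gp X p) (fun k hk => mem_range.2 (hS k hk)),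
    mul_sum]
  apply sum_le_sum
  intro v hv
  have hv := mem_range.1 hv
  rw [sum_congr rfl (g := fun _ => f v) (by
    intro k hk
    rw [(mem_filter.1 hk).2])]
  rw [sum_const, smul_eq_mul]
  exact Nat.mul_le_mul_right _ (fiber_card hp h0 hc hd S v (by omega))

lemma upper_nat (hp : p.Prime) (h0 : 0 ∉ X) (hc : ∀ x, x + p ∈ X → x ∈ X)
    (hd : ∀ x ∈ X, ¬ p ∣ G X x) :
    ∑ x ∈ X, G X x ≤ p * ∑ v ∈ range p, (p - v) * (p * (∑ w ∈ range (v + 1), w) + p) := by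
  obtain ⟨K, hK⟩ : ∃ K, ∀ x ∈ X, x < K * p := by
    refine ⟨X.sup id + 1, fun x hx => ?_⟩
    have h1 : x ≤ X.sup id := le_sup (f := id) hx
    have h2 := hp.one_lt
    nlinarith
  rw [sum_X X p K hK]
  set S := (range K).filter (fun k => gp X p k < p) with hS
  calc _ ≤ ∑ k ∈ range K, (p - gp X p k) * (G X (k * p) + p) := sum_le_sum fun k _ => row_le X p k
    _ = ∑ k ∈ S, (p - gp X p k) * (G X (k * p) + p) := by
        rw [hS, sum_filter_of_ne]
        intro k _ hne
        by_contra h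
        apply hne
        have : p - gp X p k = 0 := by omega
        rw [this, zero_mul]
    _ ≤ ∑ k ∈ S, (p - gp X p k) * (p * (∑ w ∈ range (gp X p k + 1), w) + p) := by
        apply sum_le_sum
        intro k hk
        have hk' := (mem_filter.1 hk).2
        apply Nat.mul_le_mul_left
        apply Nat.add_le_add_right
        rw [G_mul]
        exact sum_fiber_le hp h0 hc hd (range k) (gp X p k + 1) (by omega) (fun j hj => by
          have := gp_mono hc (show j ≤ k from (mem_range.1 hj).le)
          omega) (fun v => v)
    _ ≤ _ := sum_fiber_le hp h0 hc hd S p le_rfl (fun k hk => (mem_filter.1 hk).2)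
        (fun v => (p - v) * (p * (∑ w ∈ range (v + 1), w) + p))

lemma sum_id_real (n : ℕ) : (∑ w ∈ range n, (w : ℝ)) = n * (n - 1) / 2 := by
  induction n with
  | zero => simp
  | succ n ih => rw [sum_range_succ, ih]; push_cast; ring

lemma sum_poly (P : ℝ) (n : ℕ) : ∑ v ∈ range n, (P - v) * (v * (v + 1) / 2 : ℝ) =
    P * ((n - 1) * n * (n + 1)) / 6 - ((n - 1) ^ 2 * n ^ 2 / 4 + (n - 1) * n * (2 * n - 1) / 6) / 2 := by
  induction n with
  | zero => simp
  | succ n ih => rw [sum_range_succ, ih]; push_cast; ring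

lemma upper_real (hp : p.Prime) (h0 : 0 ∉ X) (hc : ∀ x, x + p ∈ X → x ∈ X)
    (hd : ∀ x ∈ X, ¬ p ∣ G X x) :
    ((∑ x ∈ X, G X x : ℕ) : ℝ) ≤ (p : ℝ) ^ 6 / 24 + 2 * (p : ℝ) ^ 5 := by
  have h := upper_nat hp h0 hc hd
  have h' : ((∑ x ∈ X, G X x : ℕ) : ℝ) ≤
      ((p * ∑ v ∈ range p, (p - v) * (p * (∑ w ∈ range (v + 1), w) + p) : ℕ) : ℝ) := by
    exact_mod_cast h
  refine h'.trans ?_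
  have hp1 : (1 : ℝ) ≤ p := by exact_mod_cast hp.one_lt.le
  have e1 : ((p * ∑ v ∈ range p, (p - v) * (p * (∑ w ∈ range (v + 1), w) + p) : ℕ) : ℝ) ≤
      p * ∑ v ∈ range p, (p * (((p : ℝ) - v) * (v * (v + 1) / 2 : ℝ)) + p ^ 2) := by
    push_cast
    apply mul_le_mul_of_nonneg_left _ (by positivity)
    apply sum_le_sum
    intro v hv
    have hv : v < p := mem_range.1 hv
    have hv' : (v : ℝ) < p := by exact_mod_cast hv
    rw [sum_id_real, Nat.cast_sub hv.le]
    push_cast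
    have : (0 : ℝ) ≤ v * p := by positivity
    nlinarith
  refine e1.trans ?_
  rw [sum_add_distrib, ← mul_sum, sum_poly]
  simp only [sum_const, card_range, nsmul_eq_mul]
  have h2 : (p : ℝ) ^ 4 ≤ p ^ 5 := pow_le_pow_right₀ hp1 (by norm_num)
  have h3 : (0 : ℝ) ≤ p ^ 3 := by positivity
  have h4 : (0 : ℝ) ≤ p ^ 4 := by positivity
  nlinarith

end upper

section nt

def Good (p D m : ℕ) : Prop :=
  ∃ u s : ℕ, 1 ≤ u ∧ u * D ≤ p ∧ 1 ≤ s ∧ s * D ≤ p ∧ p ∣ u * (m + 1) + s * m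

lemma exists_c {p m : ℕ} (hp : p.Prime) (hm : 1 ≤ m) (hmp : m + 1 < p) :
    ∃ c, 0 < c ∧ c < p ∧ p ∣ c * m + (m + 1) := by
  have := Fact.mk hp
  have hmz : (m : ZMod p) ≠ 0 := by
    rw [Ne, ZMod.natCast_eq_zero_iff]
    intro h
    exact absurd (Nat.le_of_dvd hm h) (by omega)
  have hd : p ∣ (-((m + 1 : ℕ) : ZMod p) / m).val * m + (m + 1) := by
    rw [← ZMod.natCast_eq_zero_iff]
    push_cast
    rw [ZMod.natCast_zmod_val]
    field_simp
    ring
  refine ⟨_, ?_, ZMod.val_lt _, hd⟩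
  apply Nat.pos_of_ne_zero
  intro h
  rw [h, zero_mul, zero_add] at hd
  exact absurd (Nat.le_of_dvd (by omega) hd) (by omega)

lemma dvd_of_c {p m c : ℕ} (hc : p ∣ c * m + (m + 1)) {u : ℕ} {s : ℤ}
    (h : (p : ℤ) ∣ s - u * c) : (p : ℤ) ∣ u * (m + 1) + s * m := by
  have h1 : (p : ℤ) ∣ ((c * m + (m + 1) : ℕ) : ℤ) := by exact_mod_cast hc
  have e : (u * (m + 1) + s * m : ℤ) = (s - u * c) * m + u * ((c * m + (m + 1) : ℕ) : ℤ) := by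
    push_cast; ring
  rw [e]
  exact dvd_add (Dvd.dvd.mul_right h _) (Dvd.dvd.mul_left h1 _)

lemma not_good {p D m : ℕ} (hp : p.Prime) (hD : 2 ≤ D) (hpD : D ^ 2 < p) (hm : 1 ≤ m)
    (hmp : m + 1 < p) (hb : ¬ Good p D m) :
    ∃ q r : ℕ, 1 ≤ q ∧ q ≤ D ∧ r < D ^ 2 ∧ (p : ℤ) ∣ q * (m + 1) - r * m := by
  obtain ⟨c, hc0, hcp, hc⟩ := exists_c hp hm hmp
  obtain ⟨j, k, hk0, hkD, hjk⟩ := Real.exists_int_int_abs_mul_sub_le ((c : ℝ) / p)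
    (show 0 < D by omega)
  lift k to ℕ using hk0.le
  have hk0 : 0 < k := by exact_mod_cast hk0
  have hkD : k ≤ D := by exact_mod_cast hkD
  have hpos : (0 : ℝ) < p := by exact_mod_cast hp.pos
  have habs : |(k : ℤ) * c - j * p| * (D + 1) ≤ p := by
    have e : ((k : ℤ) : ℝ) * ((c : ℝ) / p) - j = (((k : ℤ) * c - j * p : ℤ) : ℝ) / p := by
      push_cast; field_simp
    rw [e, abs_div, abs_of_pos hpos, div_le_div_iff₀ hpos (by positivity)] at hjk
    have : ((|(k : ℤ) * c - j * p| * (D + 1) : ℤ) : ℝ) ≤ ((p : ℤ) : ℝ) := by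
      push_cast at hjk ⊢
      linarith
    exact_mod_cast this
  set d : ℤ := (k : ℤ) * c - j * p with hd
  have hkp : k * D ≤ p := by nlinarith
  have hdk : (p : ℤ) ∣ d - k * c := ⟨-j, by rw [hd]; ring⟩
  have hd0 : d ≠ 0 := by
    intro h0
    rw [h0, zero_sub, dvd_neg] at hdk
    have h1 : p ∣ k * c := by exact_mod_cast hdk
    rcases (hp.dvd_mul).1 h1 with h | h
    · have := Nat.le_of_dvd hk0 h; nlinarith
    · have := Nat.le_of_dvd hc0 h; omega
  rcases lt_or_gt_of_ne hd0 with hneg | hposd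
  · -- negative
    obtain ⟨r, hr⟩ : ∃ r : ℕ, d = -(r : ℤ) := ⟨(-d).toNat, by omega⟩
    rw [hr] at habs hdk hneg
    rw [abs_neg, Nat.abs_cast] at habs
    have habs : r * (D + 1) ≤ p := by exact_mod_cast habs
    have hr0 : 0 < r := by omega
    by_cases hrD : r < D ^ 2
    · refine ⟨k, r, hk0, hkD, hrD, ?_⟩
      have := dvd_of_c hc hdk
      convert this using 1
      ring
    · exfalso
      push Not at hrD
      apply hb
      set t := (p - 1) / r with ht
      have h1 : t * r ≤ p - 1 := Nat.div_mul_le_self _ _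
      have h2 : p - 1 < (t + 1) * r := by
        have := Nat.lt_div_mul_add (a := p - 1) hr0
        rw [← ht] at this
        linarith
      have hp1 := hp.one_lt
      have h1' : t * r + 1 ≤ p := by omega
      have ht1 : 1 ≤ t := by
        rw [ht, Nat.one_le_div_iff hr0]
        have : r * (D + 1) ≥ r * 3 := Nat.mul_le_mul_left _ (by omega)
        omega
      have h2' : p ≤ (t + 1) * r := by omega
      have h3 : p - t * r ≤ r := by
        have : (t + 1) * r = t * r + r := by ring
        omega
      refine ⟨t * k, p - t * r, Nat.mul_pos ht1 hk0, ?_, by omega, ?_, ?_⟩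
      · calc t * k * D ≤ t * D * D := by gcongr
          _ = t * D ^ 2 := by ring
          _ ≤ t * r := by gcongr
          _ ≤ p := by omega
      · calc (p - t * r) * D ≤ r * D := by gcongr
          _ ≤ p := by nlinarith
      · have : (p : ℤ) ∣ ((t * k : ℕ) : ℤ) * (m + 1) + ((p : ℤ) - t * r) * m := by
          apply dvd_of_c hc
          have e : ((p : ℤ) - t * r) - ((t * k : ℕ) : ℤ) * c = p + t * (-(r : ℤ) - k * c) := by
            push_cast; ring
          rw [e]
          exact dvd_add dvd_rfl (Dvd.dvd.mul_left hdk _)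
        have e2 : ((p - t * r : ℕ) : ℤ) = (p : ℤ) - t * r := by
          rw [Nat.cast_sub (by omega)]; push_cast; ring
        rw [← e2] at this
        exact_mod_cast this
  · exfalso
    apply hb
    lift d to ℕ using hposd.le with d' hd'
    rw [Nat.abs_cast] at habs
    have habs : d' * (D + 1) ≤ p := by exact_mod_cast habs
    refine ⟨k, d', hk0, hkp, by omega, by nlinarith, ?_⟩
    have := dvd_of_c hc hdk
    exact_mod_cast this

lemma bad_card (p D : ℕ) (hp : p.Prime) (hD : 2 ≤ D) (hpD : D ^ 2 + D < p) (B : Finset ℕ)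
    (hB : ∀ m ∈ B, 1 ≤ m ∧ m + 1 < p ∧ ¬ Good p D m) : #B ≤ (D + 1) * D ^ 2 := by
  classical
  have key : ∀ m : ℕ, ∃ qr : ℕ × ℕ, m ∈ B → 1 ≤ qr.1 ∧ qr.1 ≤ D ∧ qr.2 < D ^ 2 ∧
      (p : ℤ) ∣ qr.1 * (m + 1) - qr.2 * m := by
    intro m
    by_cases h : m ∈ B
    · obtain ⟨h1, h2, h3⟩ := hB m h
      obtain ⟨q, r, h⟩ := not_good hp hD (by omega) h1 h2 h3
      exact ⟨(q, r), fun _ => h⟩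
    · exact ⟨(0, 0), fun h' => absurd h' h⟩
  choose f hf using key
  have : #B ≤ #(range (D + 1) ×ˢ range (D ^ 2)) := by
    apply card_le_card_of_injOn f
    · intro m hm
      have := hf m hm
      simp only [coe_product, coe_range, Set.mem_prod, Set.mem_Iio]
      omega
    · intro m hm m' hm' he
      obtain ⟨h1, h2, h3, h4⟩ := hf m hm
      obtain ⟨-, -, -, h4'⟩ := hf m' hm'
      obtain ⟨a1, a2, -⟩ := hB m hm
      obtain ⟨b1, b2, -⟩ := hB m' hm'
      rw [← he] at h4'
      set q := (f m).1
      set r := (f m).2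
      have h5 := dvd_sub h4 h4'
      have e : ((q : ℤ) * (m + 1) - r * m) - (q * (m' + 1) - r * m') = (q - r) * (m - m') := by ring
      rw [e] at h5
      have hpp : Prime (p : ℤ) := Nat.prime_iff_prime_int.1 hp
      rcases hpp.dvd_or_dvd h5 with h | h
      · exfalso
        have hqr : (q : ℤ) - r = 0 := by
          apply Int.eq_zero_of_abs_lt_dvd h
          rw [abs_lt]; constructor <;> omega
        have : (p : ℤ) ∣ q := by
          have e2 : (q : ℤ) = (q * (m + 1) - r * m) - (q - r) * m := by ring
          rw [e2, hqr]
          simpa using h4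
        have : p ∣ q := by exact_mod_cast this
        have := Nat.le_of_dvd h1 this
        omega
      · have : (m : ℤ) - m' = 0 := by
          apply Int.eq_zero_of_abs_lt_dvd h
          rw [abs_lt]; constructor <;> omega
        omega
  simpa using this

lemma step (p D : ℕ) (hp : p.Prime) (hD : 2 ≤ D) (hpD : D ≤ p) (m u : ℕ) (hm : 1 ≤ m)
    (hmp : m + 1 < p) (hu : 1 ≤ u) (huD : u * D ≤ p) :
    ∃ u' s, 1 ≤ u' ∧ u' * D ≤ p ∧ 1 ≤ s ∧ s + u ≤ p ∧ p ∣ u' * (m + 1) + s * m ∧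
      (Good p D m → s * D ≤ p) := by
  have h2u : u * 2 ≤ p := le_trans (Nat.mul_le_mul_left _ hD) huD
  by_cases hg : Good p D m
  · obtain ⟨u', s, h1, h2, h3, h4, h5⟩ := hg
    refine ⟨u', s, h1, h2, h3, ?_, h5, fun _ => h4⟩
    have : s * 2 ≤ p := le_trans (Nat.mul_le_mul_left _ hD) h4
    omega
  · obtain ⟨c, hc0, hcp, hc⟩ := exists_c hp hm hmp
    by_cases h : c + u ≤ p
    · refine ⟨1, c, le_rfl, by omega, hc0, h, ?_, fun h => absurd h hg⟩
      rw [one_mul, add_comm]; exact hc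
    · push Not at h
      set j := p - c with hj
      have hj0 : 0 < j := by omega
      have hju : j < u := by omega
      set t := (u + j - 1) / j with ht
      have h1 : t * j ≤ u + j - 1 := Nat.div_mul_le_self _ _
      have h2 : u + j - 1 < (t + 1) * j := by
        have := Nat.lt_div_mul_add (a := u + j - 1) hj0
        rw [← ht] at this
        linarith
      have h3 : (t + 1) * j = t * j + j := by ring
      have htu : t ≤ u := by
        by_contra! h'
        have : (u + 1) * j ≤ t * j := Nat.mul_le_mul_right _ h'
        have e1 : (u + 1) * j = u * j + j := by ring
        have e2 : u * 1 ≤ u * j := Nat.mul_le_mul_left _ hj0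
        omega
      have ht1 : 1 ≤ t := by
        rw [ht, Nat.one_le_div_iff hj0]; omega
      refine ⟨t, p - t * j, ht1, le_trans (Nat.mul_le_mul_right _ htu) huD, by omega, by omega, ?_,
        fun h => absurd h hg⟩
      have : (p : ℤ) ∣ (t : ℤ) * (m + 1) + ((p : ℤ) - t * j) * m := by
        apply dvd_of_c hc
        have e : (j : ℤ) = p - c := by omega
        refine ⟨1 - t, ?_⟩
        rw [e]; ring
      have e2 : ((p - t * j : ℕ) : ℤ) = (p : ℤ) - t * j := by
        rw [Nat.cast_sub (by omega)]; push_cast; ring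
      rw [← e2] at this
      exact_mod_cast this

lemma exists_seq (p D : ℕ) (hp : p.Prime) (hD : 2 ≤ D) (hpD : D ≤ p) :
    ∃ U r : ℕ → ℕ, U 0 = 1 ∧ (∀ n, p ≤ n + 2 → r n = 0) ∧ ∀ n, n + 2 < p →
      1 ≤ U n ∧ U n + r n < p ∧ p ∣ U (n + 1) * (n + 2) + (p - (U n + r n)) * (n + 1) ∧
      (Good p D (n + 1) → D * p ≤ D * r n + 2 * p) := by
  have key : ∀ n u : ℕ, ∃ us : ℕ × ℕ, (1 ≤ u ∧ u * D ≤ p) → (1 ≤ us.1 ∧ us.1 * D ≤ p) ∧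
      (n + 2 < p → 1 ≤ us.2 ∧ us.2 + u ≤ p ∧ p ∣ us.1 * (n + 2) + us.2 * (n + 1) ∧
      (Good p D (n + 1) → us.2 * D ≤ p)) := by
    intro n u
    by_cases h : n + 2 < p ∧ 1 ≤ u ∧ u * D ≤ p
    · obtain ⟨u', s, h1, h2, h3, h4, h5, h6⟩ :=
        step p D hp hD hpD (n + 1) u (by omega) (by omega) h.2.1 h.2.2
      exact ⟨(u', s), fun _ => ⟨⟨h1, h2⟩, fun _ => ⟨h3, h4, h5, h6⟩⟩⟩
    · exact ⟨(u, 0), fun h1 => ⟨h1, fun h2 => absurd ⟨h2, h1⟩ h⟩⟩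
  choose F hF using key
  let U : ℕ → ℕ := fun n => Nat.rec 1 (fun n u => (F n u).1) n
  have hU1 : ∀ n, U (n + 1) = (F n (U n)).1 := fun n => rfl
  have hU : ∀ n, 1 ≤ U n ∧ U n * D ≤ p := by
    intro n
    induction n with
    | zero => exact ⟨le_rfl, by simpa [U] using hpD⟩
    | succ n ih => rw [hU1]; exact (hF n (U n) ih).1
  refine ⟨U, fun n => if n + 2 < p then p - U n - (F n (U n)).2 else 0, rfl, ?_, ?_⟩
  · intro n hn
    simp only
    rw [if_neg (by omega)]
  · intro n hn
    simp only [if_pos hn]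
    obtain ⟨h1, h2, h3, h4⟩ := (hF n (U n) (hU n)).2 hn
    refine ⟨(hU n).1, by omega, ?_, ?_⟩
    · rw [hU1]
      have : p - (U n + (p - U n - (F n (U n)).2)) = (F n (U n)).2 := by omega
      rw [this]
      exact h3
    · intro hg
      have h5 := h4 hg
      have h6 := (hU n).2
      set s := (F n (U n)).2
      obtain ⟨a, ha⟩ : ∃ a, a = p - U n - s := ⟨_, rfl⟩
      rw [← ha]
      have : p = U n + s + a := by omega
      have : D * p = D * (U n + s + a) := by rw [← this]
      nlinarith

end nt

section lower

lemma lower_X (p : ℕ) (hp : p.Prime) (U r : ℕ → ℕ) (hU0 : U 0 = 1)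
    (hr0 : ∀ n, p ≤ n + 2 → r n = 0)
    (hUr : ∀ n, n + 2 < p → 1 ≤ U n ∧ U n + r n < p ∧
      p ∣ U (n + 1) * (n + 2) + (p - (U n + r n)) * (n + 1)) :
    ∃ X : Finset ℕ, 0 ∉ X ∧ (∀ x, x + p ∈ X → x ∈ X) ∧ (∀ x ∈ X, ¬ p ∣ G X x) ∧
      ∑ n ∈ range p, r n * ((p - (n + 1)) * ∑ i ∈ range n, r i * (i + 1)) ≤ ∑ x ∈ X, G X x := by
  classical
  have hp0 := hp.pos
  set R : ℕ → ℕ := fun n => ∑ i ∈ range n, r i with hR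
  have hRs : ∀ n, R (n + 1) = R n + r n := fun n => sum_range_succ _ _
  have hRm : Monotone R := monotone_nat_of_le_succ (fun n => by rw [hRs]; omega)
  set X : Finset ℕ := (range (R p * p)).filter (fun x => 0 < x % p ∧ x / p < R (p - x % p)) with hX
  have hmem' : ∀ x, x ∈ X ↔ 0 < x % p ∧ x / p < R (p - x % p) := by
    intro x
    rw [hX, mem_filter, mem_range]
    refine ⟨fun h => h.2, fun h => ⟨?_, h⟩⟩
    rw [← Nat.div_lt_iff_lt_mul hp0]
    exact lt_of_lt_of_le h.2 (hRm (by omega))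
  have hmem : ∀ k t, t < p → (k * p + t ∈ X ↔ 0 < t ∧ k < R (p - t)) := by
    intro k t ht
    rw [hmem']
    have h1 : (k * p + t) % p = t := by
      rw [mul_comm, Nat.mul_add_mod, Nat.mod_eq_of_lt ht]
    have h2 : (k * p + t) / p = k := by
      rw [mul_comm, Nat.mul_add_div hp0, Nat.div_eq_of_lt ht, add_zero]
    rw [h1, h2]
  have hrow : ∀ n k t, n < p → R n ≤ k → k < R (n + 1) → t < p →
      (k * p + t ∈ X ↔ 0 < t ∧ t + n < p) := by
    intro n k t hn h1 h2 ht
    rw [hmem k t ht]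
    refine and_congr_right fun _ => ⟨fun h => ?_, fun h => ?_⟩
    · by_contra! h'
      have := hRm (show p - t ≤ n by omega)
      omega
    · have := hRm (show n + 1 ≤ p - t by omega)
      omega
  have hgp : ∀ n k, n < p → R n ≤ k → k < R (n + 1) → gp X p k = n + 1 := by
    intro n k hn h1 h2
    have h3 := card_row X p k
    have : (range p).filter (fun t => k * p + t ∈ X) = Icc 1 (p - 1 - n) := by
      ext t
      simp only [mem_filter, mem_range, mem_Icc]
      constructor
      · rintro ⟨h4, h5⟩
        rw [hrow n k t hn h1 h2 h4] at h5
        omega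
      · intro h4
        refine ⟨by omega, ?_⟩
        rw [hrow n k t hn h1 h2 (by omega)]
        omega
    rw [this, Nat.card_Icc] at h3
    omega
  have hG1 : ∀ n i, n < p → i ≤ r n → G X ((R n + i) * p) = G X (R n * p) + i * (n + 1) := by
    intro n i hn
    induction i with
    | zero => intro _; simp
    | succ i ih =>
      intro hi
      rw [← add_assoc, G_succ_mul, ih (by omega), hgp n (R n + i) hn (by omega) (by rw [hRs]; omega)]
      ring
  have hG2 : ∀ n, n ≤ p → G X (R n * p) = ∑ i ∈ range n, r i * (i + 1) := by
    intro n
    induction n with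
    | zero => intro _; simp [hR, G]
    | succ n ih =>
      intro hn
      rw [hRs, hG1 n (r n) (by omega) le_rfl, ih (by omega), sum_range_succ]
  have hmod : ∀ n, n + 1 < p → ((G X (R n * p) + 1 : ℕ) : ZMod p) = ((U n * (n + 1) : ℕ) : ZMod p) := by
    intro n
    induction n with
    | zero => intro _; simp [hR, G, hU0]
    | succ n ih =>
      intro hn
      have h1 := ih (by omega)
      obtain ⟨h2, h3, h4⟩ := hUr n (by omega)
      rw [← ZMod.natCast_eq_zero_iff] at h4
      rw [hRs, hG1 n (r n) (by omega) le_rfl]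
      rw [Nat.cast_add, Nat.cast_mul, Nat.cast_mul, Nat.cast_sub h3.le] at h4
      push_cast at h1 h4 ⊢
      rw [CharP.cast_eq_zero (ZMod p) p] at h4
      linear_combination h1 - h4
  refine ⟨X, ?_, ?_, ?_, ?_⟩
  · have := hmem 0 0 hp0
    simp at this
    exact this
  · intro x hx
    rw [hmem'] at hx ⊢
    rw [Nat.add_mod_right, Nat.add_div_right _ hp0] at hx
    omega
  · intro x hx hdvd
    set k := x / p with hk
    set t := x % p with ht
    have hxe : x = k * p + t := by rw [hk, ht, mul_comm]; exact (Nat.div_add_mod x p).symm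
    have htp : t < p := Nat.mod_lt _ hp0
    have hx' := (hmem k t htp).1 (hxe ▸ hx)
    have hex : ∃ n, k < R (n + 1) := ⟨p - t, lt_of_lt_of_le hx'.2 (hRm (by omega))⟩
    set n := Nat.find hex with hn
    have hn1 : k < R (n + 1) := Nat.find_spec hex
    have hn2 : R n ≤ k := by
      rcases Nat.eq_zero_or_pos n with h | h
      · rw [h]; simp [hR]
      · have := Nat.find_min hex (show n - 1 < n by omega)
        rw [show n - 1 + 1 = n by omega] at this
        omega
    have hrn : k - R n < r n := by
      have := hRs n
      omega
    have hnp : n + 2 < p := by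
      by_contra! h
      have := hr0 n h
      omega
    have htn := (hrow n k t (by omega) hn2 hn1 htp).1 (hxe ▸ hx)
    have hcount : Nat.count (fun s => k * p + s ∉ X) t = 1 := by
      rw [Nat.count_eq_card_filter_range, card_eq_one]
      refine ⟨0, ?_⟩
      ext s
      simp only [mem_filter, mem_range, mem_singleton]
      constructor
      · rintro ⟨h1, h2⟩
        rw [hrow n k s (by omega) hn2 hn1 (by omega)] at h2
        omega
      · rintro rfl
        refine ⟨htn.1, ?_⟩
        rw [hrow n k 0 (by omega) hn2 hn1 (by omega)]
        omega
    obtain ⟨i, hi⟩ : ∃ i, k = R n + i := ⟨k - R n, by omega⟩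
    obtain ⟨hu1, hu2, -⟩ := hUr n hnp
    have hGx : G X x = G X (R n * p) + 1 + i * (n + 1) := by
      rw [hxe, G_add, hcount, hi, hG1 n i (by omega) (by omega)]
      ring
    have hm := hmod n (by omega)
    rw [hGx, ← ZMod.natCast_eq_zero_iff, Nat.cast_add, hm, ← Nat.cast_add, ← add_mul,
      ZMod.natCast_eq_zero_iff] at hdvd
    rcases hp.dvd_mul.1 hdvd with h | h
    · have := Nat.le_of_dvd (by omega) h
      omega
    · have := Nat.le_of_dvd (by omega) h
      omega
  · have hb : ∀ x ∈ X, x < R p * p := fun x hx => mem_range.1 (mem_filter.1 hx).1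
    rw [sum_X X p (R p) hb]
    refine le_trans ?_ (sum_le_sum fun k _ => le_row X p k)
    have : ∀ n, n ≤ p → ∑ i ∈ range n, r i * ((p - (i + 1)) * ∑ i ∈ range i, r i * (i + 1)) ≤
        ∑ k ∈ range (R n), (p - gp X p k) * G X (k * p) := by
      intro n
      induction n with
      | zero => intro _; simp
      | succ n ih =>
        intro hn
        rw [hRs, sum_range_succ, sum_range_add]
        apply Nat.add_le_add (ih (by omega))
        have h1 : ∀ i ∈ range (r n), (p - (n + 1)) * ∑ i ∈ range n, r i * (i + 1) ≤
            (p - gp X p (R n + i)) * G X ((R n + i) * p) := by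
          intro i hi
          have hi := mem_range.1 hi
          rw [hgp n (R n + i) (by omega) (by omega) (by rw [hRs]; omega),
            hG1 n i (by omega) (by omega), hG2 n (by omega)]
          exact Nat.mul_le_mul_left _ (Nat.le_add_right _ _)
        have h2 := card_nsmul_le_sum _ _ _ h1
        simpa using h2
    exact this p le_rfl

lemma wsum (p b : ℕ) (θ : ℝ) (r : ℕ → ℕ) (B : Finset ℕ) (hB : #B ≤ b)
    (hθ1 : θ ≤ 1)
    (hr : ∀ n < p, n ∉ B → θ * p ≤ r n) (w : ℕ → ℝ) (W : ℝ) (N : ℕ) (hN : N ≤ p) (hW : 0 ≤ W)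
    (hw : ∀ n < N, 0 ≤ w n ∧ w n ≤ W) :
    θ * p * ∑ n ∈ range N, w n - b * (p * W) ≤ ∑ n ∈ range N, (r n : ℝ) * w n := by
  classical
  have h1 : ∀ n ∈ range N, θ * p * w n - (if n ∈ B then p * W else 0) ≤ (r n : ℝ) * w n := by
    intro n hn
    have hn := mem_range.1 hn
    obtain ⟨h0, h1⟩ := hw n hn
    by_cases h : n ∈ B
    · rw [if_pos h]
      have h2 : (0 : ℝ) ≤ r n * w n := by positivity
      have h3 : θ * p * w n ≤ p * W := by
        calc θ * p * w n ≤ 1 * p * w n := by gcongr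
          _ = p * w n := by ring
          _ ≤ p * W := by gcongr
      linarith
    · rw [if_neg h, sub_zero]
      exact mul_le_mul_of_nonneg_right (hr n (by omega) h) h0
  have h2 := sum_le_sum h1
  rw [sum_sub_distrib, ← mul_sum, ← sum_filter, sum_const, nsmul_eq_mul] at h2
  have h3 : (#((range N).filter (fun n => n ∈ B)) : ℝ) ≤ b := by
    have : #((range N).filter (fun n => n ∈ B)) ≤ #B :=
      card_le_card (fun x hx => (mem_filter.1 hx).2)
    exact_mod_cast this.trans hB
  have h4 : (#((range N).filter (fun n => n ∈ B)) : ℝ) * (p * W) ≤ b * (p * W) :=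
    mul_le_mul_of_nonneg_right h3 (by positivity)
  linarith

lemma lower_sum (p b : ℕ) (hp : 1 ≤ p) (θ : ℝ) (r : ℕ → ℕ) (B : Finset ℕ) (hB : #B ≤ b)
    (hθ0 : 0 ≤ θ) (hθ1 : θ ≤ 1) (hrp : ∀ n < p, r n ≤ p)
    (hr : ∀ n < p, n ∉ B → θ * p ≤ r n) :
    θ ^ 2 * (p : ℝ) ^ 6 / 24 - (1 + 2 * b) * (p : ℝ) ^ 5 ≤
    ((∑ n ∈ range p, r n * ((p - (n + 1)) * ∑ i ∈ range n, r i * (i + 1)) : ℕ) : ℝ) := by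
  have hp1 : (1 : ℝ) ≤ p := by exact_mod_cast hp
  have hM : ∀ n < p, θ * p * (n * (n + 1) / 2) - b * p ^ 2 ≤
      ((∑ i ∈ range n, r i * (i + 1) : ℕ) : ℝ) := by
    intro n hn
    have := wsum p b θ r B hB hθ1 hr (fun i => (i : ℝ) + 1) p n hn.le (by positivity) (by
      intro i hi
      refine ⟨by positivity, ?_⟩
      have : i + 1 ≤ p := by omega
      exact_mod_cast this)
    push_cast
    rw [sum_add_distrib, sum_id_real] at this
    simp only [sum_const, card_range, nsmul_eq_mul] at this
    refine le_trans (le_of_eq ?_) this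
    ring
  have h1 : ∀ n ∈ range p, (r n : ℝ) * (((p : ℝ) - 1 - n) * (θ * p * (n * (n + 1) / 2)))
      - b * p ^ 4 ≤ ((r n * ((p - (n + 1)) * ∑ i ∈ range n, r i * (i + 1)) : ℕ) : ℝ) := by
    intro n hn
    have hn := mem_range.1 hn
    rw [Nat.cast_mul, Nat.cast_mul, Nat.cast_sub (by omega)]
    have h2 := hM n hn
    have h3 : (0 : ℝ) ≤ p - 1 - n := by
      have : ((n + 1 : ℕ) : ℝ) ≤ p := by exact_mod_cast hn
      push_cast at this; linarith
    have h4 : (r n : ℝ) ≤ p := by exact_mod_cast hrp n hn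
    have h5 : (p : ℝ) - 1 - n ≤ p := by
      have : (0 : ℝ) ≤ n := by positivity
      linarith
    have h6 : (r n : ℝ) * ((p : ℝ) - 1 - n) * (b * p ^ 2) ≤ p * p * (b * p ^ 2) := by gcongr
    have h7 := mul_le_mul_of_nonneg_left h2 (show 0 ≤ (r n : ℝ) * ((p : ℝ) - 1 - n) by positivity)
    have e : ((p : ℝ) - ((n + 1 : ℕ) : ℝ)) = p - 1 - n := by push_cast; ring
    rw [e]
    nlinarith
  have h2 := sum_le_sum h1
  rw [← Nat.cast_sum, sum_sub_distrib] at h2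
  simp only [sum_const, card_range, nsmul_eq_mul] at h2
  refine le_trans ?_ h2
  have h3 := wsum p b θ r B hB hθ1 hr
    (fun n => ((p : ℝ) - 1 - n) * (θ * p * (n * (n + 1) / 2))) (p ^ 4) p le_rfl (by positivity) (by
      intro n hn
      have h3 : (0 : ℝ) ≤ p - 1 - n := by
        have : ((n + 1 : ℕ) : ℝ) ≤ p := by exact_mod_cast hn
        push_cast at this; linarith
      have h0 : (0 : ℝ) ≤ n := by positivity
      refine ⟨by positivity, ?_⟩
      have h4 : (n : ℝ) * (n + 1) / 2 ≤ p ^ 2 := by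
        have : (n : ℝ) + 1 ≤ p := by linarith
        nlinarith
      calc ((p : ℝ) - 1 - n) * (θ * p * (n * (n + 1) / 2)) ≤ p * (1 * p * p ^ 2) := by
            gcongr
            linarith
        _ = p ^ 4 := by ring)
  have h4 : ∑ n ∈ range p, ((p : ℝ) - 1 - n) * (θ * p * (n * (n + 1) / 2)) =
      θ * p * ∑ n ∈ range p, (((p : ℝ) - 1) - n) * (n * (n + 1) / 2 : ℝ) := by
    rw [mul_sum]
    apply sum_congr rfl
    intro n _
    ring
  rw [h4, sum_poly] at h3
  set S := ((p : ℝ) - 1) * ((p - 1) * p * (p + 1)) / 6 -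
    ((p - 1) ^ 2 * p ^ 2 / 4 + (p - 1) * p * (2 * p - 1) / 6) / 2 with hS
  have h5 : (p : ℝ) ^ 4 / 24 - p ^ 3 ≤ S := by
    rw [hS]
    have a1 : (0 : ℝ) ≤ p ^ 2 * (p - 1) := mul_nonneg (by positivity) (by linarith)
    have a2 : (0 : ℝ) ≤ p * (p - 1) := mul_nonneg (by positivity) (by linarith)
    nlinarith
  have h6 : θ * p * (θ * p) * (p ^ 4 / 24 - p ^ 3) ≤ θ * p * (θ * p) * S :=
    mul_le_mul_of_nonneg_left h5 (by positivity)
  have h7 : θ ^ 2 * (p : ℝ) ^ 5 ≤ 1 * p ^ 5 := by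
    apply mul_le_mul_of_nonneg_right _ (by positivity)
    nlinarith
  nlinarith

lemma lower_final (p D : ℕ) (hp : p.Prime) (hD : 2 ≤ D) (hpD : D ^ 2 + D < p) :
    ∃ X : Finset ℕ, 0 ∉ X ∧ (∀ x, x + p ∈ X → x ∈ X) ∧ (∀ x ∈ X, ¬ p ∣ G X x) ∧
      (1 - 2 / (D : ℝ)) ^ 2 * (p : ℝ) ^ 6 / 24 -
        (1 + 2 * (((D + 1) * D ^ 2 + 2 : ℕ) : ℝ)) * (p : ℝ) ^ 5 ≤ ((∑ x ∈ X, G X x : ℕ) : ℝ) := by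
  classical
  obtain ⟨U, r, hU0, hr0, hUr⟩ := exists_seq p D hp hD (by omega)
  obtain ⟨X, h1, h2, h3, h4⟩ := lower_X p hp U r hU0 hr0
    (fun n hn => ⟨(hUr n hn).1, (hUr n hn).2.1, (hUr n hn).2.2.1⟩)
  refine ⟨X, h1, h2, h3, ?_⟩
  have h4' : ((∑ n ∈ range p, r n * ((p - (n + 1)) * ∑ i ∈ range n, r i * (i + 1)) : ℕ) : ℝ) ≤
    ((∑ x ∈ X, G X x : ℕ) : ℝ) := by exact_mod_cast h4
  refine le_trans ?_ h4'
  have hD0 : (2 : ℝ) ≤ D := by exact_mod_cast hD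
  set B0 := (range p).filter (fun n => n + 2 < p ∧ ¬ Good p D (n + 1)) with hB0
  have hcard0 : #B0 ≤ (D + 1) * D ^ 2 := by
    rw [← card_image_of_injective B0 (add_left_injective 1)]
    apply bad_card p D hp hD hpD
    intro m hm
    obtain ⟨n, hn, rfl⟩ := mem_image.1 hm
    have := (mem_filter.1 hn).2
    exact ⟨by omega, by omega, this.2⟩
  apply lower_sum p ((D + 1) * D ^ 2 + 2) hp.one_lt.le (1 - 2 / (D : ℝ)) r (B0 ∪ {p - 2, p - 1})
  · refine (card_union_le _ _).trans (Nat.add_le_add hcard0 card_le_two)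
  · rw [sub_nonneg, div_le_one (by linarith)]; exact hD0
  · have : 0 ≤ 2 / (D : ℝ) := by positivity
    linarith
  · intro n hn
    by_cases h : n + 2 < p
    · have := (hUr n h).2.1; omega
    · rw [hr0 n (by omega)]; omega
  · intro n hn hnB
    simp only [mem_union, mem_insert, mem_singleton, not_or, hB0, mem_filter, mem_range, not_and,
      not_not] at hnB
    have hnp : n + 2 < p := by omega
    have h5 := (hUr n hnp).2.2.2 (hnB.1 hn hnp)
    have h6 : (D : ℝ) * p ≤ D * r n + 2 * p := by exact_mod_cast h5
    have h7 : (1 - 2 / (D : ℝ)) * p = (D * p - 2 * p) / D := by field_simp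
    rw [h7, div_le_iff₀ (by linarith)]
    linarith

end lower

end PCore

/-- The maximal size of a `p`-core `p'`-partition is asymptotic to `p^6/24` as
`p → ∞` through primes: for every `ε > 0` there is `N` such that for every prime
`p > N`, every `p`-core `p'`-partition has size `< (1/24 + ε)·p^6`, and some
`p`-core `p'`-partition has size `> (1/24 - ε)·p^6`. -/
theorem max_pcore_pprime_asymptotic (ε : ℝ) (hε : 0 < ε) :
    ∃ N : ℕ, ∀ p : ℕ, p.Prime → N < p →
      (∀ μ : YoungDiagram,
          (∀ c ∈ μ.cells, ¬ p ∣ μ.hookLength c.1 c.2) →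
          (∀ r ∈ μ.rowLens, ¬ p ∣ r) →
          (μ.card : ℝ) < (1 / 24 + ε) * (p : ℝ) ^ 6) ∧
      (∃ μ : YoungDiagram,
          (∀ c ∈ μ.cells, ¬ p ∣ μ.hookLength c.1 c.2) ∧
          (∀ r ∈ μ.rowLens, ¬ p ∣ r) ∧
          (1 / 24 - ε) * (p : ℝ) ^ 6 < (μ.card : ℝ)) := by
  obtain ⟨D0, hD0⟩ := exists_nat_gt (1 / ε)
  set D := D0 + 2 with hD
  set C : ℝ := 1 + 2 * (((D + 1) * D ^ 2 + 2 : ℕ) : ℝ) with hC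
  have hC1 : 2 ≤ C := by
    have : (2 : ℝ) ≤ (((D + 1) * D ^ 2 + 2 : ℕ) : ℝ) := by
      exact_mod_cast Nat.le_add_left _ _
    linarith
  obtain ⟨N0, hN0⟩ := exists_nat_gt (2 * C / ε)
  refine ⟨N0 + (D ^ 2 + D), fun p hp hpN => ?_⟩
  have hp0 : (0 : ℝ) < p := by exact_mod_cast hp.pos
  have hpC : 2 * C < ε * p := by
    have h1 : (N0 : ℝ) ≤ p := by
      have : N0 ≤ p := by omega
      exact_mod_cast this
    rw [div_lt_iff₀ hε] at hN0
    nlinarith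
  have hp5 : (0 : ℝ) < (p : ℝ) ^ 5 := by positivity
  have hC5 : 2 * C * (p : ℝ) ^ 5 < ε * (p : ℝ) ^ 6 := by
    have := mul_lt_mul_of_pos_right hpC hp5
    calc _ < _ := this
      _ = _ := by ring
  constructor
  · intro μ h1 h2
    rw [PCore.core_iff μ p hp.pos] at h1
    rw [PCore.parts_iff] at h2
    have h := PCore.upper_real hp (PCore.zero_notMem μ) h1 h2
    rw [PCore.card_eq]
    nlinarith
  · obtain ⟨X, h1, h2, h3, h4⟩ := PCore.lower_final p D hp (by omega) (by omega)
    obtain ⟨μ, rfl⟩ := PCore.exists_diagram X h1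
    refine ⟨μ, (PCore.core_iff μ p hp.pos).2 h2, (PCore.parts_iff μ p).2 h3, ?_⟩
    rw [PCore.card_eq]
    refine lt_of_lt_of_le ?_ h4
    rw [← hC]
    have hDp : (0 : ℝ) < D := by rw [hD]; positivity
    have hDε : 1 / (D : ℝ) < ε := by
      rw [div_lt_iff₀ hDp]
      rw [div_lt_iff₀ hε] at hD0
      have : (D : ℝ) = D0 + 2 := by rw [hD]; push_cast; ring
      rw [this]
      nlinarith
    have hsq : 1 - 4 * ε ≤ (1 - 2 / (D : ℝ)) ^ 2 := by
      have e : 2 / (D : ℝ) = 2 * (1 / D) := by ring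
      rw [e]
      nlinarith [sq_nonneg (1 / (D : ℝ))]
    have h6 : (0 : ℝ) < (p : ℝ) ^ 6 := by positivity
    have h7 := mul_le_mul_of_nonneg_right hsq h6.le
    nlinarith
end

section
/- Let p be a prime and let 1 ≤ i ≤ p − 2 be an integer. Then either there exist coprime integers r, s with 0 < r, s < √p such that i·(r + s) ≡ −s (mod p), or there exist coprime integers r, s with 0 < r, s < √p, not both equal to 1, such that i·(r − s) ≡ s (mod p). -/
lemma aux_thue (p : ℕ) (hp : p.Prime) (i : ℕ) :
    ∃ a b : ℤ, (a ≠ 0 ∨ b ≠ 0) ∧ a.natAbs ≤ Nat.sqrt p ∧ b.natAbs ≤ Nat.sqrt p ∧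
      (p : ℤ) ∣ (i : ℤ) * a + (i + 1) * b := by
  have : NeZero p := ⟨hp.ne_zero⟩
  let k := Nat.sqrt p
  let f : Fin (k+1) × Fin (k+1) → ZMod p :=
    fun x => (i : ZMod p) * ((x.1 : ℕ) : ZMod p) + (i + 1) * ((x.2 : ℕ) : ZMod p)
  have hc : Fintype.card (ZMod p) < Fintype.card (Fin (k+1) × Fin (k+1)) := by
    simp only [ZMod.card, Fintype.card_prod, Fintype.card_fin]
    exact Nat.lt_succ_sqrt p
  obtain ⟨x, y, hxy, h⟩ := Fintype.exists_ne_map_eq_of_card_lt f hc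
  have h1 := x.1.2
  have h2 := x.2.2
  have h3 := y.1.2
  have h4 := y.2.2
  refine ⟨(x.1 : ℕ) - (y.1 : ℕ), (x.2 : ℕ) - (y.2 : ℕ), ?_, ?_, ?_, ?_⟩
  · by_contra! hh
    apply hxy
    ext <;> omega
  · change _ ≤ k
    omega
  · change _ ≤ k
    omega
  · rw [← ZMod.intCast_zmod_eq_zero_iff_dvd]
    push_cast
    simp only [f] at h
    linear_combination h

lemma aux_main (p : ℕ) (hp : p.Prime) (i : ℕ)
    (hi1 : 1 ≤ i) (hi2 : i ≤ p - 2) :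
    ∃ a b : ℤ, a ≠ 0 ∧ b ≠ 0 ∧ a.natAbs ≤ Nat.sqrt p ∧ b.natAbs ≤ Nat.sqrt p ∧
      Nat.Coprime a.natAbs b.natAbs ∧ (p : ℤ) ∣ (i : ℤ) * a + (i + 1) * b := by
  obtain ⟨a, b, h0, ha, hb, hd⟩ := aux_thue p hp i
  have h2 := hp.two_le
  have hkp : Nat.sqrt p < p := Nat.sqrt_lt_self hp.one_lt
  have hP : Prime (p : ℤ) := Nat.prime_iff_prime_int.mp hp
  have small : ∀ z : ℤ, z.natAbs < p → (p : ℤ) ∣ z → z = 0 := fun z hz hd =>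
    Int.eq_zero_of_abs_lt_dvd hd (by rw [Int.abs_eq_natAbs]; omega)
  have ha0 : a ≠ 0 := by
    rintro rfl
    have : (p : ℤ) ∣ (i + 1) * b := by simpa using hd
    rcases hP.dvd_or_dvd this with h | h
    · have := small _ (by omega) h
      omega
    · have := small _ (by omega) h
      omega
  have hb0 : b ≠ 0 := by
    rintro rfl
    have : (p : ℤ) ∣ i * a := by simpa using hd
    rcases hP.dvd_or_dvd this with h | h
    · have := small _ (by omega) h
      omega
    · have := small _ (by omega) h
      omega
  have hg : 0 < Int.gcd a b := Int.gcd_pos_of_ne_zero_left _ ha0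
  obtain ⟨a', b', hc, ea, eb⟩ := Int.exists_gcd_one hg
  generalize Int.gcd a b = g at *
  subst ea eb
  have hga : a'.natAbs ≤ (a' * g).natAbs := by
    rw [Int.natAbs_mul]; exact Nat.le_mul_of_pos_right _ (by simpa using hg)
  have hgb : b'.natAbs ≤ (b' * g).natAbs := by
    rw [Int.natAbs_mul]; exact Nat.le_mul_of_pos_right _ (by simpa using hg)
  refine ⟨a', b', left_ne_zero_of_mul ha0, left_ne_zero_of_mul hb0, by omega, by omega, hc, ?_⟩
  have : (p : ℤ) ∣ (i * a' + (i + 1) * b') * g := by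
    convert hd using 1; ring
  rcases hP.dvd_or_dvd this with h | h
  · exact h
  · exact absurd (small _ (by omega) (h.mul_left a')) ha0

/-- For a prime `p` and `1 ≤ i ≤ p - 2`, either `i ≡ -s/(r+s) (mod p)` for some
coprime `0 < r, s < √p`, or `i ≡ s/(r-s) (mod p)` for some coprime `0 < r, s < √p`
which are not both `1`. -/
theorem fraction_representations (p : ℕ) (hp : p.Prime) (i : ℕ)
    (hi1 : 1 ≤ i) (hi2 : i ≤ p - 2) :
    (∃ r s : ℕ, 0 < r ∧ 0 < s ∧ (r : ℝ) < Real.sqrt p ∧ (s : ℝ) < Real.sqrt p ∧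
      Nat.Coprime r s ∧ (p : ℤ) ∣ ((i : ℤ) * ((r : ℤ) + (s : ℤ)) + (s : ℤ))) ∨
    (∃ r s : ℕ, 0 < r ∧ 0 < s ∧ (r : ℝ) < Real.sqrt p ∧ (s : ℝ) < Real.sqrt p ∧
      Nat.Coprime r s ∧ ¬(r = 1 ∧ s = 1) ∧
      (p : ℤ) ∣ ((i : ℤ) * ((r : ℤ) - (s : ℤ)) - (s : ℤ))) := by
  obtain ⟨a, b, ha0, hb0, ha, hb, hc, hd⟩ := aux_main p hp i hi1 hi2
  have h2 := hp.two_le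
  have key : ∀ n : ℕ, n ≤ Nat.sqrt p → (n : ℝ) < Real.sqrt p := by
    intro n hn
    apply Real.lt_sqrt_of_sq_lt
    have h1 : n * n ≤ p := Nat.le_sqrt.mp hn
    have h3 : n * n ≠ p := by
      intro h
      exact (Nat.prime_mul_iff.not.mpr (by
        rintro (⟨h, h'⟩ | ⟨h, h'⟩) <;> exact absurd (h' ▸ h) Nat.not_prime_one)) (h ▸ hp)
    have h4 : n ^ 2 < p := by rw [sq]; omega
    exact_mod_cast h4
  have na : 0 < a.natAbs := by omega
  have nb : 0 < b.natAbs := by omega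
  have main : (p : ℤ) ∣ i * ((a.natAbs : ℤ) + b.natAbs) + b.natAbs ∨
      (p : ℤ) ∣ i * ((a.natAbs : ℤ) - b.natAbs) - b.natAbs := by
    rcases Int.natAbs_eq a with h | h <;> rcases Int.natAbs_eq b with h' | h' <;>
      rw [h, h'] at hd
    · left; convert hd using 1; ring
    · right; convert hd using 1; ring
    · right; obtain ⟨c, hc'⟩ := hd; exact ⟨-c, by linear_combination -hc'⟩
    · left; obtain ⟨c, hc'⟩ := hd; exact ⟨-c, by linear_combination -hc'⟩
  rcases main with h | h
  · exact Or.inl ⟨_, _, na, nb, key _ ha, key _ hb, hc, h⟩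
  · refine Or.inr ⟨_, _, na, nb, key _ ha, key _ hb, hc, ?_, h⟩
    rintro ⟨e1, e2⟩
    rw [e1, e2] at h
    have h5 : (p : ℤ) ∣ 1 := by
      rw [← dvd_neg]; simpa using h
    have := Int.le_of_dvd one_pos h5
    omega
end

section
/- Let p be a prime and let 1 ≤ i ≤ p − 2 be an integer. Then there is at most one pair (r, s) of coprime integers with 0 < r, s < √p satisfying i·(r + s) ≡ −s (mod p), and at most one pair (r, s) of coprime integers with 0 < r, s < √p, not both equal to 1, satisfying i·(r − s) ≡ s (mod p). -/
lemma frac_aux (p : ℕ) (hp : p.Prime) (i : ℕ) (hi1 : 1 ≤ i) (hi2 : i ≤ p - 2)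
    (r₁ s₁ r₂ s₂ : ℕ) (hs₁ : 0 < s₁)
    (h1 : (r₁ : ℝ) < Real.sqrt p) (h2 : (s₁ : ℝ) < Real.sqrt p)
    (h3 : (r₂ : ℝ) < Real.sqrt p) (h4 : (s₂ : ℝ) < Real.sqrt p)
    (c1 : Nat.Coprime r₁ s₁) (c2 : Nat.Coprime r₂ s₂)
    (hd : (p : ℤ) ∣ (i : ℤ) * ((r₁ : ℤ) * s₂ - r₂ * s₁)) : (r₁, s₁) = (r₂, s₂) := by
  have key : ∀ a b : ℕ, (a : ℝ) < Real.sqrt p → (b : ℝ) < Real.sqrt p → a * b < p := by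
    intro a b ha hb
    have h : (a : ℝ) * b < Real.sqrt p * Real.sqrt p :=
      mul_lt_mul'' ha hb (Nat.cast_nonneg _) (Nat.cast_nonneg _)
    rw [Real.mul_self_sqrt (Nat.cast_nonneg _)] at h
    exact_mod_cast h
  have k1 : (r₁ : ℤ) * s₂ < p := by exact_mod_cast key _ _ h1 h4
  have k2 : (r₂ : ℤ) * s₁ < p := by exact_mod_cast key _ _ h3 h2
  have n1 : (0 : ℤ) ≤ (r₁ : ℤ) * s₂ := by positivity
  have n2 : (0 : ℤ) ≤ (r₂ : ℤ) * s₁ := by positivity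
  have hp2 := hp.two_le
  have hz : (r₁ : ℤ) * s₂ - r₂ * s₁ = 0 := by
    rcases (Nat.prime_iff_prime_int.mp hp).dvd_or_dvd hd with h | h
    · have := Nat.le_of_dvd hi1 (Int.natCast_dvd_natCast.mp h)
      omega
    · exact Int.eq_zero_of_abs_lt_dvd h (by rw [abs_lt]; constructor <;> linarith)
  have he : r₁ * s₂ = r₂ * s₁ := by
    have : (r₁ : ℤ) * s₂ = r₂ * s₁ := by linarith
    exact_mod_cast this
  have d1 : s₁ ∣ s₂ := c1.symm.dvd_of_dvd_mul_left (he ▸ Dvd.intro_left _ rfl)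
  have d2 : s₂ ∣ s₁ := c2.symm.dvd_of_dvd_mul_left (he ▸ Dvd.intro_left _ rfl)
  have e := Nat.dvd_antisymm d1 d2
  subst e
  rw [Nat.eq_of_mul_eq_mul_right hs₁ he]

/-- For a prime `p` and `1 ≤ i ≤ p - 2`, there is at most one pair `(r, s)` of coprime
integers with `0 < r, s < √p` such that `i ≡ -s/(r+s) (mod p)`, and at most one pair
`(r, s)` of coprime integers with `0 < r, s < √p`, not both `1`, such that
`i ≡ s/(r-s) (mod p)`. -/
theorem fraction_representations_unique (p : ℕ) (hp : p.Prime) (i : ℕ)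
    (hi1 : 1 ≤ i) (hi2 : i ≤ p - 2) :
    (∀ r₁ s₁ r₂ s₂ : ℕ,
      (0 < r₁ ∧ 0 < s₁ ∧ (r₁ : ℝ) < Real.sqrt p ∧ (s₁ : ℝ) < Real.sqrt p ∧
        Nat.Coprime r₁ s₁ ∧ (p : ℤ) ∣ ((i : ℤ) * ((r₁ : ℤ) + (s₁ : ℤ)) + (s₁ : ℤ))) →
      (0 < r₂ ∧ 0 < s₂ ∧ (r₂ : ℝ) < Real.sqrt p ∧ (s₂ : ℝ) < Real.sqrt p ∧
        Nat.Coprime r₂ s₂ ∧ (p : ℤ) ∣ ((i : ℤ) * ((r₂ : ℤ) + (s₂ : ℤ)) + (s₂ : ℤ))) →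
      (r₁, s₁) = (r₂, s₂)) ∧
    (∀ r₁ s₁ r₂ s₂ : ℕ,
      (0 < r₁ ∧ 0 < s₁ ∧ (r₁ : ℝ) < Real.sqrt p ∧ (s₁ : ℝ) < Real.sqrt p ∧
        Nat.Coprime r₁ s₁ ∧ ¬(r₁ = 1 ∧ s₁ = 1) ∧
        (p : ℤ) ∣ ((i : ℤ) * ((r₁ : ℤ) - (s₁ : ℤ)) - (s₁ : ℤ))) →
      (0 < r₂ ∧ 0 < s₂ ∧ (r₂ : ℝ) < Real.sqrt p ∧ (s₂ : ℝ) < Real.sqrt p ∧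
        Nat.Coprime r₂ s₂ ∧ ¬(r₂ = 1 ∧ s₂ = 1) ∧
        (p : ℤ) ∣ ((i : ℤ) * ((r₂ : ℤ) - (s₂ : ℤ)) - (s₂ : ℤ))) →
      (r₁, s₁) = (r₂, s₂)) := by
  constructor
  · rintro r₁ s₁ r₂ s₂ ⟨-, hs, a1, a2, c1, d1⟩ ⟨-, -, a3, a4, c2, d2⟩
    refine frac_aux p hp i hi1 hi2 r₁ s₁ r₂ s₂ hs a1 a2 a3 a4 c1 c2 ?_
    have := dvd_sub (d1.mul_left (s₂ : ℤ)) (d2.mul_left (s₁ : ℤ))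
    ring_nf at this ⊢
    exact this
  · rintro r₁ s₁ r₂ s₂ ⟨-, hs, a1, a2, c1, -, d1⟩ ⟨-, -, a3, a4, c2, -, d2⟩
    refine frac_aux p hp i hi1 hi2 r₁ s₁ r₂ s₂ hs a1 a2 a3 a4 c1 c2 ?_
    have := dvd_sub (d1.mul_left (s₂ : ℤ)) (d2.mul_left (s₁ : ℤ))
    ring_nf at this ⊢
    exact this
end

section
/- Let p be a prime, let 1 ≤ i ≤ p − 2, and suppose r, s are coprime integers with 0 < r, s < √p, (r,s) ≠ (1,1), and i·(r − s) ≡ s (mod p). Then p/max(r,s) < x_i + y_i < p/max(r,s) + max(r,s) − 1. -/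
/-- `xmax p i` is the unique residue in `{1, …, p-1}` with `i * xmax ≡ 1 (mod p)`
(for `1 ≤ i ≤ p - 2` and `p` prime). -/
noncomputable def xmax (p i : ℕ) : ℕ := ((i : ZMod p)⁻¹).val

/-- `ymax p i` is the unique residue in `{1, …, p-1}` with `(i+1) * ymax ≡ -1 (mod p)`
(for `1 ≤ i ≤ p - 2` and `p` prime). -/
noncomputable def ymax (p i : ℕ) : ℕ := ((-((i : ZMod p) + 1))⁻¹).val

/-- A pair `(x, y)` of positive integers with `x ≤ xmax p i`, `y ≤ ymax p i` and
`i·x + (i+1)·y ≡ 0 (mod p)`. -/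
def ValidPair (p i : ℕ) (xy : ℕ × ℕ) : Prop :=
  0 < xy.1 ∧ 0 < xy.2 ∧ xy.1 ≤ xmax p i ∧ xy.2 ≤ ymax p i ∧
    p ∣ (i * xy.1 + (i + 1) * xy.2)

-- `minPair p i = (x_i, y_i)` is the valid pair minimizing `x + y`
-- (this minimizer exists and is unique for `1 ≤ i ≤ p - 2` and `p` prime).
open Classical in
noncomputable def minPair (p i : ℕ) : ℕ × ℕ :=
  if h : ∃ xy, ValidPair p i xy ∧
      ∀ xy', ValidPair p i xy' → xy.1 + xy.2 ≤ xy'.1 + xy'.2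
  then h.choose else (0, 0)

theorem core_aux (p : ℕ) (hp : p.Prime) (r s X Y : ℕ) (hs : 0 < s) (hsr : s < r)
    (hrp : r * r < p) (hcop : Nat.Coprime r s)
    (hX : (p : ℤ) ∣ (s : ℤ) * (X + 1) - r) (hY : (p : ℤ) ∣ (r : ℤ) * (Y + 1) - s) :
    ∃ x y : ℕ, 0 < x ∧ 0 < y ∧ x ≤ X ∧ y ≤ Y ∧ s * x + r * y = p ∧ x < r := by
  have hr0 : 0 < r := by omega
  have hrlt : r < p := by nlinarith
  -- find x < r with s x ≡ p mod r
  obtain ⟨x, hxr, hx⟩ : ∃ x : ℕ, x < r ∧ s * x ≡ p [MOD r] := by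
    haveI : NeZero r := ⟨by omega⟩
    refine ⟨((s : ZMod r)⁻¹ * p).val, ZMod.val_lt _, ?_⟩
    rw [← ZMod.natCast_eq_natCast_iff]
    push_cast
    rw [ZMod.natCast_zmod_val, ← mul_assoc, ZMod.coe_mul_inv_eq_one s hcop.symm, one_mul]
  have hsx : s * x < p := by nlinarith
  obtain ⟨y, hy⟩ := (Nat.modEq_iff_dvd' hsx.le).1 hx
  have hsum : s * x + r * y = p := by omega
  have hx0 : 0 < x := by
    rcases Nat.eq_zero_or_pos x with h | h
    · subst h
      have : r ∣ p := ⟨y, by simpa using hsum.symm⟩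
      rcases (Nat.dvd_prime hp).1 this with h | h <;> omega
    · exact h
  have hy0 : 0 < y := by
    rcases Nat.eq_zero_or_pos y with h | h
    · subst h; omega
    · exact h
  refine ⟨x, y, hx0, hy0, ?_, ?_, hsum, hxr⟩
  · obtain ⟨k, hk⟩ := hX
    have hk0 : 0 ≤ k := by
      by_contra h
      have : (p : ℤ) * k ≤ p * (-1) := by gcongr; omega
      have : (0 : ℤ) ≤ s * (X + 1) := by positivity
      omega
    rcases hk0.eq_or_lt with h | h
    · subst h
      have h1 : s * (X + 1) = r := by zify; linarith
      have h2 : s ∣ r := ⟨_, h1.symm⟩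
      have : s = 1 := by
        have := Nat.dvd_gcd h2 dvd_rfl
        rw [hcop] at this
        exact Nat.dvd_one.1 this
      subst this
      omega
    · have h1 : (p : ℤ) * 1 ≤ p * k := by gcongr; omega
      have h2 : s * x < s * (X + 1) := by zify; zify at hsx hr0; linarith
      have := Nat.lt_of_mul_lt_mul_left h2
      omega
  · obtain ⟨k, hk⟩ := hY
    have hk0 : 0 < k := by
      by_contra h
      have : (p : ℤ) * k ≤ p * 0 := by gcongr; omega
      have : (0 : ℤ) ≤ r * Y := by positivity
      zify at hsr
      linarith
    have h1 : (p : ℤ) * 1 ≤ p * k := by gcongr; omega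
    have h2 : r * y < r * (Y + 1) := by
      have : 0 ≤ s * x := by positivity
      zify at this hsum hs ⊢; linarith
    have := Nat.lt_of_mul_lt_mul_left h2
    omega

theorem final_aux (p r s x y N : ℕ) (hs : 0 < s) (hsr : s < r)
    (hx : x < r) (hsum : s * x + r * y = p) (hN : N ≤ x + y) :
    (N : ℝ) < (p : ℝ) / (r : ℕ) + (r : ℕ) - 1 := by
  have hr : (0 : ℝ) < r := by exact_mod_cast (by omega : 0 < r)
  have h1 : (N : ℝ) ≤ x + y := by exact_mod_cast hN
  have h2 : (s : ℝ) * x + r * y = p := by exact_mod_cast hsum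
  have h3 : (x : ℝ) + 1 ≤ r := by exact_mod_cast hx
  have h4 : (1 : ℝ) ≤ s := by exact_mod_cast hs
  have h5 : (s : ℝ) + 1 ≤ r := by exact_mod_cast hsr
  have h6 : (0 : ℝ) ≤ x := by positivity
  have : (x + y + 1 - r : ℝ) < p / r := by
    rw [lt_div_iff₀ hr, ← h2]
    nlinarith
  linarith

theorem lower_aux (p r s x y : ℕ) (hp : 0 < p) (hs : 0 < s) (hsr : s < r)
    (hx : 0 < x) (hd : p ∣ s * x + r * y) :
    (p : ℝ) / (r : ℕ) < (x + y : ℕ) := by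
  have hr : (0 : ℝ) < r := by exact_mod_cast (by omega : 0 < r)
  rw [div_lt_iff₀ hr]
  have := Nat.le_of_dvd (by positivity) hd
  have : p < (x + y) * r := by nlinarith
  exact_mod_cast this

/-- If `i ≡ s/(r-s) (mod p)` with `r, s` coprime, `0 < r, s < √p`, not both `1`, then
`p/max(r,s) < x_i + y_i < p/max(r,s) + max(r,s) - 1`. -/
theorem S_case_bound (p : ℕ) (hp : p.Prime) (i : ℕ) (hi1 : 1 ≤ i) (hi2 : i ≤ p - 2)
    (r s : ℕ) (hr : 0 < r) (hs : 0 < s)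
    (hrp : (r : ℝ) < Real.sqrt p) (hsp : (s : ℝ) < Real.sqrt p)
    (hcop : Nat.Coprime r s) (hne : ¬(r = 1 ∧ s = 1))
    (hcong : (p : ℤ) ∣ ((i : ℤ) * ((r : ℤ) - (s : ℤ)) - (s : ℤ))) :
    (p : ℝ) / (max r s : ℕ) < ((minPair p i).1 + (minPair p i).2 : ℕ) ∧
    ((minPair p i).1 + (minPair p i).2 : ℕ) < (p : ℝ) / (max r s : ℕ) + (max r s : ℕ) - 1 := by
  haveI : Fact p.Prime := ⟨hp⟩
  have hp2 := hp.two_le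
  have hr2 : r * r < p := by
    have := (Real.lt_sqrt (by positivity)).1 hrp
    rw [pow_two] at this
    exact_mod_cast this
  have hs2 : s * s < p := by
    have := (Real.lt_sqrt (by positivity)).1 hsp
    rw [pow_two] at this
    exact_mod_cast this
  have hslt : s < p := by nlinarith
  have hI : (i : ZMod p) * (r - s) = s := by
    have := (ZMod.intCast_zmod_eq_zero_iff_dvd _ p).2 hcong
    push_cast at this
    exact sub_eq_zero.1 this
  have hs0 : (s : ZMod p) ≠ 0 := by
    rw [Ne, ZMod.natCast_eq_zero_iff]
    exact fun h => by have := Nat.le_of_dvd hs h; omega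
  have hi0 : (i : ZMod p) ≠ 0 := by
    intro h; rw [h, zero_mul] at hI; exact hs0 hI.symm
  have hd0 : (r : ZMod p) - s ≠ 0 := by
    intro h; rw [h, mul_zero] at hI; exact hs0 hI.symm
  have hi1' : (i : ZMod p) + 1 ≠ 0 := by
    have : ((i + 1 : ℕ) : ZMod p) ≠ 0 := by
      rw [Ne, ZMod.natCast_eq_zero_iff]
      exact fun h => by have := Nat.le_of_dvd (by omega) h; omega
    exact_mod_cast this
  have hXc : (i : ZMod p) * (xmax p i : ZMod p) = 1 := by
    rw [xmax, ZMod.natCast_zmod_val, mul_inv_cancel₀ hi0]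
  have hYc : ((i : ZMod p) + 1) * (ymax p i : ZMod p) = -1 := by
    rw [ymax, ZMod.natCast_zmod_val, inv_neg, mul_neg, mul_inv_cancel₀ hi1']
  have hX : (p : ℤ) ∣ (s : ℤ) * (xmax p i + 1) - r := by
    rw [← ZMod.intCast_zmod_eq_zero_iff_dvd]
    push_cast
    linear_combination (-(xmax p i : ZMod p)) * hI + ((r : ZMod p) - s) * hXc
  have hY : (p : ℤ) ∣ (r : ℤ) * (ymax p i + 1) - s := by
    rw [← ZMod.intCast_zmod_eq_zero_iff_dvd]
    push_cast
    linear_combination (-(ymax p i : ZMod p)) * hI + ((r : ZMod p) - s) * hYc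
  have hiff : ∀ x y : ℕ, p ∣ i * x + (i + 1) * y ↔ p ∣ s * x + r * y := by
    intro x y
    rw [← ZMod.natCast_eq_zero_iff, ← ZMod.natCast_eq_zero_iff]
    push_cast
    have : (s : ZMod p) * x + r * y = (r - s) * (i * x + (i + 1) * y) := by
      linear_combination (-(x : ZMod p) - y) * hI
    rw [this, mul_eq_zero, or_iff_right hd0]
  have key : ∀ x y : ℕ, ValidPair p i (x, y) →
      ValidPair p i (minPair p i) ∧ (minPair p i).1 + (minPair p i).2 ≤ x + y := by
    intro x y hv
    have hex : ∃ xy, ValidPair p i xy ∧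
        ∀ xy', ValidPair p i xy' → xy.1 + xy.2 ≤ xy'.1 + xy'.2 := by
      have hwf := WellFounded.has_min (measure (fun xy : ℕ × ℕ => xy.1 + xy.2)).wf
        {xy | ValidPair p i xy} ⟨_, hv⟩
      obtain ⟨m, hm, hmin⟩ := hwf
      exact ⟨m, hm, fun xy' h => not_lt.1 (hmin xy' h)⟩
    have hspec := hex.choose_spec
    have heq : minPair p i = hex.choose := by rw [minPair, dif_pos hex]
    rw [← heq] at hspec
    exact ⟨hspec.1, hspec.2 _ hv⟩
  rcases lt_trichotomy s r with h | h | h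
  · rw [max_eq_left h.le]
    obtain ⟨x, y, hx0, hy0, hxX, hyY, hsum, hxr⟩ :=
      core_aux p hp r s _ _ hs h hr2 hcop hX hY
    obtain ⟨hv, hle⟩ := key x y ⟨hx0, hy0, hxX, hyY, (hiff x y).2 ⟨1, by omega⟩⟩
    exact ⟨lower_aux p r s _ _ hp.pos hs h hv.1 ((hiff _ _).1 hv.2.2.2.2),
      final_aux p r s x y _ hs h hxr hsum hle⟩
  · subst h
    exact absurd ((Nat.coprime_self _).1 hcop) (fun h => hne ⟨h, h⟩)
  · rw [max_eq_right h.le]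
    obtain ⟨y, x, hy0, hx0, hyY, hxX, hsum, hyr⟩ :=
      core_aux p hp s r _ _ hr h hs2 hcop.symm hY hX
    obtain ⟨hv, hle⟩ := key x y ⟨hx0, hy0, hxX, hyY, (hiff x y).2 ⟨1, by omega⟩⟩
    refine ⟨?_, final_aux p s r y x _ hr h hyr hsum (by omega)⟩
    rw [add_comm (minPair p i).1]
    refine lower_aux p s r _ _ hp.pos hr h hv.2.1 ?_
    rw [add_comm]
    exact (hiff _ _).1 hv.2.2.2.2
end

section
/- Let p be a prime, let 1 ≤ i ≤ p − 2, and suppose r, s are coprime integers with 0 < r < s < √p and i·(r − s) ≡ s (mod p). Let a be the unique integer with 0 < a < rs, r ∣ a, and s ∣ (p − a). Then (x_i, y_i) = ((p − a)/s, a/r). -/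
set_option maxHeartbeats 1000000 in
/-- If `i ≡ s/(r-s) (mod p)` with `r, s` coprime and `0 < r < s < √p`, and `a` is the
unique integer with `0 < a < r·s`, `r ∣ a`, `s ∣ (p - a)`, then
`(x_i, y_i) = ((p - a)/s, a/r)`. -/
theorem S_case_exact (p : ℕ) (hp : p.Prime) (i : ℕ) (hi1 : 1 ≤ i) (hi2 : i ≤ p - 2)
    (r s : ℕ) (hr : 0 < r) (hrs : r < s) (hsp : (s : ℝ) < Real.sqrt p)
    (hcop : Nat.Coprime r s)
    (hcong : (p : ℤ) ∣ ((i : ℤ) * ((r : ℤ) - (s : ℤ)) - (s : ℤ)))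
    (a : ℕ) (ha0 : 0 < a) (hars : a < r * s) (hra : r ∣ a) (hsa : s ∣ (p - a)) :
    minPair p i = ((p - a) / s, a / r) := by
  have hp2 := hp.two_le
  have hssp : s * s < p := by
    have h0 : (0 : ℝ) ≤ (s : ℝ) := by positivity
    have h1 := (Real.lt_sqrt h0).1 hsp
    have h2 : ((s * s : ℕ) : ℝ) < (p : ℝ) := by push_cast; nlinarith
    exact_mod_cast h2
  have hrss : r * s < s * s := by nlinarith
  have hap : a < p := by omega
  obtain ⟨y0, rfl⟩ := hra
  obtain ⟨x0, hx0⟩ := hsa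
  have hs0 : 0 < s := by omega
  rw [hx0, Nat.mul_div_cancel_left _ hr, Nat.mul_div_cancel_left _ hs0]
  have hpe : p = s * x0 + r * y0 := by omega
  have hy0 : 0 < y0 := by
    rcases Nat.eq_zero_or_pos y0 with h | h
    · subst h; simp at ha0
    · exact h
  have hx0p : 0 < x0 := by
    rcases Nat.eq_zero_or_pos x0 with h | h
    · subst h; omega
    · exact h
  have hy0s : y0 < s := lt_of_mul_lt_mul_left hars (Nat.zero_le r)
  have hsp' : s < p := by nlinarith
  have : Fact p.Prime := ⟨hp⟩
  have hc : ((i : ZMod p)) * ((r : ZMod p) - s) = s := by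
    have := (ZMod.intCast_zmod_eq_zero_iff_dvd _ p).2 hcong
    push_cast at this
    linear_combination this
  have hi0 : (i : ZMod p) ≠ 0 := by
    intro h
    have := Nat.le_of_dvd (by omega) ((ZMod.natCast_eq_zero_iff i p).1 h)
    omega
  have hi10 : (i : ZMod p) + 1 ≠ 0 := by
    intro h
    have h' : ((i + 1 : ℕ) : ZMod p) = 0 := by push_cast; exact h
    have := Nat.le_of_dvd (by omega) ((ZMod.natCast_eq_zero_iff (i+1) p).1 h')
    omega
  have hxm : (i : ZMod p) * (xmax p i : ZMod p) = 1 := by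
    unfold xmax
    rw [ZMod.natCast_zmod_val]
    exact mul_inv_cancel₀ hi0
  have hym : (-((i : ZMod p) + 1)) * (ymax p i : ZMod p) = 1 := by
    unfold ymax
    rw [ZMod.natCast_zmod_val]
    exact mul_inv_cancel₀ (neg_ne_zero.2 hi10)
  have hX : x0 ≤ xmax p i := by
    have h1 : (p : ℤ) ∣ (s : ℤ) * (xmax p i + 1) - r := by
      rw [← ZMod.intCast_zmod_eq_zero_iff_dvd]
      push_cast
      linear_combination ((r : ZMod p) - s) * hxm - (xmax p i : ZMod p) * hc
    have h2 : (0 : ℤ) < (s : ℤ) * (xmax p i + 1) - r := by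
      have : (0 : ℤ) ≤ (s : ℤ) * (xmax p i) := by positivity
      have : (r : ℤ) < s := by exact_mod_cast hrs
      linarith
    have h3 := Int.le_of_dvd h2 h1
    have h4 : s * x0 < s * (xmax p i + 1) := by
      zify
      zify at hpe ha0 hr
      linarith
    have := lt_of_mul_lt_mul_left h4 (Nat.zero_le s)
    omega
  have hY : y0 ≤ ymax p i := by
    have h1 : (p : ℤ) ∣ (r : ℤ) * (ymax p i + 1) - s := by
      rw [← ZMod.intCast_zmod_eq_zero_iff_dvd]
      push_cast
      linear_combination (-((r : ZMod p) - s)) * hym - (ymax p i : ZMod p) * hc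
    obtain ⟨k, hk⟩ := h1
    have hk0 : 0 ≤ k := by
      by_contra hneg
      have h5 : k ≤ -1 := by omega
      have h6 : (p : ℤ) * k ≤ -p := by nlinarith
      have h7 : (0 : ℤ) ≤ (r : ℤ) * (ymax p i + 1) := by positivity
      have h8 : (s : ℤ) < p := by exact_mod_cast hsp'
      linarith
    rcases hk0.eq_or_lt with h | h
    · subst h
      have h9 : r * (ymax p i + 1) = s := by
        zify; linarith
      have h10 : r = 1 := Nat.Coprime.eq_one_of_dvd hcop ⟨_, h9.symm⟩
      subst h10
      omega
    · have h6 : (p : ℤ) ≤ p * k := by nlinarith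
      have h4 : r * y0 < r * (ymax p i + 1) := by
        zify
        zify at hap hs0
        linarith
      have := lt_of_mul_lt_mul_left h4 (Nat.zero_le r)
      omega
  have hrs0 : ((r : ZMod p) - s) ≠ 0 := by
    intro h
    have h1 : ((s - r : ℕ) : ZMod p) = 0 := by
      rw [Nat.cast_sub hrs.le]; linear_combination -h
    have := Nat.le_of_dvd (by omega) ((ZMod.natCast_eq_zero_iff _ p).1 h1)
    omega
  have hvalid : ValidPair p i (x0, y0) := by
    refine ⟨hx0p, hy0, hX, hY, ?_⟩
    rw [← ZMod.natCast_eq_zero_iff]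
    push_cast
    apply (mul_eq_zero.1 _).resolve_left hrs0
    have h1 : ((s * x0 + r * y0 : ℕ) : ZMod p) = 0 := by
      rw [← hpe]; simp
    push_cast at h1
    linear_combination h1 + ((x0 : ZMod p) + y0) * hc
  have key : ∀ x y : ℕ, ValidPair p i (x, y) → x + y ≤ x0 + y0 → x = x0 ∧ y = y0 := by
    rintro x y ⟨hx, hy, -, -, hd⟩ hle
    simp only at hx hy hd
    have h1 : p ∣ s * x + r * y := by
      rw [← ZMod.natCast_eq_zero_iff] at hd ⊢
      push_cast at hd ⊢
      linear_combination ((r : ZMod p) - s) * hd - ((x : ZMod p) + y) * hc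
    obtain ⟨k, hk⟩ := h1
    have hlt : s * x + r * y < 2 * p := by
      have e1 : s * (x + y) ≤ s * (x0 + y0) := Nat.mul_le_mul_left _ hle
      have e2 : r * y ≤ s * y := Nat.mul_le_mul_right _ hrs.le
      have e3 : s * y0 < s * s := Nat.mul_lt_mul_of_pos_left hy0s hs0
      nlinarith
    have hpos : 0 < s * x + r * y := by positivity
    have hk1 : k = 1 := by
      have : k < 2 := by
        by_contra h
        have : p * 2 ≤ p * k := Nat.mul_le_mul_left _ (by omega)
        omega
      have : k ≠ 0 := by rintro rfl; omega
      omega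
    subst hk1
    have he : (s : ℤ) * (x - x0) = r * (y0 - y) := by
      zify at hk hpe
      linarith
    have hcz : IsCoprime (s : ℤ) (r : ℤ) := Nat.isCoprime_iff_coprime.2 hcop.symm
    obtain ⟨t, ht⟩ : (s : ℤ) ∣ (y0 - y : ℤ) := hcz.dvd_of_dvd_mul_left ⟨_, he.symm⟩
    have hsz : (0 : ℤ) < s := by exact_mod_cast hs0
    have hrsz : (r : ℤ) < s := by exact_mod_cast hrs
    have hxt : (x - x0 : ℤ) = r * t := by
      apply mul_left_cancel₀ hsz.ne'
      rw [he, ht]; ring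
    have ht1 : t < 1 := by
      by_contra h
      have : (s : ℤ) * 1 ≤ s * t := mul_le_mul_of_nonneg_left (by omega) hsz.le
      zify at hy0s hy
      linarith
    have ht2 : 0 ≤ t := by
      zify at hle
      by_contra h
      have h1 : (0 : ℤ) < (s - r) * (-t) := mul_pos (by linarith) (by omega)
      linarith
    have ht0 : t = 0 := by omega
    subst ht0
    rw [mul_zero] at ht hxt
    omega
  have hex : ∃ xy, ValidPair p i xy ∧
      ∀ xy', ValidPair p i xy' → xy.1 + xy.2 ≤ xy'.1 + xy'.2 := by
    refine ⟨(x0, y0), hvalid, ?_⟩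
    rintro ⟨x, y⟩ hv
    by_contra h
    simp only [not_le] at h
    have := key x y hv h.le
    omega
  unfold minPair
  rw [dif_pos hex]
  have hs := hex.choose_spec
  have := key _ _ hs.1 (hs.2 _ hvalid)
  exact Prod.ext this.1 this.2
end

section
/- Let p be a prime, let 1 ≤ i ≤ p − 2, and suppose r, s are coprime integers with 0 < r, s < √p, (r,s) ≠ (1,1), and i·(r − s) ≡ s (mod p). Then x_i + y_i < p/max(r,s) + max(r,s) − min(r,s). -/
theorem minPair_le (p i : ℕ) (xy : ℕ × ℕ) (h : ValidPair p i xy) :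
    (minPair p i).1 + (minPair p i).2 ≤ xy.1 + xy.2 := by
  have hex : ∃ xy, ValidPair p i xy ∧
      ∀ xy', ValidPair p i xy' → xy.1 + xy.2 ≤ xy'.1 + xy'.2 := by
    obtain ⟨m, hm, hmin⟩ := WellFounded.has_min
      (InvImage.wf (fun q : ℕ × ℕ => q.1 + q.2) Nat.lt_wfRel.wf) {q | ValidPair p i q} ⟨xy, h⟩
    exact ⟨m, hm, fun q hq => not_lt.mp (hmin q hq)⟩
  unfold minPair
  rw [dif_pos hex]
  exact hex.choose_spec.2 xy h

theorem aux_exists (p a b : ℕ) (hp : p.Prime) (hb : 0 < b) (hab : b < a) (hcop : Nat.Coprime a b)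
    (hap : a * a < p) : ∃ u v : ℕ, 0 < u ∧ 0 < v ∧ u < a ∧ b * u + a * v = p := by
  have : NeZero a := ⟨by omega⟩
  have ha1 : 1 < a := by omega
  have : Fact (1 < a) := ⟨ha1⟩
  let z : ZMod a := (p : ZMod a) * (b : ZMod a)⁻¹
  have hbz : (b : ZMod a) * (b : ZMod a)⁻¹ = 1 := ZMod.coe_mul_inv_eq_one b hcop.symm
  have hua : z.val < a := ZMod.val_lt z
  have hz : ((b * z.val : ℕ) : ZMod a) = (p : ℕ) := by
    push_cast
    rw [ZMod.natCast_zmod_val]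
    calc (b : ZMod a) * (p * (b : ZMod a)⁻¹) = p * (b * (b : ZMod a)⁻¹) := by ring
      _ = p := by rw [hbz, mul_one]
  have hlt : b * z.val < p := by nlinarith
  have hmod := (ZMod.natCast_eq_natCast_iff _ _ _).mp hz
  obtain ⟨v, hv⟩ := (Nat.modEq_iff_dvd' hlt.le).mp hmod
  refine ⟨z.val, v, ?_, ?_, hua, by omega⟩
  · rcases Nat.eq_zero_or_pos z.val with h0 | h0
    · rw [h0] at hv
      have : a ∣ p := ⟨v, by simpa using hv⟩
      rcases (Nat.dvd_prime hp).mp this with h | h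
      · omega
      · nlinarith
    · exact h0
  · rcases Nat.eq_zero_or_pos v with h0 | h0
    · subst h0; omega
    · exact h0

theorem aux_bound (p r s x y X : ℕ) (hr : 0 < r) (hrp : r < p) (hcop : Nat.Coprime r s)
    (hxy : s * x + r * y = p) (hs : 0 < s)
    (h : x < r ∨ r < s) (hX : ((s * (X + 1) : ℕ) : ZMod p) = (r : ℕ)) : x ≤ X := by
  have hmod := (ZMod.natCast_eq_natCast_iff _ _ _).mp hX
  have h1 : s * (X + 1) % p = r := by
    rw [hmod]; exact Nat.mod_eq_of_lt hrp
  have h2 := Nat.div_add_mod (s * (X + 1)) p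
  rw [h1] at h2
  by_contra hlt
  have h3 : s * (X + 1) ≤ s * x := Nat.mul_le_mul_left s (by omega)
  rcases Nat.eq_zero_or_pos (s * (X + 1) / p) with h0 | h0
  · rw [h0] at h2
    have hd : s ∣ r := ⟨X + 1, by omega⟩
    have hs1 : s = 1 := Nat.eq_one_of_dvd_coprimes hcop hd dvd_rfl
    subst hs1
    omega
  · have : p ≤ p * (s * (X + 1) / p) := Nat.le_mul_of_pos_right p h0
    omega

/-- If `i ≡ s/(r-s) (mod p)` with `r, s` coprime, `0 < r, s < √p`, not both `1`, then
`x_i + y_i < p/max(r,s) + max(r,s) - min(r,s)`. -/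
theorem S_case_stronger_bound (p : ℕ) (hp : p.Prime) (i : ℕ) (hi1 : 1 ≤ i) (hi2 : i ≤ p - 2)
    (r s : ℕ) (hr : 0 < r) (hs : 0 < s)
    (hrp : (r : ℝ) < Real.sqrt p) (hsp : (s : ℝ) < Real.sqrt p)
    (hcop : Nat.Coprime r s) (hne : ¬(r = 1 ∧ s = 1))
    (hcong : (p : ℤ) ∣ ((i : ℤ) * ((r : ℤ) - (s : ℤ)) - (s : ℤ))) :
    (((minPair p i).1 + (minPair p i).2 : ℕ) : ℝ) <
      (p : ℝ) / (max r s : ℕ) + (max r s : ℕ) - (min r s : ℕ) := by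
  have hF : Fact p.Prime := ⟨hp⟩
  have hrr : r * r < p := by
    have := (Real.lt_sqrt (by positivity)).mp hrp
    rw [sq] at this; exact_mod_cast this
  have hss : s * s < p := by
    have := (Real.lt_sqrt (by positivity)).mp hsp
    rw [sq] at this; exact_mod_cast this
  have hrp' : r < p := by nlinarith
  have hsp' : s < p := by nlinarith
  have hr0 : (r : ZMod p) ≠ 0 := fun h =>
    absurd (Nat.le_of_dvd hr ((ZMod.natCast_eq_zero_iff _ _).mp h)) (by omega)
  have hs0 : (s : ZMod p) ≠ 0 := fun h =>
    absurd (Nat.le_of_dvd hs ((ZMod.natCast_eq_zero_iff _ _).mp h)) (by omega)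
  have hc : (i : ZMod p) * (r - s) = s := by
    have := (ZMod.intCast_zmod_eq_zero_iff_dvd _ p).mpr hcong
    push_cast at this
    exact sub_eq_zero.mp this
  have hc' : ((i : ZMod p) + 1) * (r - s) = r := by linear_combination hc
  have hi0 : (i : ZMod p) ≠ 0 := fun h => hs0 (by rw [← hc, h, zero_mul])
  have hi10 : (i : ZMod p) + 1 ≠ 0 := fun h => hr0 (by rw [← hc', h, zero_mul])
  have hd0 : (r : ZMod p) - s ≠ 0 := fun h => hs0 (by rw [← hc, h, mul_zero])
  have hX : ((s * (xmax p i + 1) : ℕ) : ZMod p) = (r : ℕ) := by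
    unfold xmax
    push_cast
    rw [ZMod.natCast_zmod_val]
    have := mul_inv_cancel₀ hi0
    linear_combination ((r : ZMod p) - s) * this - (i : ZMod p)⁻¹ * hc
  have hY : ((r * (ymax p i + 1) : ℕ) : ZMod p) = (s : ℕ) := by
    unfold ymax
    push_cast
    rw [ZMod.natCast_zmod_val]
    have := mul_inv_cancel₀ (neg_ne_zero.mpr hi10)
    linear_combination -((r : ZMod p) - s) * this - (-((i : ZMod p) + 1))⁻¹ * hc'
  have key : ∀ x y : ℕ, 0 < x → 0 < y → s * x + r * y = p → (x < r ∨ r < s) → (y < s ∨ s < r) →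
      ValidPair p i (x, y) := by
    intro x y hx hy hxy h1 h2
    refine ⟨hx, hy, aux_bound p r s x y _ hr hrp' hcop hxy hs h1 hX,
      aux_bound p s r y x _ hs hsp' hcop.symm (by omega) hr h2 hY, ?_⟩
    rw [← ZMod.natCast_eq_zero_iff]
    have h3 : ((s * x + r * y : ℕ) : ZMod p) = 0 := by rw [hxy]; simp
    push_cast at h3 ⊢
    refine (mul_eq_zero.mp ?_).resolve_left hd0
    linear_combination h3 + x * hc + y * hc'
  have fin : ∀ a b u v : ℕ, b < a → u < a → b * u + a * v = p →
      ((u + v : ℕ) : ℝ) < (p : ℝ) / a + a - b := by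
    intro a b u v hb hu he
    have ha : (0 : ℝ) < a := by exact_mod_cast (by omega : 0 < a)
    have hb' : (b : ℝ) < a := by exact_mod_cast hb
    have hu' : (u : ℝ) < a := by exact_mod_cast hu
    have he' : (p : ℝ) = b * u + a * v := by exact_mod_cast he.symm
    have : (p : ℝ) / a + a - b = (u + v) + (a - u) * (a - b) / a := by
      rw [he']; field_simp; ring
    rw [this]
    have : 0 < ((a : ℝ) - u) * (a - b) / a :=
      div_pos (mul_pos (by linarith) (by linarith)) ha
    push_cast
    linarith
  rcases lt_trichotomy r s with h | h | h
  · obtain ⟨u, v, hu, hv, hus, he⟩ := aux_exists p s r hp hr h hcop.symm hss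
    have hV := minPair_le p i _ (key v u hv hu (by omega) (Or.inr h) (Or.inl hus))
    rw [max_eq_right h.le, min_eq_left h.le]
    refine lt_of_le_of_lt ?_ (fin s r u v h hus he)
    exact_mod_cast (by simpa [add_comm] using hV)
  · subst h
    simp at hcop
    exact absurd ⟨hcop, hcop⟩ hne
  · obtain ⟨u, v, hu, hv, hus, he⟩ := aux_exists p r s hp hs h hcop hrr
    have hV := minPair_le p i _ (key u v hu hv he (Or.inl hus) (Or.inr h))
    rw [max_eq_left h.le, min_eq_right h.le]
    refine lt_of_le_of_lt ?_ (fin r s u v h hus he)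
    exact_mod_cast hV
end

section
/- Let p be a prime and let 1 ≤ i ≤ p − 2 with i ∈ T. Suppose r, s are coprime integers with 0 < r, s < √p and i·(r + s) ≡ −s (mod p). Then x_i + y_i ≤ r + s. -/
/-- If `i ∈ T` (i.e. `i` has no representation `i ≡ s/(r-s) (mod p)` with `r, s`
coprime, `0 < r, s < √p`, not both `1`), and `i ≡ -s/(r+s) (mod p)` with `r, s`
coprime and `0 < r, s < √p`, then `x_i + y_i ≤ r + s`. -/
theorem T_case_bound (p : ℕ) (hp : p.Prime) (i : ℕ) (hi1 : 1 ≤ i) (hi2 : i ≤ p - 2)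
    (hT : ¬ ∃ r s : ℕ, 0 < r ∧ 0 < s ∧ (r : ℝ) < Real.sqrt p ∧ (s : ℝ) < Real.sqrt p ∧
      Nat.Coprime r s ∧ ¬(r = 1 ∧ s = 1) ∧
      (p : ℤ) ∣ ((i : ℤ) * ((r : ℤ) - (s : ℤ)) - (s : ℤ)))
    (r s : ℕ) (hr : 0 < r) (hs : 0 < s)
    (hrp : (r : ℝ) < Real.sqrt p) (hsp : (s : ℝ) < Real.sqrt p)
    (hcop : Nat.Coprime r s)
    (hcong : (p : ℤ) ∣ ((i : ℤ) * ((r : ℤ) + (s : ℤ)) + (s : ℤ))) :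
    (minPair p i).1 + (minPair p i).2 ≤ r + s := by
  haveI : Fact p.Prime := ⟨hp⟩
  have hp2 := hp.two_le
  have hi0 : (i : ZMod p) ≠ 0 := by
    intro h
    rw [ZMod.natCast_eq_zero_iff] at h
    have := Nat.le_of_dvd (by omega) h
    omega
  have hi1' : (i : ZMod p) + 1 ≠ 0 := by
    intro h
    have h' : ((i + 1 : ℕ) : ZMod p) = 0 := by push_cast; exact h
    rw [ZMod.natCast_eq_zero_iff] at h'
    have := Nat.le_of_dvd (by omega) h'
    omega
  have hX : ((xmax p i : ℕ) : ZMod p) = (i : ZMod p)⁻¹ := by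
    unfold xmax; exact ZMod.natCast_zmod_val _
  have hY : ((ymax p i : ℕ) : ZMod p) = (-((i : ZMod p) + 1))⁻¹ := by
    unfold ymax; exact ZMod.natCast_zmod_val _
  have hXpos : 0 < xmax p i := by
    rcases Nat.eq_zero_or_pos (xmax p i) with h | h
    · rw [h] at hX
      simp at hX
      exact absurd (by simpa using hX.symm) hi0
    · exact h
  have hYpos : 0 < ymax p i := by
    rcases Nat.eq_zero_or_pos (ymax p i) with h | h
    · rw [h, Nat.cast_zero] at hY
      exact absurd hY.symm (inv_ne_zero (neg_ne_zero.mpr hi1'))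
    · exact h
  have one_lt : (1 : ℝ) < Real.sqrt p := by
    rw [Real.lt_sqrt (by norm_num)]
    norm_num
    omega
  have hrX : r ≤ xmax p i := by
    by_contra hlt
    push Not at hlt
    refine hT ⟨xmax p i + 1, 1, by omega, by omega, ?_, by simpa using one_lt, by simp, by omega, ?_⟩
    · refine lt_of_le_of_lt ?_ hrp
      exact_mod_cast hlt
    · rw [← ZMod.intCast_zmod_eq_zero_iff_dvd]
      push_cast
      rw [hX]
      field_simp
      ring
  have hsY : s ≤ ymax p i := by
    by_contra hlt
    push Not at hlt
    refine hT ⟨1, ymax p i + 1, by omega, by omega, by simpa using one_lt, ?_, by simp, by omega, ?_⟩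
    · refine lt_of_le_of_lt ?_ hsp
      exact_mod_cast hlt
    · rw [← ZMod.intCast_zmod_eq_zero_iff_dvd]
      push_cast
      rw [hY, inv_neg]
      field_simp
      ring
  have hv : ValidPair p i (r, s) := by
    refine ⟨hr, hs, hrX, hsY, ?_⟩
    zify
    convert hcong using 1
    ring
  have hex : ∃ xy, ValidPair p i xy ∧
      ∀ xy', ValidPair p i xy' → xy.1 + xy.2 ≤ xy'.1 + xy'.2 := by
    obtain ⟨m, hm, hmin⟩ := WellFounded.has_min
      (InvImage.wf (fun q : ℕ × ℕ => q.1 + q.2) Nat.lt_wfRel.wf) {q | ValidPair p i q} ⟨_, hv⟩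
    exact ⟨m, hm, fun q hq => not_lt.mp (hmin q hq)⟩
  have : minPair p i = hex.choose := by
    unfold minPair
    rw [dif_pos hex]
  rw [this]
  exact hex.choose_spec.2 _ hv
end
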